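/- For every n ≥ 4: if 𝒮 is a family of distinct 3-element subsets with U(𝒮) = [n] and the union-closed family ⟨𝒮⟩ generated by 𝒮 is Non–Frankl-Complete, then 2·|𝒮| ≤ n (i.e., NFC(3,n) ≤ n/2). -/

import Mathlib

/-- A family of sets is union-closed. -/
def UC (F : Finset (Finset ℕ)) : Prop := ∀ A ∈ F, ∀ B ∈ F, A ∪ B ∈ F

/-- `famU F` is the union `U(F)` of all members of the family `F`. -/
def famU (F : Finset (Finset ℕ)) : Finset ℕ := F.sup id

/-- `memFam F i` is the subfamily `F_i` of sets in `F` containing `i`. -/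
def memFam (F : Finset (Finset ℕ)) (i : ℕ) : Finset (Finset ℕ) :=
  F.filter (fun S => i ∈ S)

/-- `A` is Non–Frankl-Complete: some union-closed family containing `A` has every
element of `U(A)` in fewer than half of its sets. -/
def NonFC (A : Finset (Finset ℕ)) : Prop :=
  ∃ F : Finset (Finset ℕ), UC F ∧ A ⊆ F ∧
    ∀ i ∈ famU A, 2 * (memFam F i).card < F.card

/-- `gen S` is the union-closed family generated by `S`: the smallest
union-closed family containing `S`, given explicitly as all unions of
nonempty subfamilies of `S`. -/
def gen (S : Finset (Finset ℕ)) : Finset (Finset ℕ) :=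
  (S.powerset.filter (fun T => T.Nonempty)).image (fun T => T.sup id)

/-- The set of those listed vertices whose position is a set bit of the mask. -/
def decodeSet : List ℕ → ℕ → Finset ℕ
  | [], _ => ∅
  | v :: vs, m => if m % 2 = 1 then insert v (decodeSet vs (m / 2)) else decodeSet vs (m / 2)

theorem decodeSet_lor (vs : List ℕ) (a b : ℕ) :
    decodeSet vs (a ||| b) = decodeSet vs a ∪ decodeSet vs b := by
  induction vs generalizing a b with
  | nil => simp [decodeSet]
  | cons v vs ih =>
    have hmod : (a ||| b) % 2 = 1 ↔ a % 2 = 1 ∨ b % 2 = 1 := Nat.or_mod_two_eq_one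
    have hdiv : (a ||| b) / 2 = a / 2 ||| b / 2 := Nat.or_div_two
    simp only [decodeSet, hmod, hdiv, ih]
    by_cases ha : a % 2 = 1 <;> by_cases hb : b % 2 = 1 <;> ext x <;> simp [ha, hb]

theorem decodeSet_zero (vs : List ℕ) : decodeSet vs 0 = ∅ := by
  induction vs with
  | nil => rfl
  | cons v vs ih => simp [decodeSet, ih]

/-- Total signed weight of `G`: a listed vertex contributes `-w` if it lies in `G`, else `w`. -/
def signedWeight : List ℤ → List ℕ → Finset ℕ → ℤ
  | w :: ws, v :: vs, G => (if v ∈ G then -w else w) + signedWeight ws vs G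
  | _, _, _ => 0

/-- The entries of `L` whose index has lowest bit `b`, with that bit removed. -/
def bitPart (b : ℕ) : List (ℤ × ℕ) → List (ℤ × ℕ)
  | [] => []
  | (c, m) :: L => bif Nat.beq (m % 2) b then (c, m / 2) :: bitPart b L else bitPart b L

/-- The sum of the coefficients in `L`. -/
def coeffSum : List (ℤ × ℕ) → ℤ
  | [] => 0
  | (c, _) :: L => c + coeffSum L

/-- Checks that for every mask `m` the coefficients of `L` at `m`, together with `acc` plus the
signed weight of `m`, add up to at most `0`. -/
def checkSum : List ℤ → ℤ → List (ℤ × ℕ) → Bool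
  | [], acc, L => decide (acc + coeffSum L ≤ 0)
  | w :: ws, acc, L => checkSum ws (acc + w) (bitPart 0 L) && checkSum ws (acc - w) (bitPart 1 L)

/-- The value of the formal linear combination `L` of masks under `x`. -/
def evalSum (x : Finset ℕ → ℤ) (vs : List ℕ) : List (ℤ × ℕ) → ℤ
  | [] => 0
  | (c, m) :: L => c * x (decodeSet vs m) + evalSum x vs L

theorem evalSum_nil (x : Finset ℕ → ℤ) (L : List (ℤ × ℕ)) :
    evalSum x [] L = coeffSum L * x ∅ := by
  induction L with
  | nil => simp [evalSum, coeffSum]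
  | cons p L ih => simp only [evalSum, coeffSum, decodeSet, ih]; ring

theorem evalSum_cons (x : Finset ℕ → ℤ) (v : ℕ) (vs : List ℕ) (L : List (ℤ × ℕ)) :
    evalSum x (v :: vs) L =
      evalSum x vs (bitPart 0 L) + evalSum (fun P => x (insert v P)) vs (bitPart 1 L) := by
  induction L with
  | nil => simp [evalSum, bitPart]
  | cons p L ih =>
    obtain ⟨c, m⟩ := p
    rcases Nat.mod_two_eq_zero_or_one m with hm | hm
    · simp only [evalSum, bitPart, decodeSet, hm, ih, show Nat.beq 0 0 = true from rfl,
        show Nat.beq 0 1 = false from rfl, cond_true, cond_false, zero_ne_one, if_false]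
      ring
    · simp only [evalSum, bitPart, decodeSet, hm, ih, show Nat.beq 1 0 = false from rfl,
        show Nat.beq 1 1 = true from rfl, cond_true, cond_false, if_true]
      ring

theorem checkSum_sound (ws : List ℤ) (vs : List ℕ) (acc : ℤ) (L : List (ℤ × ℕ))
    (x : Finset ℕ → ℤ) (hx : ∀ P, 0 ≤ x P) (hlen : vs.length = ws.length) (hnd : vs.Nodup)
    (hcheck : checkSum ws acc L = true) :
    ∑ P ∈ vs.toFinset.powerset, (acc + signedWeight ws vs P) * x P + evalSum x vs L ≤ 0 := by
  induction ws generalizing vs acc L x with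
  | nil =>
    obtain rfl : vs = [] := List.eq_nil_of_length_eq_zero hlen
    simp only [checkSum, decide_eq_true_eq] at hcheck
    simp only [evalSum_nil, signedWeight, List.toFinset_nil, Finset.powerset_empty,
      Finset.sum_singleton]
    nlinarith [hx ∅]
  | cons w ws ih =>
    cases vs with
    | nil => simp at hlen
    | cons v vs =>
      simp only [checkSum, Bool.and_eq_true] at hcheck
      obtain ⟨hv, hnd⟩ := List.nodup_cons.mp hnd
      have hv' : v ∉ vs.toFinset := by simpa using hv
      have h0 := ih vs _ _ x hx (by simpa using hlen) hnd hcheck.1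
      have h1 := ih vs _ _ (fun P => x (insert v P)) (fun P => hx _) (by simpa using hlen) hnd
        hcheck.2
      have hins : ∀ (ws : List ℤ) (us : List ℕ) (P : Finset ℕ), v ∉ us →
          signedWeight ws us (insert v P) = signedWeight ws us P := by
        intro ws us P
        induction ws generalizing us with
        | nil => simp [signedWeight]
        | cons w ws ih =>
          cases us with
          | nil => simp [signedWeight]
          | cons u us =>
            intro hu
            simp only [List.mem_cons, not_or] at hu
            simp [signedWeight, ih us hu.2, Ne.symm hu.1]
      rw [List.toFinset_cons, Finset.sum_powerset_insert hv', evalSum_cons]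
      have e0 : ∑ P ∈ vs.toFinset.powerset, (acc + signedWeight (w :: ws) (v :: vs) P) * x P =
          ∑ P ∈ vs.toFinset.powerset, (acc + w + signedWeight ws vs P) * x P := by
        refine Finset.sum_congr rfl fun P hP => ?_
        have : v ∉ P := fun h => hv' (Finset.mem_powerset.mp hP h)
        simp only [signedWeight, this, if_false, add_assoc]
      have e1 : ∑ P ∈ vs.toFinset.powerset,
          (acc + signedWeight (w :: ws) (v :: vs) (insert v P)) * x (insert v P) =
          ∑ P ∈ vs.toFinset.powerset, (acc - w + signedWeight ws vs P) * x (insert v P) := by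
        refine Finset.sum_congr rfl fun P hP => ?_
        simp only [signedWeight, Finset.mem_insert_self, if_true, hins ws vs P hv]
        ring
      rw [e0, e1]
      linarith

/-- Summing over `F` amounts to summing over the traces on `V` of each fibre of `G ↦ G \ V`. -/
theorem sum_eq_sum_fibers (F : Finset (Finset ℕ)) (V : Finset ℕ) (φ : Finset ℕ → ℤ)
    (hφ : ∀ P T, Disjoint T V → φ (P ∪ T) = φ P) :
    ∑ G ∈ F, φ G =
      ∑ T ∈ F.image (· \ V), ∑ P ∈ V.powerset, φ P * (if P ∪ T ∈ F then 1 else 0) := by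
  rw [← Finset.sum_fiberwise_of_maps_to (g := (· \ V)) (t := F.image (· \ V))
    (fun G hG => Finset.mem_image_of_mem _ hG)]
  refine Finset.sum_congr rfl fun T hT => ?_
  have hTV : Disjoint T V := by
    obtain ⟨G, -, rfl⟩ := Finset.mem_image.mp hT
    exact Finset.sdiff_disjoint
  simp only [mul_ite, mul_one, mul_zero]
  rw [← Finset.sum_filter]
  symm
  refine Finset.sum_nbij' (fun P => P ∪ T) (fun G => G ∩ V) ?_ ?_ ?_ ?_ ?_
  · intro P hP
    simp only [Finset.mem_filter, Finset.mem_powerset] at hP ⊢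
    refine ⟨hP.2, ?_⟩
    rw [Finset.union_sdiff_distrib, Finset.sdiff_eq_empty_iff_subset.mpr hP.1, Finset.empty_union,
      Finset.sdiff_eq_self_of_disjoint hTV]
  · intro G hG
    simp only [Finset.mem_filter, Finset.mem_powerset] at hG ⊢
    refine ⟨Finset.inter_subset_right, ?_⟩
    rw [← hG.2, Finset.union_comm, Finset.sdiff_union_inter]
    exact hG.1
  · intro P hP
    simp only [Finset.mem_filter, Finset.mem_powerset] at hP
    rw [Finset.union_inter_distrib_right, Finset.inter_eq_left.mpr hP.1,
      Finset.disjoint_iff_inter_eq_empty.mp hTV, Finset.union_empty]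
  · intro G hG
    simp only [Finset.mem_filter] at hG
    rw [← hG.2, Finset.union_comm, Finset.sdiff_union_inter]
  · intro P _
    exact (hφ P T hTV).symm

theorem signedWeight_union (ws : List ℤ) (vs : List ℕ) (P T : Finset ℕ)
    (hT : Disjoint T vs.toFinset) : signedWeight ws vs (P ∪ T) = signedWeight ws vs P := by
  induction ws generalizing vs with
  | nil => simp [signedWeight]
  | cons w ws ih =>
    cases vs with
    | nil => simp [signedWeight]
    | cons v vs =>
      rw [List.toFinset_cons, Finset.disjoint_insert_right] at hT
      simp [signedWeight, hT.1, ih vs hT.2]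

/-- The union of the edges (as bit masks) contained in `Z`. -/
def hull : List ℕ → ℕ → ℕ
  | [], _ => 0
  | e :: es, Z => bif Nat.beq (e ||| Z) Z then e ||| hull es Z else hull es Z

theorem union_hull_mem {F : Finset (Finset ℕ)} (hF : UC F) (vs es : List ℕ)
    (hes : ∀ e ∈ es, decodeSet vs e ∈ F) (Z : ℕ) (Q : Finset ℕ) (hQ : Q ∈ F) :
    decodeSet vs (hull es Z) ∪ Q ∈ F := by
  induction es with
  | nil => simpa [hull, decodeSet_zero] using hQ
  | cons e es ih =>
    have ih := ih fun e he => hes e (List.mem_cons_of_mem _ he)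
    cases hb : Nat.beq (e ||| Z) Z with
    | false => simpa only [hull, hb, cond_false] using ih
    | true =>
      simp only [hull, hb, cond_true, decodeSet_lor, Finset.union_assoc]
      exact hF _ (hes e List.mem_cons_self) _ ih

/-- Each quadruple `(k, X, Y, Z)` stands for the inequality
`k * ([X ∈ B] + [Y ∈ B]) ≤ k * ([X ∪ Y ∈ B] + [Z ∈ B])`; its validity requires that `Z` arises
from both `X` and `Y` by adding edges. -/
def validEntries (es : List ℕ) : List (ℕ × ℕ × ℕ × ℕ) → Bool
  | [] => true
  | (_, X, Y, Z) :: C =>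
    Nat.beq (hull es Z ||| X) Z && (Nat.beq (hull es Z ||| Y) Z && validEntries es C)

/-- The linear combination of masks obtained by adding up all inequalities in the list. -/
def expandEntries : List (ℕ × ℕ × ℕ × ℕ) → List (ℤ × ℕ)
  | [] => []
  | (k, X, Y, Z) :: C =>
    (Int.ofNat k, X ||| Y) :: (Int.ofNat k, Z) :: (Int.negOfNat k, X) :: (Int.negOfNat k, Y) ::
      expandEntries C

theorem evalSum_expandEntries_nonneg {F : Finset (Finset ℕ)} (hF : UC F) (vs es : List ℕ)
    (hes : ∀ e ∈ es, decodeSet vs e ∈ F) (T : Finset ℕ) (C : List (ℕ × ℕ × ℕ × ℕ))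
    (hC : validEntries es C = true) :
    0 ≤ evalSum (fun P => if P ∪ T ∈ F then 1 else 0) vs (expandEntries C) := by
  induction C with
  | nil => simp [evalSum, expandEntries]
  | cons p C ih =>
    obtain ⟨k, X, Y, Z⟩ := p
    simp only [validEntries, Bool.and_eq_true] at hC
    obtain ⟨hX, hY, hC⟩ := hC
    have up : ∀ W, hull es Z ||| W = Z → decodeSet vs W ∪ T ∈ F → decodeSet vs Z ∪ T ∈ F := by
      intro W hW h
      have := union_hull_mem hF vs es hes Z _ h
      rwa [← Finset.union_assoc, ← decodeSet_lor, hW] at this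
    have hXY : decodeSet vs X ∪ T ∈ F → decodeSet vs Y ∪ T ∈ F →
        decodeSet vs (X ||| Y) ∪ T ∈ F := by
      intro h1 h2
      rw [decodeSet_lor, Finset.union_union_distrib_right]
      exact hF _ h1 _ h2
    have key : (0 : ℤ) ≤ (if decodeSet vs (X ||| Y) ∪ T ∈ F then 1 else 0) +
        (if decodeSet vs Z ∪ T ∈ F then 1 else 0) - (if decodeSet vs X ∪ T ∈ F then 1 else 0) -
        (if decodeSet vs Y ∪ T ∈ F then 1 else 0) := by
      have hX' := up X (Nat.eq_of_beq_eq_true hX)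
      have hY' := up Y (Nat.eq_of_beq_eq_true hY)
      split_ifs <;> simp_all
    have := mul_nonneg (Int.natCast_nonneg k) key
    have ih := ih hC
    simp only [expandEntries, evalSum, Int.ofNat_eq_natCast, Int.negOfNat_eq]
    linarith

theorem sum_signedWeight_pos {F : Finset (Finset ℕ)} (ws : List ℤ) (vs : List ℕ)
    (hlen : vs.length = ws.length) (hne : vs ≠ []) (hpos : ∀ w ∈ ws, 0 < w)
    (hv : ∀ v ∈ vs, 2 * (memFam F v).card < F.card) :
    0 < ∑ G ∈ F, signedWeight ws vs G := by
  have step : ∀ v w, 0 < w → 2 * (memFam F v).card < F.card →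
      0 < ∑ G ∈ F, (if v ∈ G then -w else w : ℤ) := by
    intro v w hw h
    have hsplit : ∑ G ∈ F, (if v ∈ G then -w else w : ℤ) =
        ∑ G ∈ F, (w - 2 * w * if v ∈ G then 1 else 0) :=
      Finset.sum_congr rfl fun G _ => by split_ifs <;> ring
    have hcard : (2 * (memFam F v).card : ℤ) < F.card := by exact_mod_cast h
    rw [hsplit, Finset.sum_sub_distrib, ← Finset.mul_sum, Finset.sum_boole, Finset.sum_const,
      nsmul_eq_mul]
    change 0 < (F.card : ℤ) * w - 2 * w * ((memFam F v).card : ℤ)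
    nlinarith
  have nonneg : ∀ (ws : List ℤ) (vs : List ℕ), (∀ w ∈ ws, 0 < w) →
      (∀ v ∈ vs, 2 * (memFam F v).card < F.card) → 0 ≤ ∑ G ∈ F, signedWeight ws vs G := by
    intro ws
    induction ws with
    | nil => simp [signedWeight]
    | cons w ws ih =>
      intro vs hpos hv
      cases vs with
      | nil => simp [signedWeight]
      | cons v vs =>
        simp only [List.forall_mem_cons] at hpos hv
        simp only [signedWeight, Finset.sum_add_distrib]
        exact add_nonneg (step v w hpos.1 hv.1).le (ih vs hpos.2 hv.2)
  match ws, vs with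
  | [], [] => exact absurd rfl hne
  | w :: ws, v :: vs =>
    simp only [List.forall_mem_cons] at hpos hv
    simp only [signedWeight, Finset.sum_add_distrib]
    exact add_pos_of_pos_of_nonneg (step v w hpos.1 hv.1) (nonneg ws vs hpos.2 hv.2)

theorem subset_gen (S : Finset (Finset ℕ)) : S ⊆ gen S := by
  intro A hA
  simp only [gen, Finset.mem_image, Finset.mem_filter, Finset.mem_powerset]
  exact ⟨{A}, ⟨by simpa using hA, Finset.singleton_nonempty A⟩, by simp⟩

theorem subset_famU {F : Finset (Finset ℕ)} {A : Finset ℕ} (hA : A ∈ F) : A ⊆ famU F :=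
  Finset.le_sup (f := id) hA

/-- `C` certifies that no union-closed family containing the edges `es` has all weighted degrees
below one half. -/
def certifies (ws : List ℤ) (es : List ℕ) (C : List (ℕ × ℕ × ℕ × ℕ)) : Bool :=
  validEntries es C && checkSum ws 0 (expandEntries C)

/-- A family containing a certified configuration of edges is Frankl-complete: for the indicator
`x` of each fibre of a union-closed family, the certificate bounds the signed weight sum by `0`. -/
theorem not_nonFC_of_certifies {S : Finset (Finset ℕ)} (ws : List ℤ) (es : List ℕ)
    (C : List (ℕ × ℕ × ℕ × ℕ)) (hcert : certifies ws es C = true) (hpos : ∀ w ∈ ws, 0 < w)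
    (vs : List ℕ) (hlen : vs.length = ws.length) (hne : vs ≠ []) (hnd : vs.Nodup)
    (hes : ∀ e ∈ es, decodeSet vs e ∈ S) (hvs : ∀ v ∈ vs, ∃ e ∈ es, v ∈ decodeSet vs e) :
    ¬ NonFC (gen S) := by
  rintro ⟨F, hF, hSF, hlt⟩
  simp only [certifies, Bool.and_eq_true] at hcert
  have hpos := sum_signedWeight_pos (F := F) ws vs hlen hne hpos fun v hv => by
    obtain ⟨e, he, hve⟩ := hvs v hv
    exact hlt v (subset_famU (subset_gen S (hes e he)) hve)
  rw [sum_eq_sum_fibers F vs.toFinset _ fun P T => signedWeight_union ws vs P T] at hpos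
  refine hpos.not_ge (Finset.sum_nonpos fun T _ => ?_)
  have h := checkSum_sound ws vs 0 _ (fun P => if P ∪ T ∈ F then 1 else 0)
    (fun P => by split_ifs <;> simp) hlen hnd hcert.2
  have h' := evalSum_expandEntries_nonneg hF vs es (fun e he => hSF (subset_gen S (hes e he))) T C
    hcert.1
  simp only [zero_add] at h
  linarith

/-! ### Forbidden configurations of triples

The first two arguments of `not_nonFC_of_certifies` are the vertex weights and the edges as bit
masks; the third is a dual solution of the linear program bounding the weighted degrees. -/

theorem not_threeEdgesInFour {S : Finset (Finset ℕ)} (hS : NonFC (gen S)) {a b c d : ℕ}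
    (hnd : [a, b, c, d].Nodup)
    (h1 : {a, b, c} ∈ S) (h2 : {a, b, d} ∈ S) (h3 : {a, c, d} ∈ S) : False := by
  refine not_nonFC_of_certifies [3, 3, 3, 3]
    [7, 11, 13] [
    (2, 0, 7, 7), (2, 0, 11, 11), (2, 0, 13, 13), (6, 0, 14, 15), (2, 1, 7, 7), (2, 1, 11, 11),
    (2, 1, 13, 13), (2, 2, 4, 7), (2, 2, 8, 11), (2, 2, 12, 15), (2, 4, 8, 13), (2, 4, 10, 15),
    (2, 6, 8, 15)]
    (by decide +kernel) (by decide) [a, b, c, d] rfl (by simp) hnd ?_ ?_ hS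
  · simp [decodeSet, h1, h2, h3]
  · simp [decodeSet]

theorem not_bookThreePages {S : Finset (Finset ℕ)} (hS : NonFC (gen S)) {a b c d e : ℕ}
    (hnd : [a, b, c, d, e].Nodup)
    (h1 : {a, b, c} ∈ S) (h2 : {a, b, d} ∈ S) (h3 : {a, b, e} ∈ S) : False := by
  refine not_nonFC_of_certifies [3, 3, 2, 2, 2]
    [7, 11, 19] [
    (4, 0, 7, 7), (4, 0, 11, 11), (4, 0, 19, 19), (2, 1, 12, 15), (2, 1, 20, 23), (2, 1, 24, 27),
    (2, 2, 12, 15), (2, 2, 20, 23), (2, 2, 24, 27), (4, 4, 8, 15), (4, 4, 16, 23), (2, 5, 24, 31),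
    (2, 6, 24, 31), (4, 8, 16, 27), (2, 9, 20, 31), (2, 10, 20, 31), (2, 12, 17, 31),
    (2, 12, 18, 31)]
    (by decide +kernel) (by decide) [a, b, c, d, e] rfl (by simp) hnd ?_ ?_ hS
  · simp [decodeSet, h1, h2, h3]
  · simp [decodeSet]

theorem not_bookChain {S : Finset (Finset ℕ)} (hS : NonFC (gen S)) {a b c d e : ℕ}
    (hnd : [a, b, c, d, e].Nodup)
    (h1 : {a, b, c} ∈ S) (h2 : {a, b, d} ∈ S) (h3 : {a, c, e} ∈ S) : False := by
  refine not_nonFC_of_certifies [16, 12, 12, 8, 8]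
    [7, 11, 21] [
    (14, 0, 7, 7), (21, 0, 11, 11), (21, 0, 21, 21), (2, 1, 8, 11), (10, 1, 12, 15), (2, 1, 16, 21),
    (10, 1, 18, 23), (10, 2, 4, 7), (22, 2, 16, 23), (22, 4, 8, 15), (8, 6, 10, 15), (8, 6, 20, 23),
    (2, 6, 24, 31), (16, 8, 16, 31), (6, 9, 12, 29), (4, 9, 24, 29), (8, 10, 20, 31),
    (7, 11, 18, 31), (7, 12, 21, 31), (15, 12, 24, 29), (6, 17, 18, 27), (4, 17, 24, 27),
    (15, 18, 24, 27), (15, 26, 28, 31), (1, 30, 31, 31)]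
    (by decide +kernel) (by decide) [a, b, c, d, e] rfl (by simp) hnd ?_ ?_ hS
  · simp [decodeSet, h1, h2, h3]
  · simp [decodeSet]

theorem not_bookWithPendant {S : Finset (Finset ℕ)} (hS : NonFC (gen S)) {a b c d e f : ℕ}
    (hnd : [a, b, c, d, e, f].Nodup)
    (h1 : {a, b, c} ∈ S) (h2 : {a, b, d} ∈ S) (h3 : {a, e, f} ∈ S) : False := by
  refine not_nonFC_of_certifies [22, 18, 12, 12, 10, 10]
    [7, 11, 49] [
    (36, 0, 7, 7), (36, 0, 11, 11), (6, 0, 28, 63), (6, 0, 44, 63), (18, 1, 4, 7), (18, 1, 8, 11),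
    (2, 1, 16, 49), (2, 1, 32, 49), (32, 2, 51, 51), (16, 2, 60, 63), (2, 3, 18, 51),
    (2, 3, 34, 51), (26, 4, 9, 15), (10, 4, 49, 55), (6, 4, 53, 53), (26, 5, 8, 15), (4, 5, 20, 53),
    (4, 5, 36, 53), (2, 6, 12, 15), (2, 6, 48, 55), (14, 6, 52, 55), (6, 6, 56, 63),
    (15, 7, 16, 55), (2, 7, 20, 55), (15, 7, 32, 55), (2, 7, 36, 55), (10, 8, 49, 59),
    (6, 8, 57, 57), (4, 9, 24, 57), (4, 9, 40, 57), (2, 10, 12, 15), (2, 10, 48, 59),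
    (6, 10, 52, 63), (14, 10, 56, 59), (15, 11, 16, 59), (2, 11, 24, 59), (15, 11, 32, 59),
    (2, 11, 40, 59), (20, 12, 48, 63), (8, 12, 50, 63), (4, 12, 61, 61), (22, 13, 28, 61),
    (22, 13, 44, 61), (4, 14, 48, 63), (2, 15, 29, 63), (2, 15, 45, 63), (8, 15, 63, 63),
    (16, 16, 23, 23), (16, 16, 27, 27), (7, 17, 18, 23), (7, 17, 18, 27), (8, 17, 28, 31),
    (12, 18, 28, 31), (34, 20, 24, 31), (4, 22, 28, 31), (4, 26, 28, 31), (16, 32, 39, 39),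
    (16, 32, 43, 43), (7, 33, 34, 39), (7, 33, 34, 43), (8, 33, 44, 47), (12, 34, 44, 47),
    (34, 36, 40, 47), (4, 38, 44, 47), (4, 42, 44, 47), (16, 48, 49, 49)]
    (by decide +kernel) (by decide) [a, b, c, d, e, f] rfl (by simp) hnd ?_ ?_ hS
  · simp [decodeSet, h1, h2, h3]
  · simp [decodeSet]

theorem not_sunflower {S : Finset (Finset ℕ)} (hS : NonFC (gen S)) {a b c d e f g : ℕ}
    (hnd : [a, b, c, d, e, f, g].Nodup)
    (h1 : {a, b, c} ∈ S) (h2 : {a, d, e} ∈ S) (h3 : {a, f, g} ∈ S) : False := by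
  refine not_nonFC_of_certifies [12, 6, 6, 6, 6, 6, 6]
    [7, 25, 97] [
    (16, 0, 7, 7), (16, 0, 25, 25), (16, 0, 97, 97), (4, 1, 2, 7), (4, 1, 4, 7), (4, 1, 8, 25),
    (4, 1, 16, 25), (4, 1, 32, 97), (4, 1, 64, 97), (6, 2, 25, 31), (8, 2, 27, 27), (6, 2, 97, 103),
    (8, 2, 99, 99), (4, 2, 121, 127), (4, 3, 10, 27), (4, 3, 18, 27), (4, 3, 34, 99),
    (4, 3, 66, 99), (6, 4, 25, 31), (8, 4, 29, 29), (6, 4, 97, 103), (8, 4, 101, 101),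
    (4, 4, 121, 127), (4, 5, 12, 29), (4, 5, 20, 29), (4, 5, 36, 101), (4, 5, 68, 101),
    (8, 6, 24, 31), (8, 6, 96, 103), (8, 6, 120, 127), (6, 7, 8, 31), (6, 7, 16, 31),
    (6, 7, 32, 103), (6, 7, 64, 103), (8, 8, 15, 15), (6, 8, 97, 121), (4, 8, 103, 127),
    (8, 8, 105, 105), (4, 9, 10, 15), (4, 9, 12, 15), (4, 9, 40, 105), (4, 9, 72, 105),
    (5, 10, 99, 123), (5, 10, 105, 111), (6, 10, 107, 107), (4, 11, 42, 107), (4, 11, 74, 107),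
    (5, 12, 101, 125), (5, 12, 105, 111), (6, 12, 109, 109), (4, 13, 44, 109), (4, 13, 76, 109),
    (12, 14, 104, 111), (5, 15, 40, 111), (5, 15, 72, 111), (8, 16, 23, 23), (6, 16, 97, 121),
    (4, 16, 103, 127), (8, 16, 113, 113), (4, 17, 18, 23), (4, 17, 20, 23), (4, 17, 48, 113),
    (4, 17, 80, 113), (5, 18, 99, 123), (5, 18, 113, 119), (6, 18, 115, 115), (4, 19, 50, 115),
    (4, 19, 82, 115), (5, 20, 101, 125), (5, 20, 113, 119), (6, 20, 117, 117), (4, 21, 52, 117),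
    (4, 21, 84, 117), (12, 22, 112, 119), (5, 23, 48, 119), (5, 23, 80, 119), (8, 24, 96, 121),
    (8, 24, 102, 127), (6, 25, 32, 121), (6, 25, 64, 121), (12, 26, 98, 123), (5, 27, 34, 123),
    (5, 27, 66, 123), (12, 28, 100, 125), (5, 29, 36, 125), (5, 29, 68, 125), (8, 30, 96, 127),
    (4, 31, 32, 127), (4, 31, 64, 127), (8, 32, 39, 39), (8, 32, 57, 57), (4, 33, 34, 39),
    (4, 33, 36, 39), (4, 33, 40, 57), (4, 33, 48, 57), (5, 34, 57, 63), (6, 34, 59, 59),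
    (4, 35, 42, 59), (4, 35, 50, 59), (5, 36, 57, 63), (6, 36, 61, 61), (4, 37, 44, 61),
    (4, 37, 52, 61), (12, 38, 56, 63), (5, 39, 40, 63), (5, 39, 48, 63), (6, 40, 47, 47),
    (4, 41, 42, 47), (4, 41, 44, 47), (6, 48, 55, 55), (4, 49, 50, 55), (4, 49, 52, 55),
    (8, 64, 71, 71), (8, 64, 89, 89), (4, 65, 66, 71), (4, 65, 68, 71), (4, 65, 72, 89),
    (4, 65, 80, 89), (5, 66, 89, 95), (6, 66, 91, 91), (4, 67, 74, 91), (4, 67, 82, 91),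
    (5, 68, 89, 95), (6, 68, 93, 93), (4, 69, 76, 93), (4, 69, 84, 93), (12, 70, 88, 95),
    (5, 71, 72, 95), (5, 71, 80, 95), (6, 72, 79, 79), (4, 73, 74, 79), (4, 73, 76, 79),
    (6, 80, 87, 87), (4, 81, 82, 87), (4, 81, 84, 87)]
    (by decide +kernel) (by decide) [a, b, c, d, e, f, g] rfl (by simp) hnd ?_ ?_ hS
  · simp [decodeSet, h1, h2, h3]
  · simp [decodeSet]

theorem not_triangle {S : Finset (Finset ℕ)} (hS : NonFC (gen S)) {a b c d e f : ℕ}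
    (hnd : [a, b, c, d, e, f].Nodup)
    (h1 : {a, b, c} ∈ S) (h2 : {a, d, e} ∈ S) (h3 : {b, d, f} ∈ S) : False := by
  refine not_nonFC_of_certifies [4, 4, 2, 4, 2, 2]
    [7, 25, 42] [
    (6, 0, 7, 7), (6, 0, 25, 25), (6, 0, 42, 42), (2, 1, 2, 7), (2, 1, 8, 25), (3, 1, 42, 47),
    (3, 1, 42, 59), (2, 2, 8, 42), (3, 2, 25, 31), (3, 2, 25, 59), (2, 3, 9, 43), (2, 3, 10, 27),
    (2, 4, 16, 31), (4, 4, 29, 29), (2, 4, 32, 47), (4, 4, 46, 46), (2, 4, 56, 63), (2, 5, 12, 29),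
    (4, 5, 36, 47), (2, 6, 12, 46), (4, 6, 20, 31), (3, 7, 8, 31), (3, 7, 8, 47), (2, 9, 10, 15),
    (2, 12, 15, 15), (4, 16, 23, 23), (2, 16, 32, 59), (2, 16, 38, 63), (4, 16, 58, 58),
    (2, 17, 18, 23), (4, 17, 48, 59), (2, 18, 24, 58), (2, 18, 27, 27), (4, 20, 24, 31),
    (2, 20, 36, 63), (2, 20, 48, 63), (2, 21, 32, 63), (6, 22, 28, 62), (2, 31, 63, 63),
    (4, 32, 39, 39), (4, 32, 57, 57), (2, 33, 34, 39), (2, 33, 40, 57), (2, 33, 43, 43),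
    (4, 34, 48, 59), (4, 36, 40, 47), (2, 36, 48, 63), (6, 37, 44, 61), (2, 47, 63, 63),
    (6, 49, 50, 55), (4, 52, 55, 55), (4, 52, 61, 61), (4, 52, 62, 62), (2, 59, 63, 63)]
    (by decide +kernel) (by decide) [a, b, c, d, e, f] rfl (by simp) hnd ?_ ?_ hS
  · simp [decodeSet, h1, h2, h3]
  · simp [decodeSet]

theorem not_twoChords {S : Finset (Finset ℕ)} (hS : NonFC (gen S)) {a b c d e : ℕ}
    (hnd : [a, b, c, d, e].Nodup)
    (h1 : {a, b, c} ∈ S) (h2 : {a, d, e} ∈ S) (h3 : {b, d, e} ∈ S) : False := by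
  refine not_nonFC_of_certifies [6, 6, 3, 6, 6]
    [7, 25, 26] [
    (11, 0, 7, 7), (8, 0, 25, 25), (8, 0, 26, 26), (9, 1, 2, 27), (2, 1, 8, 25), (1, 1, 12, 31),
    (2, 1, 16, 25), (1, 1, 20, 31), (2, 2, 8, 26), (1, 2, 12, 31), (2, 2, 16, 26), (1, 2, 20, 31),
    (6, 3, 8, 27), (6, 3, 16, 27), (1, 4, 8, 31), (1, 4, 16, 31), (3, 4, 24, 31), (8, 4, 29, 29),
    (8, 4, 30, 30), (1, 5, 11, 31), (2, 5, 12, 29), (1, 5, 19, 31), (2, 5, 20, 29), (3, 5, 25, 31),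
    (1, 6, 11, 31), (2, 6, 12, 30), (1, 6, 19, 31), (2, 6, 20, 30), (3, 6, 26, 31), (4, 7, 12, 31),
    (4, 7, 20, 31), (4, 8, 15, 15), (5, 9, 10, 15), (4, 16, 23, 23), (5, 17, 18, 23)]
    (by decide +kernel) (by decide) [a, b, c, d, e] rfl (by simp) hnd ?_ ?_ hS
  · simp [decodeSet, h1, h2, h3]
  · simp [decodeSet]

theorem not_matchedStar {S : Finset (Finset ℕ)} (hS : NonFC (gen S)) {a b c d e f g h i : ℕ}
    (hnd : [a, b, c, d, e, f, g, h, i].Nodup)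
    (h1 : {a, b, c} ∈ S) (h2 : {a, d, e} ∈ S) (h3 : {b, f, g} ∈ S) (h4 : {c, h, i} ∈ S) : False
    := by
  refine not_nonFC_of_certifies [12, 12, 12, 6, 6, 6, 6, 6, 6]
    [7, 25, 98, 388] [
    (72, 0, 7, 7), (12, 1, 8, 25), (2, 1, 10, 31), (2, 1, 12, 31), (12, 1, 16, 25), (2, 1, 18, 31),
    (2, 1, 20, 31), (8, 1, 96, 103), (8, 1, 384, 391), (8, 2, 24, 31), (12, 2, 32, 98),
    (2, 2, 33, 103), (2, 2, 36, 103), (12, 2, 64, 98), (2, 2, 65, 103), (2, 2, 68, 103),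
    (8, 2, 384, 391), (6, 3, 10, 27), (6, 3, 18, 27), (6, 3, 33, 99), (6, 3, 65, 99),
    (8, 4, 24, 31), (8, 4, 96, 103), (12, 4, 128, 388), (2, 4, 129, 391), (2, 4, 130, 391),
    (12, 4, 256, 388), (2, 4, 257, 391), (2, 4, 258, 391), (6, 5, 12, 29), (6, 5, 20, 29),
    (6, 5, 129, 389), (6, 5, 257, 389), (6, 6, 36, 102), (6, 6, 68, 102), (6, 6, 130, 390),
    (6, 6, 258, 390), (12, 7, 8, 31), (12, 7, 16, 31), (12, 7, 32, 103), (12, 7, 64, 103),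
    (12, 7, 128, 391), (12, 7, 256, 391), (12, 8, 98, 123), (12, 8, 388, 413), (12, 8, 486, 511),
    (6, 9, 104, 111), (12, 9, 107, 107), (6, 9, 392, 399), (12, 9, 397, 397), (12, 9, 488, 495),
    (12, 10, 12, 15), (1, 10, 40, 106), (6, 10, 44, 111), (1, 10, 72, 106), (6, 10, 76, 111),
    (2, 10, 396, 399), (20, 11, 392, 399), (2, 12, 106, 111), (1, 12, 136, 396), (6, 12, 138, 399),
    (1, 12, 264, 396), (6, 12, 266, 399), (20, 13, 104, 111), (6, 14, 44, 110), (6, 14, 76, 110),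
    (6, 14, 138, 398), (6, 14, 266, 398), (6, 15, 103, 127), (6, 15, 391, 415), (12, 16, 98, 123),
    (12, 16, 388, 413), (12, 16, 486, 511), (6, 17, 112, 119), (12, 17, 115, 115),
    (6, 17, 400, 407), (12, 17, 405, 405), (12, 17, 496, 503), (12, 18, 20, 23), (1, 18, 48, 114),
    (6, 18, 52, 119), (1, 18, 80, 114), (6, 18, 84, 119), (2, 18, 404, 407), (20, 19, 400, 407),
    (2, 20, 114, 119), (1, 20, 144, 404), (6, 20, 146, 407), (1, 20, 272, 404), (6, 20, 274, 407),
    (20, 21, 112, 119), (6, 22, 52, 118), (6, 22, 84, 118), (6, 22, 146, 406), (6, 22, 274, 406),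
    (6, 23, 103, 127), (6, 23, 391, 415), (12, 24, 102, 127), (4, 24, 122, 122), (12, 24, 390, 415),
    (4, 24, 412, 412), (12, 25, 32, 123), (12, 25, 64, 123), (12, 25, 128, 413), (12, 25, 256, 413),
    (2, 26, 60, 510), (2, 26, 92, 510), (28, 26, 414, 414), (12, 27, 384, 415), (28, 28, 126, 126),
    (2, 28, 154, 510), (2, 28, 282, 510), (12, 29, 96, 127), (6, 31, 39, 127), (6, 31, 71, 127),
    (6, 31, 135, 415), (6, 31, 263, 415), (12, 32, 388, 486), (12, 32, 413, 511), (12, 33, 36, 39),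
    (1, 33, 40, 57), (6, 33, 44, 63), (1, 33, 48, 57), (6, 33, 52, 63), (2, 33, 420, 423),
    (6, 34, 56, 63), (12, 34, 59, 59), (6, 34, 416, 423), (12, 34, 422, 422), (12, 34, 440, 447),
    (20, 35, 416, 423), (2, 36, 57, 63), (1, 36, 160, 420), (6, 36, 161, 423), (1, 36, 288, 420),
    (6, 36, 289, 423), (6, 37, 44, 61), (6, 37, 52, 61), (6, 37, 161, 421), (6, 37, 289, 421),
    (20, 38, 56, 63), (6, 39, 391, 487), (34, 40, 47, 47), (1, 40, 396, 494), (5, 40, 399, 495),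
    (1, 40, 420, 445), (5, 40, 423, 447), (14, 41, 42, 47), (7, 41, 396, 495), (4, 41, 420, 445),
    (4, 42, 396, 494), (7, 42, 420, 447), (14, 43, 424, 431), (6, 45, 169, 429), (6, 45, 297, 429),
    (6, 46, 170, 430), (6, 46, 298, 430), (12, 47, 168, 431), (12, 47, 296, 431), (34, 48, 55, 55),
    (1, 48, 404, 502), (5, 48, 407, 503), (1, 48, 420, 445), (5, 48, 423, 447), (14, 49, 50, 55),
    (7, 49, 404, 503), (4, 49, 420, 445), (4, 50, 404, 502), (7, 50, 420, 447), (14, 51, 432, 439),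
    (6, 53, 177, 437), (6, 53, 305, 437), (6, 54, 178, 438), (6, 54, 306, 438), (12, 55, 176, 439),
    (12, 55, 304, 439), (2, 56, 412, 510), (8, 56, 414, 510), (1, 57, 160, 445), (7, 57, 162, 447),
    (4, 57, 164, 445), (1, 57, 288, 445), (7, 57, 290, 447), (4, 57, 292, 445), (18, 58, 446, 446),
    (5, 60, 184, 444), (5, 60, 312, 444), (1, 61, 185, 445), (1, 61, 313, 445), (5, 62, 186, 446),
    (5, 62, 314, 446), (5, 63, 160, 447), (5, 63, 288, 447), (12, 64, 388, 486), (12, 64, 413, 511),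
    (12, 65, 68, 71), (1, 65, 72, 89), (6, 65, 76, 95), (1, 65, 80, 89), (6, 65, 84, 95),
    (2, 65, 452, 455), (6, 66, 88, 95), (12, 66, 91, 91), (6, 66, 448, 455), (12, 66, 454, 454),
    (12, 66, 472, 479), (20, 67, 448, 455), (2, 68, 89, 95), (1, 68, 192, 452), (6, 68, 193, 455),
    (1, 68, 320, 452), (6, 68, 321, 455), (6, 69, 76, 93), (6, 69, 84, 93), (6, 69, 193, 453),
    (6, 69, 321, 453), (20, 70, 88, 95), (6, 71, 391, 487), (34, 72, 79, 79), (1, 72, 396, 494),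
    (5, 72, 399, 495), (1, 72, 452, 477), (5, 72, 455, 479), (14, 73, 74, 79), (7, 73, 396, 495),
    (4, 73, 452, 477), (4, 74, 396, 494), (7, 74, 452, 479), (14, 75, 456, 463), (6, 77, 201, 461),
    (6, 77, 329, 461), (6, 78, 202, 462), (6, 78, 330, 462), (12, 79, 200, 463), (12, 79, 328, 463),
    (34, 80, 87, 87), (1, 80, 404, 502), (5, 80, 407, 503), (1, 80, 452, 477), (5, 80, 455, 479),
    (14, 81, 82, 87), (7, 81, 404, 503), (4, 81, 452, 477), (4, 82, 404, 502), (7, 82, 452, 479),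
    (14, 83, 464, 471), (6, 85, 209, 469), (6, 85, 337, 469), (6, 86, 210, 470), (6, 86, 338, 470),
    (12, 87, 208, 471), (12, 87, 336, 471), (2, 88, 412, 510), (8, 88, 414, 510), (1, 89, 192, 477),
    (7, 89, 194, 479), (4, 89, 196, 477), (1, 89, 320, 477), (7, 89, 322, 479), (4, 89, 324, 477),
    (18, 90, 478, 478), (5, 92, 216, 476), (5, 92, 344, 476), (1, 93, 217, 477), (1, 93, 345, 477),
    (5, 94, 218, 478), (5, 94, 346, 478), (5, 95, 192, 479), (5, 95, 320, 479), (4, 96, 121, 121),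
    (12, 96, 389, 487), (4, 96, 484, 484), (2, 97, 108, 509), (2, 97, 116, 509), (28, 97, 485, 485),
    (12, 98, 128, 486), (12, 98, 256, 486), (12, 99, 384, 487), (28, 100, 125, 125),
    (2, 100, 225, 509), (2, 100, 353, 509), (6, 103, 135, 487), (6, 103, 263, 487),
    (2, 104, 484, 509), (8, 104, 485, 509), (18, 105, 493, 493), (1, 106, 136, 494),
    (7, 106, 137, 495), (4, 106, 140, 494), (1, 106, 264, 494), (7, 106, 265, 495),
    (4, 106, 268, 494), (5, 108, 232, 492), (5, 108, 360, 492), (5, 109, 233, 493),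
    (5, 109, 361, 493), (1, 110, 234, 494), (1, 110, 362, 494), (5, 111, 136, 495),
    (5, 111, 264, 495), (2, 112, 484, 509), (8, 112, 485, 509), (18, 113, 501, 501),
    (1, 114, 144, 502), (7, 114, 145, 503), (4, 114, 148, 502), (1, 114, 272, 502),
    (7, 114, 273, 503), (4, 114, 276, 502), (5, 116, 240, 500), (5, 116, 368, 500),
    (5, 117, 241, 501), (5, 117, 369, 501), (1, 118, 242, 502), (1, 118, 370, 502),
    (5, 119, 144, 503), (5, 119, 272, 503), (24, 120, 508, 508), (2, 121, 224, 509),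
    (2, 121, 352, 509), (2, 122, 152, 510), (2, 122, 280, 510), (12, 123, 128, 511),
    (12, 123, 256, 511), (8, 125, 224, 509), (8, 125, 352, 509), (8, 126, 152, 510),
    (8, 126, 280, 510), (12, 129, 130, 135), (1, 129, 136, 153), (6, 129, 138, 159),
    (1, 129, 144, 153), (6, 129, 146, 159), (2, 129, 226, 231), (2, 130, 153, 159),
    (1, 130, 160, 226), (6, 130, 161, 231), (1, 130, 192, 226), (6, 130, 193, 231),
    (6, 131, 138, 155), (6, 131, 146, 155), (6, 131, 161, 227), (6, 131, 193, 227),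
    (6, 132, 152, 159), (12, 132, 157, 157), (6, 132, 224, 231), (12, 132, 230, 230),
    (12, 132, 248, 255), (20, 133, 224, 231), (20, 134, 152, 159), (34, 136, 143, 143),
    (1, 136, 226, 251), (5, 136, 231, 255), (14, 137, 140, 143), (4, 137, 226, 251),
    (6, 139, 169, 235), (6, 139, 201, 235), (7, 140, 226, 255), (14, 141, 232, 239),
    (6, 142, 172, 238), (6, 142, 204, 238), (12, 143, 168, 239), (12, 143, 200, 239),
    (34, 144, 151, 151), (1, 144, 226, 251), (5, 144, 231, 255), (14, 145, 148, 151),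
    (4, 145, 226, 251), (6, 147, 177, 243), (6, 147, 209, 243), (7, 148, 226, 255),
    (14, 149, 240, 247), (6, 150, 180, 246), (6, 150, 212, 246), (12, 151, 176, 247),
    (12, 151, 208, 247), (1, 153, 160, 251), (4, 153, 162, 251), (7, 153, 164, 255),
    (1, 153, 192, 251), (4, 153, 194, 251), (7, 153, 196, 255), (5, 154, 184, 250),
    (5, 154, 216, 250), (1, 155, 185, 251), (1, 155, 217, 251), (18, 156, 254, 254),
    (5, 158, 188, 254), (5, 158, 220, 254), (5, 159, 160, 255), (5, 159, 192, 255),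
    (34, 160, 167, 167), (14, 162, 164, 167), (6, 163, 170, 187), (6, 163, 178, 187),
    (6, 165, 172, 189), (6, 165, 180, 189), (14, 166, 184, 191), (12, 167, 168, 191),
    (12, 167, 176, 191), (34, 192, 199, 199), (14, 194, 196, 199), (6, 195, 202, 219),
    (6, 195, 210, 219), (6, 197, 204, 221), (6, 197, 212, 221), (14, 198, 216, 223),
    (12, 199, 200, 223), (12, 199, 208, 223), (5, 225, 232, 249), (5, 225, 240, 249),
    (1, 227, 234, 251), (1, 227, 242, 251), (18, 228, 253, 253), (5, 229, 236, 253),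
    (5, 229, 244, 253), (12, 257, 258, 263), (1, 257, 264, 281), (6, 257, 266, 287),
    (1, 257, 272, 281), (6, 257, 274, 287), (2, 257, 354, 359), (2, 258, 281, 287),
    (1, 258, 288, 354), (6, 258, 289, 359), (1, 258, 320, 354), (6, 258, 321, 359),
    (6, 259, 266, 283), (6, 259, 274, 283), (6, 259, 289, 355), (6, 259, 321, 355),
    (6, 260, 280, 287), (12, 260, 285, 285), (6, 260, 352, 359), (12, 260, 358, 358),
    (12, 260, 376, 383), (20, 261, 352, 359), (20, 262, 280, 287), (34, 264, 271, 271),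
    (1, 264, 354, 379), (5, 264, 359, 383), (14, 265, 268, 271), (4, 265, 354, 379),
    (6, 267, 297, 363), (6, 267, 329, 363), (7, 268, 354, 383), (14, 269, 360, 367),
    (6, 270, 300, 366), (6, 270, 332, 366), (12, 271, 296, 367), (12, 271, 328, 367),
    (34, 272, 279, 279), (1, 272, 354, 379), (5, 272, 359, 383), (14, 273, 276, 279),
    (4, 273, 354, 379), (6, 275, 305, 371), (6, 275, 337, 371), (7, 276, 354, 383),
    (14, 277, 368, 375), (6, 278, 308, 374), (6, 278, 340, 374), (12, 279, 304, 375),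
    (12, 279, 336, 375), (1, 281, 288, 379), (4, 281, 290, 379), (7, 281, 292, 383),
    (1, 281, 320, 379), (4, 281, 322, 379), (7, 281, 324, 383), (5, 282, 312, 378),
    (5, 282, 344, 378), (1, 283, 313, 379), (1, 283, 345, 379), (18, 284, 382, 382),
    (5, 286, 316, 382), (5, 286, 348, 382), (5, 287, 288, 383), (5, 287, 320, 383),
    (34, 288, 295, 295), (14, 290, 292, 295), (6, 291, 298, 315), (6, 291, 306, 315),
    (6, 293, 300, 317), (6, 293, 308, 317), (14, 294, 312, 319), (12, 295, 296, 319),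
    (12, 295, 304, 319), (34, 320, 327, 327), (14, 322, 324, 327), (6, 323, 330, 347),
    (6, 323, 338, 347), (6, 325, 332, 349), (6, 325, 340, 349), (14, 326, 344, 351),
    (12, 327, 328, 351), (12, 327, 336, 351), (5, 353, 360, 377), (5, 353, 368, 377),
    (1, 355, 362, 379), (1, 355, 370, 379), (18, 356, 381, 381), (5, 357, 364, 381),
    (5, 357, 372, 381), (4, 384, 409, 409), (4, 384, 482, 482), (2, 385, 394, 507),
    (2, 385, 402, 507), (28, 385, 483, 483), (28, 386, 411, 411), (2, 386, 417, 507),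
    (2, 386, 449, 507), (2, 392, 482, 507), (8, 392, 483, 507), (18, 393, 491, 491),
    (5, 394, 424, 490), (5, 394, 456, 490), (5, 395, 425, 491), (5, 395, 457, 491),
    (1, 398, 428, 494), (1, 398, 460, 494), (2, 400, 482, 507), (8, 400, 483, 507),
    (18, 401, 499, 499), (5, 402, 432, 498), (5, 402, 464, 498), (5, 403, 433, 499),
    (5, 403, 465, 499), (1, 406, 436, 502), (1, 406, 468, 502), (24, 408, 506, 506),
    (2, 409, 416, 507), (2, 409, 448, 507), (8, 411, 416, 507), (8, 411, 448, 507),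
    (5, 417, 424, 441), (5, 417, 432, 441), (18, 418, 443, 443), (5, 419, 426, 443),
    (5, 419, 434, 443), (1, 421, 428, 445), (1, 421, 436, 445), (5, 449, 456, 473),
    (5, 449, 464, 473), (18, 450, 475, 475), (5, 451, 458, 475), (5, 451, 466, 475),
    (1, 453, 460, 477), (1, 453, 468, 477), (24, 480, 505, 505)]
    (by decide +kernel) (by decide) [a, b, c, d, e, f, g, h, i] rfl (by simp) hnd ?_ ?_ hS
  · simp [decodeSet, h1, h2, h3, h4]
  · simp [decodeSet]

theorem not_bookCapped {S : Finset (Finset ℕ)} (hS : NonFC (gen S)) {a b c d e : ℕ}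
    (hnd : [a, b, c, d, e].Nodup)
    (h1 : {a, b, c} ∈ S) (h2 : {a, b, d} ∈ S) (h3 : {c, d, e} ∈ S) : False := by
  refine not_nonFC_of_certifies [16, 16, 16, 16, 8]
    [7, 11, 28] [
    (12, 0, 7, 7), (12, 0, 11, 11), (48, 0, 28, 28), (8, 1, 4, 7), (8, 1, 8, 11), (16, 1, 12, 15),
    (3, 1, 20, 31), (3, 1, 24, 31), (2, 1, 29, 29), (8, 2, 4, 7), (8, 2, 8, 11), (16, 2, 12, 15),
    (3, 2, 20, 31), (3, 2, 24, 31), (2, 2, 30, 30), (8, 3, 16, 31), (24, 4, 8, 15), (16, 5, 9, 29),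
    (16, 6, 10, 30), (4, 7, 20, 31), (4, 11, 24, 31), (8, 13, 28, 31), (8, 14, 28, 31),
    (24, 16, 23, 23), (24, 16, 27, 27), (6, 17, 20, 23), (6, 17, 24, 27), (12, 17, 28, 31),
    (6, 18, 20, 23), (6, 18, 24, 27), (12, 18, 28, 31), (1, 20, 25, 31), (1, 20, 26, 31),
    (1, 21, 24, 31), (1, 22, 24, 31)]
    (by decide +kernel) (by decide) [a, b, c, d, e] rfl (by simp) hnd ?_ ?_ hS
  · simp [decodeSet, h1, h2, h3]
  · simp [decodeSet]

theorem not_bookTwoTails {S : Finset (Finset ℕ)} (hS : NonFC (gen S)) {a b c d e f g h : ℕ}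
    (hnd : [a, b, c, d, e, f, g, h].Nodup)
    (h1 : {a, b, c} ∈ S) (h2 : {a, b, d} ∈ S) (h3 : {c, e, f} ∈ S) (h4 : {d, g, h} ∈ S) : False
    := by
  refine not_nonFC_of_certifies [24, 24, 24, 24, 12, 12, 12, 12]
    [7, 11, 52, 200] [
    (72, 0, 7, 7), (72, 0, 11, 11), (24, 1, 4, 7), (24, 1, 8, 11), (24, 1, 12, 15), (12, 1, 52, 55),
    (12, 1, 200, 203), (24, 2, 4, 7), (24, 2, 8, 11), (24, 2, 12, 15), (12, 2, 52, 55),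
    (12, 2, 200, 203), (12, 3, 48, 55), (12, 3, 192, 203), (24, 3, 240, 255), (14, 4, 16, 52),
    (3, 4, 25, 63), (3, 4, 26, 63), (14, 4, 32, 52), (3, 4, 41, 63), (3, 4, 42, 63),
    (8, 4, 200, 252), (72, 5, 9, 253), (72, 6, 10, 254), (6, 7, 16, 55), (6, 7, 32, 55),
    (84, 7, 192, 207), (24, 7, 244, 255), (8, 8, 52, 252), (14, 8, 64, 200), (3, 8, 69, 207),
    (3, 8, 70, 207), (14, 8, 128, 200), (3, 8, 133, 207), (3, 8, 134, 207), (84, 11, 48, 63),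
    (6, 11, 64, 203), (6, 11, 128, 203), (24, 11, 248, 255), (24, 13, 25, 61), (24, 13, 41, 61),
    (24, 13, 69, 205), (24, 13, 133, 205), (24, 14, 26, 62), (24, 14, 42, 62), (24, 14, 70, 206),
    (24, 14, 134, 206), (30, 16, 27, 27), (66, 16, 28, 31), (4, 16, 200, 252), (12, 17, 20, 23),
    (3, 17, 24, 27), (12, 17, 28, 31), (6, 17, 201, 253), (18, 17, 216, 219), (21, 17, 220, 223),
    (12, 18, 20, 23), (3, 18, 24, 27), (12, 18, 28, 31), (6, 18, 202, 254), (18, 18, 216, 219),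
    (21, 18, 220, 223), (24, 19, 208, 219), (62, 20, 220, 220), (27, 21, 24, 31), (9, 21, 200, 255),
    (27, 22, 24, 31), (9, 22, 200, 255), (6, 23, 208, 223), (6, 24, 80, 216), (6, 24, 144, 216),
    (6, 27, 80, 219), (6, 27, 144, 219), (21, 29, 85, 221), (21, 29, 149, 221), (21, 30, 86, 222),
    (21, 30, 150, 222), (36, 31, 80, 223), (36, 31, 144, 223), (30, 32, 43, 43), (66, 32, 44, 47),
    (4, 32, 200, 252), (12, 33, 36, 39), (3, 33, 40, 43), (12, 33, 44, 47), (6, 33, 201, 253),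
    (18, 33, 232, 235), (21, 33, 236, 239), (12, 34, 36, 39), (3, 34, 40, 43), (12, 34, 44, 47),
    (6, 34, 202, 254), (18, 34, 232, 235), (21, 34, 236, 239), (24, 35, 224, 235),
    (62, 36, 236, 236), (27, 37, 40, 47), (9, 37, 200, 255), (27, 38, 40, 47), (9, 38, 200, 255),
    (6, 39, 224, 239), (6, 40, 96, 232), (6, 40, 160, 232), (6, 43, 96, 235), (6, 43, 160, 235),
    (21, 45, 101, 237), (21, 45, 165, 237), (21, 46, 102, 238), (21, 46, 166, 238),
    (36, 47, 96, 239), (36, 47, 160, 239), (12, 49, 56, 59), (36, 49, 249, 249), (12, 50, 56, 59),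
    (36, 50, 250, 250), (12, 51, 240, 251), (4, 52, 64, 252), (9, 52, 73, 255), (9, 52, 74, 255),
    (4, 52, 128, 252), (9, 52, 137, 255), (9, 52, 138, 255), (6, 53, 65, 253), (6, 53, 129, 253),
    (6, 54, 66, 254), (6, 54, 130, 254), (12, 56, 112, 248), (12, 56, 176, 248), (6, 57, 113, 249),
    (6, 57, 177, 249), (6, 58, 114, 250), (6, 58, 178, 250), (30, 59, 112, 251), (30, 59, 176, 251),
    (4, 60, 116, 252), (4, 60, 180, 252), (30, 64, 71, 71), (66, 64, 76, 79), (3, 65, 68, 71),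
    (12, 65, 72, 75), (12, 65, 76, 79), (18, 65, 116, 119), (21, 65, 124, 127), (3, 66, 68, 71),
    (12, 66, 72, 75), (12, 66, 76, 79), (18, 66, 116, 119), (21, 66, 124, 127), (24, 67, 112, 119),
    (27, 68, 73, 79), (27, 68, 74, 79), (6, 68, 80, 116), (6, 68, 96, 116), (6, 71, 80, 119),
    (6, 71, 96, 119), (62, 72, 124, 124), (6, 75, 112, 127), (21, 77, 89, 125), (21, 77, 105, 125),
    (21, 78, 90, 126), (21, 78, 106, 126), (36, 79, 80, 127), (36, 79, 96, 127), (21, 81, 84, 87),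
    (21, 81, 88, 91), (6, 81, 92, 95), (21, 82, 84, 87), (21, 82, 88, 91), (6, 82, 92, 95),
    (12, 84, 88, 95), (21, 97, 100, 103), (21, 97, 104, 107), (6, 97, 108, 111), (21, 98, 100, 103),
    (21, 98, 104, 107), (6, 98, 108, 111), (12, 100, 104, 111), (18, 113, 120, 123),
    (18, 114, 120, 123), (30, 128, 135, 135), (66, 128, 140, 143), (3, 129, 132, 135),
    (12, 129, 136, 139), (12, 129, 140, 143), (18, 129, 180, 183), (21, 129, 188, 191),
    (3, 130, 132, 135), (12, 130, 136, 139), (12, 130, 140, 143), (18, 130, 180, 183),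
    (21, 130, 188, 191), (24, 131, 176, 183), (27, 132, 137, 143), (27, 132, 138, 143),
    (6, 132, 144, 180), (6, 132, 160, 180), (6, 135, 144, 183), (6, 135, 160, 183),
    (62, 136, 188, 188), (6, 139, 176, 191), (21, 141, 153, 189), (21, 141, 169, 189),
    (21, 142, 154, 190), (21, 142, 170, 190), (36, 143, 144, 191), (36, 143, 160, 191),
    (21, 145, 148, 151), (21, 145, 152, 155), (6, 145, 156, 159), (21, 146, 148, 151),
    (21, 146, 152, 155), (6, 146, 156, 159), (12, 148, 152, 159), (21, 161, 164, 167),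
    (21, 161, 168, 171), (6, 161, 172, 175), (21, 162, 164, 167), (21, 162, 168, 171),
    (6, 162, 172, 175), (12, 164, 168, 175), (18, 177, 184, 187), (18, 178, 184, 187),
    (12, 193, 196, 199), (36, 193, 245, 245), (12, 194, 196, 199), (36, 194, 246, 246),
    (12, 195, 240, 247), (12, 196, 208, 244), (12, 196, 224, 244), (6, 197, 209, 245),
    (6, 197, 225, 245), (6, 198, 210, 246), (6, 198, 226, 246), (30, 199, 208, 247),
    (30, 199, 224, 247), (4, 204, 216, 252), (4, 204, 232, 252), (18, 209, 212, 215),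
    (18, 210, 212, 215), (18, 225, 228, 231), (18, 226, 228, 231)]
    (by decide +kernel) (by decide) [a, b, c, d, e, f, g, h] rfl (by simp) hnd ?_ ?_ hS
  · simp [decodeSet, h1, h2, h3, h4]
  · simp [decodeSet]

theorem not_bookTriangle {S : Finset (Finset ℕ)} (hS : NonFC (gen S)) {a b c d e f g : ℕ}
    (hnd : [a, b, c, d, e, f, g].Nodup)
    (h1 : {a, b, c} ∈ S) (h2 : {a, b, d} ∈ S) (h3 : {c, e, f} ∈ S) (h4 : {d, e, g} ∈ S) : False
    := by
  refine not_nonFC_of_certifies [164, 164, 164, 164, 164, 82, 82]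
    [7, 11, 52, 88] [
    (356, 0, 7, 7), (356, 0, 11, 11), (136, 0, 52, 52), (136, 0, 88, 88), (60, 1, 12, 15),
    (298, 1, 53, 53), (298, 1, 89, 89), (60, 2, 12, 15), (298, 2, 54, 54), (298, 2, 90, 90),
    (160, 3, 32, 55), (160, 3, 64, 91), (8, 3, 112, 127), (208, 4, 8, 15), (82, 4, 16, 95),
    (19, 4, 25, 63), (19, 4, 26, 63), (164, 4, 89, 95), (164, 4, 90, 95), (292, 5, 9, 125),
    (36, 5, 64, 95), (292, 6, 10, 126), (36, 6, 64, 95), (164, 7, 36, 55), (192, 7, 96, 127),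
    (82, 8, 16, 63), (19, 8, 21, 95), (19, 8, 22, 95), (164, 8, 53, 63), (164, 8, 54, 63),
    (36, 9, 32, 63), (36, 10, 32, 63), (164, 11, 72, 91), (192, 11, 96, 127), (164, 12, 20, 92),
    (164, 12, 24, 60), (44, 12, 97, 127), (44, 12, 98, 127), (22, 13, 21, 93), (22, 13, 25, 61),
    (154, 13, 41, 61), (154, 13, 69, 93), (22, 14, 22, 94), (22, 14, 26, 62), (154, 14, 42, 62),
    (154, 14, 70, 94), (246, 16, 23, 23), (246, 16, 27, 27), (41, 17, 20, 23), (41, 17, 24, 27),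
    (246, 17, 28, 31), (41, 18, 20, 23), (41, 18, 24, 27), (246, 18, 28, 31), (164, 20, 24, 31),
    (420, 32, 43, 43), (168, 32, 64, 124), (118, 33, 40, 43), (30, 33, 52, 55), (296, 33, 65, 125),
    (4, 33, 76, 127), (44, 33, 120, 123), (118, 34, 40, 43), (30, 34, 52, 55), (296, 34, 66, 126),
    (4, 34, 76, 127), (44, 34, 120, 123), (108, 35, 48, 55), (56, 35, 48, 123), (160, 35, 96, 123),
    (168, 36, 40, 47), (160, 36, 72, 124), (162, 37, 44, 47), (2, 37, 104, 127), (162, 38, 44, 47),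
    (2, 38, 104, 127), (28, 40, 48, 120), (60, 40, 96, 120), (164, 41, 49, 121), (164, 42, 50, 122),
    (300, 43, 48, 63), (192, 43, 56, 123), (4, 44, 65, 127), (4, 44, 66, 127), (152, 45, 61, 61),
    (152, 46, 62, 62), (120, 52, 97, 127), (120, 52, 98, 127), (420, 64, 71, 71), (118, 65, 68, 71),
    (30, 65, 88, 91), (44, 65, 116, 119), (118, 66, 68, 71), (30, 66, 88, 91), (44, 66, 116, 119),
    (108, 67, 80, 91), (56, 67, 80, 119), (160, 67, 96, 119), (168, 68, 72, 79), (28, 68, 80, 116),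
    (60, 68, 96, 116), (164, 69, 81, 117), (164, 70, 82, 118), (300, 71, 80, 95),
    (192, 71, 84, 119), (162, 73, 76, 79), (2, 73, 100, 127), (162, 74, 76, 79), (2, 74, 100, 127),
    (152, 77, 93, 93), (152, 78, 94, 94), (120, 88, 97, 127), (120, 88, 98, 127),
    (68, 97, 100, 103), (68, 97, 104, 107), (204, 97, 108, 111), (68, 98, 100, 103),
    (68, 98, 104, 107), (204, 98, 108, 111), (160, 99, 112, 119), (160, 99, 112, 123),
    (248, 100, 104, 111), (68, 101, 105, 125), (68, 102, 106, 126)]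
    (by decide +kernel) (by decide) [a, b, c, d, e, f, g] rfl (by simp) hnd ?_ ?_ hS
  · simp [decodeSet, h1, h2, h3, h4]
  · simp [decodeSet]

theorem not_bookPair {S : Finset (Finset ℕ)} (hS : NonFC (gen S)) {a b c d e f : ℕ}
    (hnd : [a, b, c, d, e, f].Nodup)
    (h1 : {a, b, c} ∈ S) (h2 : {a, b, d} ∈ S) (h3 : {c, e, f} ∈ S) (h4 : {d, e, f} ∈ S) : False
    := by
  refine not_nonFC_of_certifies [40, 40, 40, 40, 40, 40]
    [7, 11, 52, 56] [
    (60, 0, 7, 7), (60, 0, 11, 11), (60, 0, 52, 52), (60, 0, 56, 56), (12, 1, 4, 7), (12, 1, 8, 11),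
    (44, 1, 12, 15), (8, 1, 13, 61), (42, 1, 52, 55), (42, 1, 56, 59), (12, 2, 4, 7),
    (12, 2, 8, 11), (44, 2, 12, 15), (8, 2, 14, 62), (42, 2, 52, 55), (42, 2, 56, 59),
    (40, 3, 48, 55), (40, 3, 48, 59), (56, 4, 8, 15), (56, 4, 8, 60), (12, 4, 16, 52),
    (12, 4, 32, 52), (19, 5, 17, 53), (19, 5, 25, 61), (19, 5, 33, 53), (19, 5, 41, 61),
    (16, 5, 60, 63), (19, 6, 18, 54), (19, 6, 26, 62), (19, 6, 34, 54), (19, 6, 42, 62),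
    (16, 6, 60, 63), (42, 7, 16, 55), (42, 7, 32, 55), (12, 8, 16, 56), (12, 8, 32, 56),
    (19, 9, 17, 57), (19, 9, 21, 61), (19, 9, 33, 57), (19, 9, 37, 61), (16, 9, 60, 63),
    (19, 10, 18, 58), (19, 10, 22, 62), (19, 10, 34, 58), (19, 10, 38, 62), (16, 10, 60, 63),
    (42, 11, 16, 59), (42, 11, 32, 59), (44, 12, 16, 60), (4, 12, 17, 63), (4, 12, 18, 63),
    (44, 12, 32, 60), (4, 12, 33, 63), (4, 12, 34, 63), (44, 13, 61, 61), (44, 14, 62, 62),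
    (16, 15, 20, 63), (16, 15, 24, 63), (16, 15, 36, 63), (16, 15, 40, 63), (8, 16, 28, 31),
    (19, 17, 20, 23), (19, 17, 24, 27), (19, 18, 20, 23), (19, 18, 24, 27), (19, 20, 25, 31),
    (19, 20, 26, 31), (19, 21, 24, 31), (19, 22, 24, 31), (44, 28, 31, 31), (8, 32, 44, 47),
    (19, 33, 36, 39), (19, 33, 40, 43), (19, 34, 36, 39), (19, 34, 40, 43), (19, 36, 41, 47),
    (19, 36, 42, 47), (19, 37, 40, 47), (19, 38, 40, 47), (44, 44, 47, 47), (48, 55, 63, 63),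
    (48, 59, 63, 63)]
    (by decide +kernel) (by decide) [a, b, c, d, e, f] rfl (by simp) hnd ?_ ?_ hS
  · simp [decodeSet, h1, h2, h3, h4]
  · simp [decodeSet]

theorem not_bookTailOverlap {S : Finset (Finset ℕ)} (hS : NonFC (gen S)) {a b c d e f g : ℕ}
    (hnd : [a, b, c, d, e, f, g].Nodup)
    (h1 : {a, b, c} ∈ S) (h2 : {a, b, d} ∈ S) (h3 : {c, e, f} ∈ S) (h4 : {e, f, g} ∈ S) : False
    := by
  refine not_nonFC_of_certifies [6, 6, 8, 4, 6, 6, 4]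
    [7, 11, 52, 112] [
    (20, 0, 7, 7), (20, 0, 52, 52), (6, 1, 8, 11), (4, 1, 12, 15), (10, 1, 52, 55),
    (8, 1, 112, 119), (6, 2, 8, 11), (4, 2, 12, 15), (10, 2, 52, 55), (8, 2, 112, 119),
    (8, 3, 48, 55), (8, 3, 115, 115), (2, 4, 24, 63), (2, 4, 40, 63), (2, 4, 65, 119),
    (2, 4, 66, 119), (4, 4, 89, 127), (4, 4, 90, 127), (4, 4, 105, 127), (4, 4, 106, 127),
    (2, 5, 8, 15), (1, 5, 17, 53), (1, 5, 33, 53), (8, 5, 65, 117), (2, 6, 8, 15), (1, 6, 18, 54),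
    (1, 6, 34, 54), (8, 6, 66, 118), (10, 7, 16, 55), (10, 7, 32, 55), (8, 8, 60, 60),
    (4, 8, 117, 127), (4, 8, 118, 127), (20, 9, 61, 61), (2, 9, 112, 123), (2, 9, 116, 127),
    (2, 9, 121, 121), (20, 10, 62, 62), (2, 10, 112, 123), (2, 10, 116, 127), (2, 10, 122, 122),
    (8, 11, 16, 63), (8, 11, 32, 63), (2, 11, 80, 123), (2, 11, 96, 123), (4, 12, 88, 124),
    (4, 12, 104, 124), (10, 13, 73, 125), (10, 14, 74, 126), (2, 15, 80, 127), (2, 15, 96, 127),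
    (6, 16, 64, 112), (4, 16, 68, 116), (1, 17, 20, 23), (7, 17, 28, 31), (7, 17, 69, 117),
    (1, 18, 20, 23), (7, 18, 28, 31), (7, 18, 70, 118), (4, 19, 67, 115), (8, 20, 24, 31),
    (2, 20, 64, 116), (1, 21, 24, 31), (1, 21, 65, 117), (1, 22, 24, 31), (1, 22, 66, 118),
    (6, 24, 72, 120), (2, 24, 76, 124), (2, 25, 73, 121), (6, 25, 77, 125), (2, 26, 74, 122),
    (6, 26, 78, 126), (4, 27, 75, 123), (4, 31, 64, 127), (6, 32, 64, 112), (4, 32, 68, 116),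
    (1, 33, 36, 39), (7, 33, 44, 47), (7, 33, 69, 117), (1, 34, 36, 39), (7, 34, 44, 47),
    (7, 34, 70, 118), (4, 35, 67, 115), (8, 36, 40, 47), (2, 36, 64, 116), (1, 37, 40, 47),
    (1, 37, 65, 117), (1, 38, 40, 47), (1, 38, 66, 118), (6, 40, 72, 120), (2, 40, 76, 124),
    (2, 41, 73, 121), (6, 41, 77, 125), (2, 42, 74, 122), (6, 42, 78, 126), (4, 43, 75, 123),
    (4, 47, 64, 127), (8, 48, 59, 59), (4, 49, 56, 59), (4, 50, 56, 59), (12, 55, 63, 63),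
    (12, 55, 119, 119), (8, 64, 71, 71), (6, 65, 72, 75), (2, 65, 76, 79), (6, 66, 72, 75),
    (2, 66, 76, 79), (4, 68, 73, 79), (4, 68, 74, 79), (4, 75, 79, 79), (20, 80, 87, 87),
    (2, 80, 91, 91), (2, 81, 88, 91), (6, 81, 92, 95), (2, 82, 88, 91), (6, 82, 92, 95),
    (10, 84, 88, 95), (20, 96, 103, 103), (2, 96, 107, 107), (2, 97, 104, 107), (6, 97, 108, 111),
    (2, 98, 104, 107), (6, 98, 108, 111), (10, 100, 104, 111), (4, 113, 120, 123),
    (4, 114, 120, 123), (4, 120, 124, 124)]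
    (by decide +kernel) (by decide) [a, b, c, d, e, f, g] rfl (by simp) hnd ?_ ?_ hS
  · simp [decodeSet, h1, h2, h3, h4]
  · simp [decodeSet]

theorem not_bookPathOverlap {S : Finset (Finset ℕ)} (hS : NonFC (gen S)) {a b c d e f g h i : ℕ}
    (hnd : [a, b, c, d, e, f, g, h, i].Nodup)
    (h1 : {a, b, c} ∈ S) (h2 : {a, b, d} ∈ S) (h3 : {c, e, f} ∈ S) (h4 : {e, g, h} ∈ S)
    (h5 : {g, h, i} ∈ S) : False := by
  refine not_nonFC_of_certifies
    [2526690856, 2526690856, 3790036284, 1263345428, 3790036284, 2526690856, 2526690856, 2526690856,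
    1263345428]
    [7, 11, 52, 208, 448] [
    (1859474168, 0, 7, 7), (19021269368, 0, 52, 52), (1859474168, 0, 208, 208),
    (3103414066, 1, 12, 15), (4604545464, 1, 52, 55), (2508659350, 1, 208, 215),
    (5678343284, 1, 212, 215), (149817610, 1, 216, 219), (617450850, 1, 244, 247),
    (1024605368, 1, 260, 455), (3103414066, 2, 12, 15), (4604545464, 2, 52, 55),
    (2508659350, 2, 208, 215), (5678343284, 2, 212, 215), (149817610, 2, 216, 219),
    (617450850, 2, 244, 247), (1024605368, 2, 260, 455), (10112042612, 3, 211, 211),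
    (2521411668, 3, 448, 455), (539662560, 4, 16, 52), (685496884, 4, 24, 63),
    (13883377424, 4, 212, 212), (25804134, 4, 225, 247), (25804134, 4, 226, 247),
    (7151104222, 5, 17, 53), (2955659202, 5, 33, 53), (7151104222, 6, 18, 54),
    (2955659202, 6, 34, 54), (1595901960, 7, 43, 63), (2508659350, 7, 64, 215),
    (2508659350, 7, 128, 215), (299635220, 7, 256, 455), (3673548724, 8, 21, 63),
    (3673548724, 8, 22, 63), (608925673, 8, 69, 223), (608925673, 8, 70, 223),
    (608925673, 8, 133, 223), (608925673, 8, 134, 223), (299635220, 8, 208, 219),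
    (1935044140, 8, 229, 255), (1935044140, 8, 230, 255), (1262178792, 8, 244, 255),
    (4762999816, 8, 256, 459), (235824600, 8, 484, 511), (2921011210, 9, 61, 61),
    (5976526874, 9, 77, 253), (5976526874, 9, 141, 253), (286080178, 9, 457, 457),
    (2921011210, 10, 62, 62), (5976526874, 10, 78, 254), (5976526874, 10, 142, 254),
    (286080178, 10, 458, 458), (351849012, 11, 24, 219), (1582441560, 11, 112, 255),
    (1582441560, 11, 176, 255), (2521411668, 11, 192, 219), (2034309812, 11, 343, 479),
    (2034309812, 11, 407, 479), (29909648, 12, 33, 63), (29909648, 12, 34, 63),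
    (211863512, 12, 201, 223), (211863512, 12, 202, 223), (2971539914, 12, 449, 463),
    (2971539914, 12, 450, 463), (2581980786, 13, 25, 61), (8038556166, 13, 221, 221),
    (62949682, 13, 233, 253), (2581980786, 14, 26, 62), (8038556166, 14, 222, 222),
    (62949682, 14, 234, 254), (993514148, 15, 27, 223), (418447836, 15, 32, 63),
    (624961572, 15, 87, 223), (624961572, 15, 151, 223), (5691573976, 15, 232, 255),
    (380059884, 15, 283, 479), (13883377424, 16, 23, 23), (25804134, 16, 99, 247),
    (25804134, 16, 163, 247), (685496884, 16, 260, 500), (86652496, 17, 24, 27),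
    (324284344, 17, 33, 53), (1272361181, 17, 65, 209), (1272361181, 17, 129, 209),
    (86652496, 18, 24, 27), (324284344, 18, 34, 54), (1272361181, 18, 66, 210),
    (1272361181, 18, 130, 210), (868062132, 19, 32, 55), (617450850, 19, 67, 211),
    (617450850, 19, 131, 211), (2950417880, 19, 259, 467), (2029933782, 20, 25, 31),
    (2029933782, 20, 26, 31), (2029933782, 20, 324, 468), (2029933782, 20, 388, 468),
    (1263345428, 21, 69, 213), (1263345428, 21, 133, 213), (3477555498, 21, 261, 469),
    (1263345428, 22, 70, 214), (1263345428, 22, 134, 214), (3477555498, 22, 262, 470),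
    (5678343284, 23, 64, 215), (5678343284, 23, 128, 215), (4302892532, 24, 40, 60),
    (1024605368, 24, 64, 219), (1008742598, 24, 104, 252), (1024605368, 24, 128, 219),
    (1008742598, 24, 168, 252), (1526607464, 24, 328, 472), (1526607464, 24, 392, 472),
    (1188436623, 25, 73, 217), (1188436623, 25, 137, 217), (229654060, 25, 329, 473),
    (109314565, 25, 361, 509), (229654060, 25, 393, 473), (109314565, 25, 425, 509),
    (1188436623, 26, 74, 218), (1188436623, 26, 138, 218), (229654060, 26, 330, 474),
    (109314565, 26, 362, 510), (229654060, 26, 394, 474), (109314565, 26, 426, 510),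
    (1029165356, 27, 72, 219), (1029165356, 27, 136, 219), (2526690856, 28, 76, 220),
    (2526690856, 28, 140, 220), (342748442, 28, 332, 476), (342748442, 28, 396, 476),
    (2051258535, 29, 77, 221), (2051258535, 29, 141, 221), (4182946222, 29, 269, 477),
    (2051258535, 30, 78, 222), (2051258535, 30, 142, 222), (4182946222, 30, 270, 478),
    (2526690856, 32, 195, 247), (868062132, 32, 196, 244), (6293562600, 32, 199, 247),
    (6293562600, 32, 211, 247), (418447836, 32, 464, 500), (536022364, 33, 36, 39),
    (2704551392, 33, 40, 43), (5053381712, 33, 209, 245), (1029645618, 33, 488, 491),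
    (536022364, 34, 36, 39), (2704551392, 34, 40, 43), (5053381712, 34, 210, 246),
    (1029645618, 34, 488, 491), (3813200824, 35, 243, 243), (638192264, 35, 288, 487),
    (3128679480, 35, 483, 483), (256170530, 36, 41, 47), (256170530, 36, 42, 47),
    (3228055720, 36, 200, 255), (2647160958, 36, 233, 495), (2647160958, 36, 234, 495),
    (6962621718, 37, 193, 245), (1582441560, 37, 448, 503), (6962621718, 38, 194, 246),
    (1582441560, 38, 448, 503), (1072044728, 39, 203, 255), (2082355748, 40, 204, 252),
    (2526690856, 40, 216, 252), (638192264, 40, 224, 251), (200910952, 40, 288, 491),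
    (3144141706, 41, 201, 253), (2202406512, 41, 249, 249), (5738878596, 41, 473, 509),
    (1469717472, 41, 484, 495), (3144141706, 42, 202, 254), (2202406512, 42, 250, 250),
    (5738878596, 42, 474, 510), (1469717472, 42, 484, 495), (563816494, 43, 104, 491),
    (2907123658, 43, 120, 251), (563816494, 43, 168, 491), (2907123658, 43, 184, 251),
    (475335292, 43, 200, 255), (1449366940, 43, 203, 255), (2218052832, 44, 200, 252),
    (272231312, 44, 289, 495), (272231312, 44, 290, 495), (4817557112, 44, 488, 495),
    (2812771034, 45, 457, 509), (2812771034, 46, 458, 510), (536022364, 48, 96, 240),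
    (536022364, 48, 160, 240), (3228055720, 48, 259, 503), (256170530, 48, 352, 496),
    (2647160958, 48, 355, 507), (256170530, 48, 416, 496), (2647160958, 48, 419, 507),
    (2850975200, 49, 56, 59), (2526690856, 49, 289, 497), (2850975200, 50, 56, 59),
    (2526690856, 50, 290, 498), (434031066, 51, 355, 499), (434031066, 51, 419, 499),
    (4604545464, 52, 64, 244), (4604545464, 52, 128, 244), (917360232, 52, 329, 511),
    (917360232, 52, 330, 511), (917360232, 52, 393, 511), (917360232, 52, 394, 511),
    (6254451188, 53, 321, 501), (6254451188, 53, 385, 501), (6254451188, 54, 322, 502),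
    (6254451188, 54, 386, 502), (617450850, 55, 64, 247), (617450850, 55, 128, 247),
    (1262178792, 55, 256, 503), (3090507350, 56, 107, 251), (3090507350, 56, 171, 251),
    (2688833028, 57, 105, 249), (2688833028, 57, 169, 249), (2688833028, 58, 106, 250),
    (2688833028, 58, 170, 250), (235824600, 59, 256, 511), (1469717472, 59, 352, 507),
    (1469717472, 59, 416, 507), (1075723133, 60, 321, 511), (1075723133, 60, 322, 511),
    (1075723133, 60, 385, 511), (1075723133, 60, 386, 511), (449610284, 61, 265, 509),
    (449610284, 62, 266, 510), (149817610, 64, 263, 455), (3103414066, 64, 272, 464),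
    (1272361181, 65, 68, 71), (7580072568, 65, 117, 117), (1254329675, 65, 124, 127),
    (1254329675, 65, 309, 501), (1272361181, 66, 68, 71), (7580072568, 66, 118, 118),
    (1254329675, 66, 124, 127), (1254329675, 66, 310, 502), (6962621718, 67, 112, 119),
    (7151104222, 68, 80, 116), (324284344, 68, 96, 116), (86652496, 68, 260, 452),
    (1451348615, 69, 261, 453), (3002123177, 69, 277, 469), (1451348615, 70, 262, 454),
    (3002123177, 70, 278, 470), (5053381712, 71, 96, 119), (13174500014, 72, 124, 124),
    (956479766, 72, 316, 508), (1588152480, 73, 76, 79), (6254451188, 73, 116, 127),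
    (1075723133, 73, 308, 511), (1588152480, 74, 76, 79), (6254451188, 74, 116, 127),
    (1075723133, 74, 308, 511), (142583410, 75, 88, 127), (2971539914, 75, 272, 475),
    (1939258388, 75, 319, 511), (1877076752, 76, 268, 460), (2597982561, 77, 105, 125),
    (74527913, 77, 285, 477), (2597982561, 78, 106, 126), (74527913, 78, 286, 478),
    (649614104, 79, 287, 479), (2955659202, 80, 96, 116), (1263345428, 81, 84, 87),
    (1451348615, 81, 88, 91), (3002123177, 81, 92, 95), (608925673, 81, 256, 471),
    (1263345428, 82, 84, 87), (1451348615, 82, 88, 91), (3002123177, 82, 92, 95),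
    (608925673, 82, 256, 471), (617450850, 83, 259, 467), (3477555498, 84, 88, 95),
    (3673548724, 84, 256, 500), (2081841798, 88, 267, 475), (5166476094, 89, 265, 473),
    (5166476094, 90, 266, 474), (1547755140, 91, 271, 479), (29909648, 96, 272, 500),
    (2704551392, 96, 288, 480), (1029645618, 96, 299, 491), (1263345428, 97, 104, 107),
    (2526690856, 97, 108, 111), (1263345428, 97, 289, 481), (2526690856, 97, 305, 497),
    (1263345428, 98, 104, 107), (2526690856, 98, 108, 111), (1263345428, 98, 290, 482),
    (2526690856, 98, 306, 498), (2500886722, 99, 307, 499), (2526690856, 100, 104, 111),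
    (2850975200, 100, 292, 484), (3208591308, 104, 296, 488), (272231312, 104, 304, 507),
    (748522619, 105, 297, 489), (281388932, 105, 313, 505), (748522619, 106, 298, 490),
    (281388932, 106, 314, 506), (2597982561, 109, 301, 493), (2597982561, 110, 302, 494),
    (1935044140, 115, 256, 503), (628309796, 120, 299, 507), (162142172, 121, 265, 509),
    (162142172, 122, 266, 510), (5612458952, 124, 264, 508), (149817610, 128, 263, 455),
    (3103414066, 128, 272, 464), (1272361181, 129, 132, 135), (7580072568, 129, 181, 181),
    (1254329675, 129, 188, 191), (1254329675, 129, 309, 501), (1272361181, 130, 132, 135),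
    (7580072568, 130, 182, 182), (1254329675, 130, 188, 191), (1254329675, 130, 310, 502),
    (6962621718, 131, 176, 183), (7151104222, 132, 144, 180), (324284344, 132, 160, 180),
    (86652496, 132, 260, 452), (1451348615, 133, 261, 453), (3002123177, 133, 277, 469),
    (1451348615, 134, 262, 454), (3002123177, 134, 278, 470), (5053381712, 135, 160, 183),
    (13174500014, 136, 188, 188), (956479766, 136, 316, 508), (1588152480, 137, 140, 143),
    (6254451188, 137, 180, 191), (1075723133, 137, 308, 511), (1588152480, 138, 140, 143),
    (6254451188, 138, 180, 191), (1075723133, 138, 308, 511), (142583410, 139, 152, 191),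
    (2971539914, 139, 272, 475), (1939258388, 139, 319, 511), (1877076752, 140, 268, 460),
    (2597982561, 141, 169, 189), (74527913, 141, 285, 477), (2597982561, 142, 170, 190),
    (74527913, 142, 286, 478), (649614104, 143, 287, 479), (2955659202, 144, 160, 180),
    (1263345428, 145, 148, 151), (1451348615, 145, 152, 155), (3002123177, 145, 156, 159),
    (608925673, 145, 256, 471), (1263345428, 146, 148, 151), (1451348615, 146, 152, 155),
    (3002123177, 146, 156, 159), (608925673, 146, 256, 471), (617450850, 147, 259, 467),
    (3477555498, 148, 152, 159), (3673548724, 148, 256, 500), (2081841798, 152, 267, 475),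
    (5166476094, 153, 265, 473), (5166476094, 154, 266, 474), (1547755140, 155, 271, 479),
    (29909648, 160, 272, 500), (2704551392, 160, 288, 480), (1029645618, 160, 299, 491),
    (1263345428, 161, 168, 171), (2526690856, 161, 172, 175), (1263345428, 161, 289, 481),
    (2526690856, 161, 305, 497), (1263345428, 162, 168, 171), (2526690856, 162, 172, 175),
    (1263345428, 162, 290, 482), (2526690856, 162, 306, 498), (2500886722, 163, 307, 499),
    (2526690856, 164, 168, 175), (2850975200, 164, 292, 484), (3208591308, 168, 296, 488),
    (272231312, 168, 304, 507), (748522619, 169, 297, 489), (281388932, 169, 313, 505),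
    (748522619, 170, 298, 490), (281388932, 170, 314, 506), (2597982561, 173, 301, 493),
    (2597982561, 174, 302, 494), (1935044140, 179, 256, 503), (628309796, 184, 299, 507),
    (162142172, 185, 265, 509), (162142172, 186, 266, 510), (5612458952, 188, 264, 508),
    (10112042612, 192, 199, 199), (617450850, 193, 196, 199), (617450850, 194, 196, 199),
    (2950417880, 196, 200, 207), (617450850, 197, 200, 207), (617450850, 198, 200, 207),
    (1697376494, 201, 204, 207), (1697376494, 202, 204, 207), (1595901960, 208, 480, 500),
    (624961572, 213, 464, 471), (624961572, 214, 464, 471), (10057278128, 215, 223, 223),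
    (10057278128, 215, 471, 471), (2034309812, 221, 448, 479), (2034309812, 222, 448, 479),
    (3813200824, 224, 231, 231), (3128679480, 224, 235, 235), (2500886722, 225, 236, 239),
    (2500886722, 226, 236, 239), (434031066, 228, 233, 239), (434031066, 228, 234, 239),
    (1072044728, 240, 451, 503), (13174500014, 257, 309, 309), (956479766, 257, 316, 319),
    (1029165356, 257, 452, 455), (13174500014, 258, 310, 310), (956479766, 258, 316, 319),
    (1029165356, 258, 452, 455), (2218052832, 259, 304, 311), (475335292, 259, 480, 503),
    (1526607464, 260, 265, 271), (1526607464, 260, 266, 271), (4302892532, 260, 288, 308),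
    (1008742598, 260, 289, 311), (1008742598, 260, 290, 311), (351849012, 260, 448, 455),
    (142583410, 261, 449, 501), (2081841798, 261, 456, 463), (142583410, 262, 450, 502),
    (2081841798, 262, 456, 463), (2526690856, 263, 288, 311), (5612458952, 264, 309, 319),
    (5612458952, 264, 310, 319), (3416388972, 267, 271, 271), (6352609920, 268, 280, 316),
    (2397042954, 269, 297, 317), (2397042954, 270, 298, 318), (3374093620, 271, 283, 319),
    (211863512, 272, 323, 471), (211863512, 272, 387, 471), (2526690856, 273, 276, 279),
    (1877076752, 273, 280, 283), (1588152480, 273, 321, 465), (1588152480, 273, 385, 465),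
    (2526690856, 274, 276, 279), (1877076752, 274, 280, 283), (1588152480, 274, 322, 466),
    (1588152480, 274, 386, 466), (2082355748, 275, 288, 311), (1697376494, 275, 323, 467),
    (1697376494, 275, 387, 467), (342748442, 276, 281, 287), (342748442, 276, 282, 287),
    (2219825194, 281, 284, 287), (4367884828, 281, 297, 317), (2219825194, 282, 284, 287),
    (4367884828, 282, 298, 318), (2219825194, 284, 332, 476), (2219825194, 284, 396, 476),
    (2034886588, 285, 333, 477), (2034886588, 285, 397, 477), (2034886588, 286, 334, 478),
    (2034886588, 286, 398, 478), (3208591308, 289, 296, 299), (563816494, 289, 480, 491),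
    (3208591308, 290, 296, 299), (563816494, 290, 480, 491), (5691573976, 291, 464, 503),
    (3090507350, 292, 481, 487), (3090507350, 292, 482, 487), (2907123658, 293, 480, 487),
    (628309796, 293, 488, 495), (2907123658, 294, 480, 487), (628309796, 294, 488, 495),
    (2526690856, 297, 300, 303), (2526690856, 298, 300, 303), (4817557112, 299, 304, 507),
    (810405532, 299, 459, 511), (2526690856, 312, 360, 504), (2526690856, 312, 424, 504),
    (1902553482, 313, 361, 505), (1902553482, 313, 425, 505), (1902553482, 314, 362, 506),
    (1902553482, 314, 426, 506), (3101702108, 317, 329, 509), (3101702108, 317, 393, 509),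
    (3101702108, 318, 330, 510), (3101702108, 318, 394, 510), (286080178, 320, 331, 331),
    (5976526874, 320, 337, 375), (5976526874, 320, 338, 375), (2921011210, 320, 372, 372),
    (1188436623, 321, 324, 327), (1188436623, 322, 324, 327), (3144141706, 323, 352, 375),
    (229654060, 324, 329, 335), (229654060, 324, 330, 335), (2581980786, 324, 336, 372),
    (109314565, 324, 361, 383), (109314565, 324, 362, 383), (5166476094, 325, 328, 335),
    (5166476094, 326, 328, 335), (162142172, 328, 357, 383), (162142172, 328, 358, 383),
    (449610284, 328, 372, 383), (3101702108, 329, 380, 383), (3101702108, 330, 380, 383),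
    (2812771034, 331, 368, 383), (4367884828, 332, 360, 380), (3361243566, 333, 345, 381),
    (3361243566, 334, 346, 382), (5738878596, 335, 352, 383), (8038556166, 336, 343, 343),
    (62949682, 336, 355, 375), (2051258535, 337, 340, 343), (74527913, 337, 348, 351),
    (2597982561, 337, 353, 373), (2051258535, 338, 340, 343), (74527913, 338, 348, 351),
    (2597982561, 338, 354, 374), (4182946222, 340, 344, 351), (2397042954, 344, 360, 380),
    (2034886588, 345, 348, 351), (2034886588, 346, 348, 351), (2202406512, 352, 359, 359),
    (2688833028, 353, 356, 359), (748522619, 353, 360, 363), (281388932, 353, 364, 367),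
    (2688833028, 354, 356, 359), (748522619, 354, 360, 363), (281388932, 354, 364, 367),
    (1902553482, 361, 364, 367), (1902553482, 362, 364, 367), (2597982561, 369, 376, 379),
    (2597982561, 370, 376, 379), (286080178, 384, 395, 395), (5976526874, 384, 401, 439),
    (5976526874, 384, 402, 439), (2921011210, 384, 436, 436), (1188436623, 385, 388, 391),
    (1188436623, 386, 388, 391), (3144141706, 387, 416, 439), (229654060, 388, 393, 399),
    (229654060, 388, 394, 399), (2581980786, 388, 400, 436), (109314565, 388, 425, 447),
    (109314565, 388, 426, 447), (5166476094, 389, 392, 399), (5166476094, 390, 392, 399),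
    (162142172, 392, 421, 447), (162142172, 392, 422, 447), (449610284, 392, 436, 447),
    (3101702108, 393, 444, 447), (3101702108, 394, 444, 447), (2812771034, 395, 432, 447),
    (4367884828, 396, 424, 444), (3361243566, 397, 409, 445), (3361243566, 398, 410, 446),
    (5738878596, 399, 416, 447), (8038556166, 400, 407, 407), (62949682, 400, 419, 439),
    (2051258535, 401, 404, 407), (74527913, 401, 412, 415), (2597982561, 401, 417, 437),
    (2051258535, 402, 404, 407), (74527913, 402, 412, 415), (2597982561, 402, 418, 438),
    (4182946222, 404, 408, 415), (2397042954, 408, 424, 444), (2034886588, 409, 412, 415),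
    (2034886588, 410, 412, 415), (2202406512, 416, 423, 423), (2688833028, 417, 420, 423),
    (748522619, 417, 424, 427), (281388932, 417, 428, 431), (2688833028, 418, 420, 423),
    (748522619, 418, 424, 427), (281388932, 418, 428, 431), (1902553482, 425, 428, 431),
    (1902553482, 426, 428, 431), (2597982561, 433, 440, 443), (2597982561, 434, 440, 443),
    (1939258388, 449, 508, 511), (1939258388, 450, 508, 511), (1449366940, 451, 480, 503),
    (993514148, 452, 464, 471), (1547755140, 453, 472, 479), (1547755140, 454, 472, 479),
    (3416388972, 456, 472, 472), (307748948, 459, 463, 463), (307748948, 459, 475, 475),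
    (810405532, 459, 488, 511), (380059884, 460, 464, 479), (3374093620, 460, 472, 508),
    (307748948, 463, 491, 511), (649614104, 465, 476, 479), (649614104, 466, 476, 479),
    (307748948, 475, 491, 511)]
    (by decide +kernel) (by decide) [a, b, c, d, e, f, g, h, i] rfl (by simp) hnd ?_ ?_ hS
  · simp [decodeSet, h1, h2, h3, h4, h5]
  · simp [decodeSet]

theorem not_bookPath {S : Finset (Finset ℕ)} (hS : NonFC (gen S)) {a b c d e f g h i j : ℕ}
    (hnd : [a, b, c, d, e, f, g, h, i, j].Nodup)
    (h1 : {a, b, c} ∈ S) (h2 : {a, b, d} ∈ S) (h3 : {c, e, f} ∈ S) (h4 : {e, g, h} ∈ S)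
    (h5 : {g, i, j} ∈ S) : False := by
  refine not_nonFC_of_certifies
    [290322136663638518630012223870872180560, 290322136663638518630012223870872180560,
    406450991329093926082017113419221052784, 174193281998183111178007334322523308336,
    377418777662730074219015891032133834728, 261289922997274666767011001483784962504,
    290322136663638518630012223870872180560, 203225495664546963041008556709610526392,
    145161068331819259315006111935436090280, 145161068331819259315006111935436090280]
    [7, 11, 52, 208, 832] [
    (1535701571255180784310212776847258775776, 0, 7, 7),
    (1048165445051202031496896015603503631208, 0, 52, 52),
    (872170029279265697282242807906162951512, 1, 4, 7),
    (209650678315220206014083547645078687444, 1, 12, 15),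
    (533660837929986170366847067032861908156, 1, 60, 63),
    (44135932208473215701312864361577128562, 1, 220, 223),
    (343605265246160489182598057763337370190, 1, 984, 987),
    (872170029279265697282242807906162951512, 2, 4, 7),
    (209650678315220206014083547645078687444, 2, 12, 15),
    (533660837929986170366847067032861908156, 2, 60, 63),
    (44135932208473215701312864361577128562, 2, 220, 223),
    (343605265246160489182598057763337370190, 2, 984, 987),
    (103813673120667986777970855891041647460, 3, 16, 55),
    (328685865279390594481463350978684177648, 3, 176, 247),
    (340506790958228045323041307364358130708, 3, 240, 247),
    (388282217296267447937573381249404766424, 3, 832, 843),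
    (261289922997274666767011001483784962504, 3, 864, 887),
    (11430730001501462476504036716103879992, 4, 144, 244),
    (15194245088162106602084913083890518400, 4, 208, 244),
    (457455645044123160871880923899076311850, 5, 17, 53),
    (817764945755014112659990161634116888512, 5, 33, 53),
    (206172246049872358322825268417727693650, 5, 208, 215),
    (456837150174989682778636051802757399656, 5, 837, 837),
    (124260802576184309031960520023060598140, 5, 960, 983),
    (457455645044123160871880923899076311850, 6, 18, 54),
    (817764945755014112659990161634116888512, 6, 34, 54),
    (206172246049872358322825268417727693650, 6, 208, 215),
    (456837150174989682778636051802757399656, 6, 838, 838),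
    (124260802576184309031960520023060598140, 6, 960, 983),
    (1144685405939154100748952898336240765704, 7, 32, 55),
    (932649683912020359588260334653963874068, 7, 80, 215),
    (18925020793868791364503696556496815836, 7, 96, 247),
    (121622449243304073471852128698469622924, 7, 128, 215),
    (833409418018859164095574749052019062830, 7, 256, 839),
    (833409418018859164095574749052019062830, 7, 512, 839),
    (5016720881287414633005506439207053784, 7, 768, 839),
    (396304497451062007540439597309657910712, 8, 60, 60),
    (8202242385143103649207843996047237564, 8, 100, 255),
    (1825122509062975523071399238347534491824, 8, 216, 216),
    (5851203410835959190047444152476150212, 8, 768, 843),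
    (574750637552644568925549343857138445746, 9, 212, 223),
    (215118029972638112902507012041822480476, 9, 216, 219),
    (324389324971508193236158141160230546102, 9, 244, 255),
    (540578186485948681126855179004779956868, 9, 836, 847),
    (574750637552644568925549343857138445746, 10, 212, 223),
    (215118029972638112902507012041822480476, 10, 216, 219),
    (324389324971508193236158141160230546102, 10, 244, 255),
    (540578186485948681126855179004779956868, 10, 836, 847),
    (107155425605345396659973229019346465256, 11, 32, 63),
    (23423924561393879898111204995247897172, 11, 120, 895),
    (604227259830901860346641611335909902000, 11, 160, 255),
    (24916274037199251386034855851109910268, 11, 343, 991),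
    (43198493405255670905971518055851080344, 11, 480, 1023),
    (24916274037199251386034855851109910268, 11, 599, 991),
    (43198493405255670905971518055851080344, 11, 736, 1023),
    (33436105402911198680208582451459557424, 11, 791, 895),
    (169719655370000338762097852706341264996, 11, 944, 1023),
    (317819934830638809580862015519121495968, 12, 40, 60),
    (407626214746948801895639174981113655740, 12, 216, 252),
    (277830963443800717782391611176881158148, 12, 984, 1020),
    (652906691904778297865349236187118976750, 13, 25, 61),
    (314892670532430641035774902301364043218, 13, 73, 893),
    (44619179512626762553475240158480060766, 13, 233, 253),
    (39166332689936208586519618223644930334, 13, 848, 991),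
    (652906691904778297865349236187118976750, 14, 26, 62),
    (314892670532430641035774902301364043218, 14, 74, 894),
    (44619179512626762553475240158480060766, 14, 234, 254),
    (39166332689936208586519618223644930334, 14, 848, 991),
    (242869757462320875759337925304016972240, 15, 80, 223),
    (308988285799392769927233783432664996284, 15, 107, 895),
    (916491204245575119705347301963443900, 15, 124, 895),
    (63908372580877928994450520367648462484, 15, 491, 1023),
    (63908372580877928994450520367648462484, 15, 747, 1023),
    (1368283021777222607618192098102969260400, 16, 23, 23),
    (92267183816780723911506846934714303586, 16, 391, 983),
    (92267183816780723911506846934714303586, 16, 647, 983),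
    (172398398449470625149900362523055222496, 16, 768, 884),
    (172428053683337837497037588639598903354, 17, 24, 27),
    (217730013146868373862159171281953335462, 17, 28, 31),
    (68800243447193126323259939154897263270, 17, 769, 977),
    (43559909850406292904851830201831627042, 17, 844, 991),
    (166935228581592148212257028725751503822, 17, 848, 859),
    (121476093900124690437606080741641431608, 17, 852, 855),
    (172428053683337837497037588639598903354, 18, 24, 27),
    (217730013146868373862159171281953335462, 18, 28, 31),
    (68800243447193126323259939154897263270, 18, 770, 978),
    (43559909850406292904851830201831627042, 18, 844, 991),
    (166935228581592148212257028725751503822, 18, 848, 859),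
    (121476093900124690437606080741641431608, 18, 852, 855),
    (278006955118851097955978190213564955796, 19, 67, 211),
    (493547632328185481671020780580482706952, 19, 835, 979),
    (621058213181082406172836396048003829496, 20, 68, 212),
    (395069265141652409032206387500048802464, 20, 132, 212),
    (116788115907171308641165449517054205680, 21, 24, 31),
    (21459885913115884635112158514775229510, 21, 209, 245),
    (754690848219293745540621651673555147500, 21, 837, 981),
    (116788115907171308641165449517054205680, 22, 24, 31),
    (21459885913115884635112158514775229510, 22, 210, 246),
    (754690848219293745540621651673555147500, 22, 838, 982),
    (357779137108502843272846870757501211802, 23, 336, 855),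
    (357779137108502843272846870757501211802, 23, 592, 855),
    (507563679228397661757492244652530746516, 23, 784, 855),
    (208036175246452264297386409301508319352, 24, 40, 60),
    (46527660848929620209187116088151816864, 24, 341, 863),
    (46527660848929620209187116088151816864, 24, 342, 863),
    (46527660848929620209187116088151816864, 24, 597, 863),
    (46527660848929620209187116088151816864, 24, 598, 863),
    (254031869580683703801260695887013157990, 24, 849, 859),
    (254031869580683703801260695887013157990, 24, 850, 859),
    (376661732895447438924056182263301218434, 25, 41, 61),
    (42858252540391508460670064188882467906, 25, 73, 217),
    (376661732895447438924056182263301218434, 26, 42, 62),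
    (42858252540391508460670064188882467906, 26, 74, 218),
    (288923031252057630863931484711557815672, 27, 128, 219),
    (373009049639859376341582406568463258212, 27, 839, 895),
    (2278376804761038281574732257136131440, 27, 911, 991),
    (232280888032631845124709772339099344364, 28, 840, 892),
    (535358986718177781694115024830608470468, 29, 77, 221),
    (345626872643614021023369089102294012750, 29, 141, 221),
    (193535602596117733240193410214485688842, 29, 845, 989),
    (535358986718177781694115024830608470468, 30, 78, 222),
    (345626872643614021023369089102294012750, 30, 142, 222),
    (193535602596117733240193410214485688842, 30, 846, 990),
    (55213730494647342945955622389554582658, 31, 279, 863),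
    (55213730494647342945955622389554582658, 31, 535, 863),
    (65061164790599197443717216238423210016, 31, 779, 991),
    (23921666189254882907238824196844868352, 32, 71, 887),
    (444892513640542006427737028223509998084, 32, 195, 247),
    (340632158937537095529184809707250384580, 32, 240, 240),
    (201538410051901427104402203756721294792, 33, 193, 245),
    (236316090361898205749071747102148522810, 33, 209, 245),
    (163395980024267439161522965739463323248, 33, 976, 1015),
    (61627470791475260338075263508998091494, 33, 1000, 1019),
    (201538410051901427104402203756721294792, 34, 194, 246),
    (236316090361898205749071747102148522810, 34, 210, 246),
    (163395980024267439161522965739463323248, 34, 976, 1015),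
    (61627470791475260338075263508998091494, 34, 1000, 1019),
    (843388327313004849262874247025598528076, 35, 48, 251),
    (56610296344274558490163646974105231660, 35, 848, 887),
    (73796706873142153748344022050911338026, 36, 41, 47),
    (73796706873142153748344022050911338026, 36, 42, 47),
    (950421338699943695029488671849261846984, 36, 128, 244),
    (150370435207417627582875846693665853372, 36, 864, 871),
    (360967243892691953909159563242074493534, 37, 40, 47),
    (487898973025399199155299350887949489586, 37, 129, 245),
    (636639643163291552444559362407098920680, 37, 833, 885),
    (360967243892691953909159563242074493534, 38, 40, 47),
    (487898973025399199155299350887949489586, 38, 130, 246),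
    (636639643163291552444559362407098920680, 38, 834, 886),
    (516715440833601149638561894750679957212, 39, 199, 247),
    (357533303052322253349697335373411231330, 39, 288, 871),
    (357533303052322253349697335373411231330, 39, 544, 871),
    (84941507169941332035887506985349898476, 40, 96, 251),
    (64190536562891662195988596904771811304, 40, 101, 879),
    (64190536562891662195988596904771811304, 40, 102, 879),
    (179044220221432486047093860816413905892, 40, 196, 255),
    (72743207935835135745546007922059635940, 40, 248, 248),
    (93695302215626145355607455585003738476, 41, 77, 893),
    (84722476057519533805805914314775312106, 41, 141, 253),
    (503380114946454950823234098882409897142, 41, 201, 253),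
    (93695302215626145355607455585003738476, 42, 78, 894),
    (84722476057519533805805914314775312106, 42, 142, 254),
    (503380114946454950823234098882409897142, 42, 202, 254),
    (658767485266258582056996454374003608320, 43, 800, 875),
    (838303764400610907569294137005612853528, 44, 200, 252),
    (379514794087307309764605772513212402176, 44, 840, 892),
    (550649208025961811961660061687055794024, 45, 841, 893),
    (203469093069874666188856969863889436152, 45, 864, 879),
    (550649208025961811961660061687055794024, 46, 842, 894),
    (203469093069874666188856969863889436152, 46, 864, 879),
    (273447457491392077790699458689862488632, 47, 79, 255),
    (50660726437603174508560196023184083748, 47, 107, 879),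
    (284129794605398296248736514389140128236, 47, 192, 255),
    (156024507965356633033563602152707021976, 48, 835, 887),
    (307036779708011851538617158240619262468, 48, 843, 895),
    (479061166475198758634836779838578361140, 49, 56, 59),
    (24973832635376461017939254381636439694, 49, 161, 241),
    (214331887263522362731141023774190507634, 49, 832, 887),
    (7438455284998714191113501682775142932, 49, 880, 891),
    (479061166475198758634836779838578361140, 50, 56, 59),
    (24973832635376461017939254381636439694, 50, 162, 242),
    (214331887263522362731141023774190507634, 50, 832, 887),
    (7438455284998714191113501682775142932, 50, 880, 891),
    (852586571235719110603108831870610483332, 51, 99, 243),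
    (135962824409104997974771527090424135024, 51, 931, 1011),
    (214776061043675739513858765349401093793, 52, 321, 887),
    (214776061043675739513858765349401093793, 52, 322, 887),
    (214776061043675739513858765349401093793, 52, 577, 887),
    (214776061043675739513858765349401093793, 52, 578, 887),
    (341304416602342277556240867393190981494, 52, 897, 1015),
    (341304416602342277556240867393190981494, 52, 898, 1015),
    (594061974900022858971433709185965773097, 53, 257, 885),
    (594061974900022858971433709185965773097, 53, 513, 885),
    (594061974900022858971433709185965773097, 54, 258, 886),
    (594061974900022858971433709185965773097, 54, 514, 886),
    (290379082366726747338947819662138198938, 55, 384, 1015),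
    (290379082366726747338947819662138198938, 55, 640, 1015),
    (2375698810757447732872315844309633264, 56, 817, 891),
    (2375698810757447732872315844309633264, 56, 818, 891),
    (203225495664546963041008556709610526392, 56, 840, 892),
    (449271908041552271476875848682658526790, 57, 169, 249),
    (514094806756885757782181381136750657366, 57, 873, 1017),
    (269774962234938242518851623314604230146, 57, 880, 891),
    (449271908041552271476875848682658526790, 58, 170, 250),
    (514094806756885757782181381136750657366, 58, 874, 1018),
    (269774962234938242518851623314604230146, 58, 880, 891),
    (256597807336150177091899590698444222408, 59, 107, 251),
    (498299029949700377136765412269101973480, 59, 816, 891),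
    (348345364056779734768899811514665189440, 61, 73, 253),
    (389700346838987197221167169081154321530, 61, 393, 1021),
    (389700346838987197221167169081154321530, 61, 649, 1021),
    (348345364056779734768899811514665189440, 62, 74, 254),
    (389700346838987197221167169081154321530, 62, 394, 1022),
    (389700346838987197221167169081154321530, 62, 650, 1022),
    (158349623142582922188624579537017649608, 63, 911, 1023),
    (2003222742979105778547084344709018045864, 64, 116, 116),
    (296400903910697224141856452473910943624, 65, 76, 79),
    (164679886523931322496771230274075949702, 65, 116, 119),
    (255370887452230810584210026441881868112, 65, 124, 127),
    (353063395882484692032111093888702461653, 65, 257, 833),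
    (353063395882484692032111093888702461653, 65, 513, 833),
    (296400903910697224141856452473910943624, 66, 76, 79),
    (164679886523931322496771230274075949702, 66, 116, 119),
    (255370887452230810584210026441881868112, 66, 124, 127),
    (353063395882484692032111093888702461653, 66, 258, 834),
    (353063395882484692032111093888702461653, 66, 514, 834),
    (21285711654899637478243180982111555868, 67, 80, 119),
    (533232220905716740110095385612651084716, 67, 96, 119),
    (9409308645084228482718692417201727244, 67, 131, 211),
    (89147338028028364180969768695246523076, 68, 132, 212),
    (235739942989128236565342343940364167280, 68, 260, 836),
    (4317661566775341449279632623298626582, 68, 388, 980),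
    (235739942989128236565342343940364167280, 68, 516, 836),
    (4317661566775341449279632623298626582, 68, 644, 980),
    (156088727580116645481652916912410298736, 69, 81, 117),
    (184766275035584032742388375732710750652, 69, 97, 117),
    (134410742188970105449492188741855264894, 69, 261, 837),
    (134410742188970105449492188741855264894, 69, 517, 837),
    (156088727580116645481652916912410298736, 70, 82, 118),
    (184766275035584032742388375732710750652, 70, 98, 118),
    (134410742188970105449492188741855264894, 70, 262, 838),
    (134410742188970105449492188741855264894, 70, 518, 838),
    (5110547477108968955762398190242349704, 71, 167, 247),
    (698009082601007718489821191714328014588, 72, 124, 124),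
    (471324061456164102693166818074165244114, 72, 264, 840),
    (7089486734701816157457424100656463188, 72, 272, 987),
    (471324061456164102693166818074165244114, 72, 520, 840),
    (7089486734701816157457424100656463188, 72, 528, 987),
    (302839962220796457231382282451797534220, 73, 116, 127),
    (8154080607287847143678886758944746216, 73, 137, 217),
    (28550787848888165145319640553286543536, 73, 265, 841),
    (28550787848888165145319640553286543536, 73, 521, 841),
    (302839962220796457231382282451797534220, 74, 116, 127),
    (8154080607287847143678886758944746216, 74, 138, 218),
    (28550787848888165145319640553286543536, 74, 266, 842),
    (28550787848888165145319640553286543536, 74, 522, 842),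
    (162893986148670099244070844582616948992, 75, 87, 127),
    (316539574951041642470106421617857795524, 75, 112, 127),
    (7057035614236869978421757190003981218, 75, 283, 895),
    (7057035614236869978421757190003981218, 75, 539, 895),
    (249132388503157255743322544277707436376, 76, 104, 124),
    (10602076668272495645844279876430461058, 77, 141, 221),
    (116463565919163054624537797983508639672, 77, 269, 845),
    (116463565919163054624537797983508639672, 77, 525, 845),
    (10602076668272495645844279876430461058, 78, 142, 222),
    (116463565919163054624537797983508639672, 78, 270, 846),
    (116463565919163054624537797983508639672, 78, 526, 846),
    (22127490379080714708501515783781698782, 80, 256, 976),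
    (3662526933121663933104045068547288334, 80, 268, 895),
    (22127490379080714708501515783781698782, 80, 512, 976),
    (3662526933121663933104045068547288334, 80, 524, 895),
    (349446161559515355239159606006786700354, 81, 88, 91),
    (162206025186736592128215591983809016198, 81, 97, 117),
    (349446161559515355239159606006786700354, 82, 88, 91),
    (162206025186736592128215591983809016198, 82, 98, 118),
    (386389307772842291023225038356938165832, 83, 96, 119),
    (334214081022235771963818229217796573420, 84, 89, 95),
    (334214081022235771963818229217796573420, 84, 90, 95),
    (194056628066034320095109136709359476748, 84, 276, 852),
    (194056628066034320095109136709359476748, 84, 532, 852),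
    (5463829624148693083323402488487104228, 85, 277, 853),
    (5463829624148693083323402488487104228, 85, 533, 853),
    (5463829624148693083323402488487104228, 86, 278, 854),
    (5463829624148693083323402488487104228, 86, 534, 854),
    (21975178052126981884579465197083236838, 87, 283, 863),
    (21975178052126981884579465197083236838, 87, 539, 863),
    (100553150269124348637359340993065179514, 88, 264, 892),
    (100553150269124348637359340993065179514, 88, 520, 892),
    (109571264592927812620550663139708040188, 89, 105, 125),
    (133936709407372824804237112048061976634, 89, 281, 857),
    (133936709407372824804237112048061976634, 89, 537, 857),
    (109571264592927812620550663139708040188, 90, 106, 126),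
    (133936709407372824804237112048061976634, 90, 282, 858),
    (133936709407372824804237112048061976634, 90, 538, 858),
    (218801200060878021855654105264894219102, 91, 279, 863),
    (218801200060878021855654105264894219102, 91, 535, 863),
    (43548320499545777794501833580630827084, 92, 284, 860),
    (43548320499545777794501833580630827084, 92, 540, 860),
    (188012717706114035993456236733961168468, 93, 285, 861),
    (188012717706114035993456236733961168468, 93, 541, 861),
    (188012717706114035993456236733961168468, 94, 286, 862),
    (188012717706114035993456236733961168468, 94, 542, 862),
    (228577420171093645239675357115006077998, 96, 288, 864),
    (228577420171093645239675357115006077998, 96, 544, 864),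
    (225350472672530903699639129913570511382, 97, 100, 103),
    (322639516619754986695347396270690260248, 97, 104, 107),
    (2518167071336446243723700049461610628, 97, 305, 1009),
    (2518167071336446243723700049461610628, 97, 561, 1009),
    (225350472672530903699639129913570511382, 98, 100, 103),
    (322639516619754986695347396270690260248, 98, 104, 107),
    (2518167071336446243723700049461610628, 98, 306, 1010),
    (2518167071336446243723700049461610628, 98, 562, 1010),
    (104418863298081840900271005539908877480, 100, 105, 111),
    (104418863298081840900271005539908877480, 100, 106, 111),
    (262193053176774637928564229466873141604, 101, 129, 245),
    (85414899483770095953239173217948981647, 101, 293, 869),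
    (85414899483770095953239173217948981647, 101, 549, 869),
    (262193053176774637928564229466873141604, 102, 130, 246),
    (85414899483770095953239173217948981647, 102, 294, 870),
    (85414899483770095953239173217948981647, 102, 550, 870),
    (161393209207732162779458921631331722894, 104, 296, 872),
    (161393209207732162779458921631331722894, 104, 552, 872),
    (330130724194829259285774476472865242822, 105, 297, 873),
    (330130724194829259285774476472865242822, 105, 553, 873),
    (330130724194829259285774476472865242822, 106, 298, 874),
    (330130724194829259285774476472865242822, 106, 554, 874),
    (81748105790652690364748036954861445416, 108, 136, 252),
    (247470437713825019760397898788426313570, 108, 300, 876),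
    (247470437713825019760397898788426313570, 108, 556, 876),
    (507389539662490842428028272949732378, 109, 301, 877),
    (507389539662490842428028272949732378, 109, 557, 877),
    (507389539662490842428028272949732378, 110, 302, 878),
    (507389539662490842428028272949732378, 110, 558, 878),
    (204632883354027327052462069029661327938, 112, 304, 880),
    (204632883354027327052462069029661327938, 112, 560, 880),
    (93654231071619150420457893569902486204, 113, 120, 123),
    (106856431223468350511381905174671310137, 113, 305, 881),
    (106856431223468350511381905174671310137, 113, 561, 881),
    (93654231071619150420457893569902486204, 114, 120, 123),
    (106856431223468350511381905174671310137, 114, 306, 882),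
    (106856431223468350511381905174671310137, 114, 562, 882),
    (401746337006551811840657767210620189162, 115, 307, 883),
    (401746337006551811840657767210620189162, 115, 563, 883),
    (490543202245279331750886826048004711926, 116, 256, 884),
    (490543202245279331750886826048004711926, 116, 512, 884),
    (10940912863837841748026751427551164706, 119, 263, 887),
    (10940912863837841748026751427551164706, 119, 519, 887),
    (83343195479048946739994449448540482574, 120, 296, 1016),
    (83343195479048946739994449448540482574, 120, 552, 1016),
    (39413929969211938954461302411546845756, 128, 356, 1012),
    (39413929969211938954461302411546845756, 128, 612, 1012),
    (153270878793927379845496984348073762960, 128, 804, 1012),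
    (289023072877185615770248278214431600508, 128, 820, 1012),
    (295327394172446616835151526386653013640, 128, 823, 1015),
    (148439790647598943393489362977576463990, 129, 132, 135),
    (113083998531726937980229384212380710902, 129, 136, 139),
    (235703925122296926816100125604217421460, 129, 140, 143),
    (240550180623300344043427566480467546224, 129, 785, 977),
    (108901830522914863147957211660332219314, 129, 964, 967),
    (148439790647598943393489362977576463990, 130, 132, 135),
    (113083998531726937980229384212380710902, 130, 136, 139),
    (235703925122296926816100125604217421460, 130, 140, 143),
    (240550180623300344043427566480467546224, 130, 786, 978),
    (108901830522914863147957211660332219314, 130, 964, 967),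
    (423168023450670357270984302149001046076, 131, 160, 183),
    (31938086566067044054316563627192715576, 131, 211, 211),
    (74942842813175374119665607582133001098, 131, 259, 979),
    (74942842813175374119665607582133001098, 131, 515, 979),
    (256565305702743177842685898254955050588, 131, 787, 979),
    (145161068331819259315006111935436090280, 131, 832, 983),
    (568839692472939614305996703431597082876, 132, 772, 980),
    (14578165381282763254905866611053912236, 132, 960, 967),
    (608329631941498001255436569006777131598, 133, 145, 181),
    (323979927697924942439085798422154219904, 133, 213, 213),
    (608329631941498001255436569006777131598, 134, 146, 182),
    (323979927697924942439085798422154219904, 134, 214, 214),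
    (419901135950082848024911593812936915792, 135, 144, 183),
    (201826390252966075274927817550296161504, 135, 155, 191),
    (303211656264247716158269732052702049980, 136, 144, 191),
    (261289922997274666767011001483784962504, 136, 188, 188),
    (272244143594163500354362375077148699328, 136, 192, 971),
    (150796432007834402109698072944133068474, 136, 197, 975),
    (150796432007834402109698072944133068474, 136, 198, 975),
    (18454666877214002809284356178878279612, 136, 256, 987),
    (18454666877214002809284356178878279612, 136, 512, 987),
    (131784361383474326445324191988567670024, 136, 776, 984),
    (107040538058779540740469023079322896150, 136, 821, 1023),
    (107040538058779540740469023079322896150, 136, 822, 1023),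
    (1110596194645046040375338106014263823958, 137, 189, 189),
    (242718910933038680570264954083922517136, 137, 813, 1021),
    (1110596194645046040375338106014263823958, 138, 190, 190),
    (242718910933038680570264954083922517136, 138, 814, 1022),
    (788343395620006772716942486067536930852, 139, 176, 191),
    (13717477149209245037796098410349585544, 139, 199, 975),
    (91848038620606451054748298849880920696, 139, 824, 1023),
    (49981678668875085385532032518523158300, 140, 268, 988),
    (49981678668875085385532032518523158300, 140, 524, 988),
    (444756270740390790801778467302571472440, 140, 840, 1020),
    (230235704748348654286099178117025906386, 141, 832, 991),
    (230235704748348654286099178117025906386, 142, 832, 991),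
    (129197027514608177136919861296738542408, 143, 152, 191),
    (10043879657835695200247466091925029200, 143, 768, 991),
    (187005874740330721980026811884335181032, 143, 815, 1023),
    (217030637242117959445367943046517348764, 144, 160, 180),
    (471004310193878755182006591339013490216, 144, 768, 976),
    (223600638123544802645272939596157602904, 145, 148, 151),
    (5001963129754450063162970311297294561, 145, 385, 977),
    (5001963129754450063162970311297294561, 145, 641, 977),
    (223600638123544802645272939596157602904, 146, 148, 151),
    (5001963129754450063162970311297294561, 146, 386, 978),
    (5001963129754450063162970311297294561, 146, 642, 978),
    (261289922997274666767011001483784962504, 147, 160, 183),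
    (235051423932876740625038472978454129508, 148, 152, 159),
    (166961890978414207358075871087107463158, 148, 153, 159),
    (166961890978414207358075871087107463158, 148, 154, 159),
    (860962483731406655763710730990021952558, 149, 773, 981),
    (860962483731406655763710730990021952558, 150, 774, 982),
    (315490352536259267918434247650594978536, 151, 779, 991),
    (1013155110472225317327356626099736446136, 152, 776, 984),
    (324135649080208103666430057139668645098, 153, 777, 985),
    (2450092269563170646514852353706598696, 153, 825, 1021),
    (324135649080208103666430057139668645098, 154, 778, 986),
    (2450092269563170646514852353706598696, 154, 826, 1022),
    (496341346930151407392049474462239092012, 156, 780, 988),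
    (77112306074057727625101769739846778382, 157, 221, 221),
    (116122107217968130263329744191595298910, 157, 797, 989),
    (77112306074057727625101769739846778382, 158, 222, 222),
    (116122107217968130263329744191595298910, 158, 798, 990),
    (60322669707529613899251690635707146084, 160, 800, 1008),
    (88797665754245098461813127413051023764, 160, 864, 1008),
    (162232448903555669724387922224100874160, 161, 164, 167),
    (283856397677244240678129038039987882316, 161, 172, 175),
    (370020672396201293550594028331039947862, 161, 801, 1009),
    (138756046215322655981151572477573249512, 161, 865, 1009),
    (77923794130773190378076716960077133454, 161, 996, 999),
    (16428713696989007600766695907811541074, 161, 1016, 1019),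
    (162232448903555669724387922224100874160, 162, 164, 167),
    (283856397677244240678129038039987882316, 162, 172, 175),
    (370020672396201293550594028331039947862, 162, 802, 1010),
    (138756046215322655981151572477573249512, 162, 866, 1010),
    (77923794130773190378076716960077133454, 162, 996, 999),
    (16428713696989007600766695907811541074, 162, 1016, 1019),
    (53359773010185589484643098565573572490, 163, 355, 1011),
    (53359773010185589484643098565573572490, 163, 611, 1011),
    (227650811676054079839884977604802877332, 163, 819, 1011),
    (582345298082430580132833907993533730716, 163, 992, 999),
    (100028118971880111492770038823030250656, 164, 168, 175),
    (165279968481594604035259441251687553780, 164, 192, 244),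
    (742450010640579484124074999827760123232, 164, 224, 999),
    (230066269561664929977821898362055747310, 164, 1001, 1007),
    (230066269561664929977821898362055747310, 164, 1002, 1007),
    (911421344926229535646698274595835326250, 165, 833, 1013),
    (911421344926229535646698274595835326250, 166, 834, 1014),
    (331741895014883034806970228494466944840, 168, 224, 1003),
    (432136529160049726962025377512401278292, 168, 808, 1016),
    (221271535919780230286644681294513169366, 168, 997, 1007),
    (221271535919780230286644681294513169366, 168, 998, 1007),
    (117122010106939566099486690936712679188, 169, 205, 253),
    (794379709969550869717769697320242418, 169, 361, 1017),
    (794379709969550869717769697320242418, 169, 617, 1017),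
    (157822664090665357259232480663168760586, 169, 996, 1007),
    (117122010106939566099486690936712679188, 170, 206, 254),
    (794379709969550869717769697320242418, 170, 362, 1018),
    (794379709969550869717769697320242418, 170, 618, 1018),
    (157822664090665357259232480663168760586, 170, 996, 1007),
    (5393118501821567992388773161183291336, 171, 208, 255),
    (516488897951503632230993802702084223024, 171, 232, 1003),
    (227506311709395919438265147408078477920, 171, 816, 1019),
    (25862955945577111807532743323537192976, 172, 960, 1023),
    (281482232735672218894931285193501540254, 173, 1000, 1007),
    (281482232735672218894931285193501540254, 174, 1000, 1007),
    (231262424635522509056781123377377851908, 177, 184, 187),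
    (113065758329856322454171577262217986402, 177, 801, 1009),
    (231262424635522509056781123377377851908, 178, 184, 187),
    (113065758329856322454171577262217986402, 178, 802, 1010),
    (328685865279390594481463350978684177648, 179, 803, 1011),
    (58679684045987700782781574529388892564, 180, 271, 1023),
    (58679684045987700782781574529388892564, 180, 527, 1023),
    (186767910149234113468808461149001217804, 180, 783, 1023),
    (114781999613312519584415788426294424646, 181, 769, 1013),
    (114781999613312519584415788426294424646, 182, 770, 1014),
    (15633807884018121453803964737990389204, 183, 775, 1015),
    (14533368858547231678057704385505467096, 183, 792, 1023),
    (89087210389868167283460978599901439248, 184, 800, 1019),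
    (160404578952088617646149821446173052386, 185, 249, 249),
    (491097540058622311024505928226776108256, 185, 809, 1017),
    (160404578952088617646149821446173052386, 186, 250, 250),
    (491097540058622311024505928226776108256, 186, 810, 1018),
    (641191757897410901707479062693461055492, 187, 811, 1019),
    (268661998320494336348302656788734500334, 189, 777, 1021),
    (268661998320494336348302656788734500334, 190, 778, 1022),
    (724197533831703786679798533026636258772, 192, 199, 199),
    (51656420072572836181701334012596404652, 192, 292, 1012),
    (23803735496002996391753849759995771830, 192, 384, 960),
    (51656420072572836181701334012596404652, 192, 548, 1012),
    (23803735496002996391753849759995771830, 192, 640, 960),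
    (91827080906918341107787675583263559356, 193, 196, 199),
    (71886604838663166054265352633896405820, 193, 200, 203),
    (100884569762651927658950450051585239936, 193, 204, 207),
    (244952190423655044467862027884369928941, 193, 293, 1013),
    (30043215957644932171956522876923137087, 193, 385, 961),
    (244952190423655044467862027884369928941, 193, 549, 1013),
    (30043215957644932171956522876923137087, 193, 641, 961),
    (91827080906918341107787675583263559356, 194, 196, 199),
    (71886604838663166054265352633896405820, 194, 200, 203),
    (100884569762651927658950450051585239936, 194, 204, 207),
    (244952190423655044467862027884369928941, 194, 294, 1014),
    (30043215957644932171956522876923137087, 194, 386, 962),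
    (244952190423655044467862027884369928941, 194, 550, 1014),
    (30043215957644932171956522876923137087, 194, 642, 962),
    (510318724984583196219333561163660385984, 196, 200, 207),
    (72128072281815451019549079674370508637, 197, 389, 965),
    (72128072281815451019549079674370508637, 197, 645, 965),
    (72128072281815451019549079674370508637, 198, 390, 966),
    (72128072281815451019549079674370508637, 198, 646, 966),
    (14116816092644347283128267142416512292, 200, 384, 971),
    (14116816092644347283128267142416512292, 200, 640, 971),
    (122200742412932327611869127706718635091, 201, 393, 969),
    (122200742412932327611869127706718635091, 201, 649, 969),
    (122200742412932327611869127706718635091, 202, 394, 970),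
    (122200742412932327611869127706718635091, 202, 650, 970),
    (115434925338208943848767186214527232904, 203, 384, 971),
    (115434925338208943848767186214527232904, 203, 640, 971),
    (372016395227368559423225498433399088476, 204, 396, 972),
    (372016395227368559423225498433399088476, 204, 652, 972),
    (102250585158705828196727806536250031647, 208, 257, 983),
    (102250585158705828196727806536250031647, 208, 258, 983),
    (102250585158705828196727806536250031647, 208, 513, 983),
    (102250585158705828196727806536250031647, 208, 514, 983),
    (1756973361130288191413547933430605092, 209, 417, 1013),
    (1756973361130288191413547933430605092, 209, 673, 1013),
    (1756973361130288191413547933430605092, 210, 418, 1014),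
    (1756973361130288191413547933430605092, 210, 674, 1014),
    (167180146133439463524357663545743690054, 215, 500, 1015),
    (167180146133439463524357663545743690054, 215, 756, 1015),
    (486972842924339821939034221238136852684, 216, 264, 984),
    (126715545212564083290924594346746219179, 216, 385, 987),
    (126715545212564083290924594346746219179, 216, 386, 987),
    (486972842924339821939034221238136852684, 216, 520, 984),
    (126715545212564083290924594346746219179, 216, 641, 987),
    (126715545212564083290924594346746219179, 216, 642, 987),
    (89516861060612956458926147914194020215, 217, 269, 1021),
    (89516861060612956458926147914194020215, 217, 525, 1021),
    (89516861060612956458926147914194020215, 218, 270, 1022),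
    (89516861060612956458926147914194020215, 218, 526, 1022),
    (25709088435482631909958696946098380668, 219, 427, 1023),
    (25709088435482631909958696946098380668, 219, 683, 1023),
    (343794094103980201431127238884095768615, 221, 269, 989),
    (343794094103980201431127238884095768615, 221, 525, 989),
    (343794094103980201431127238884095768615, 222, 270, 990),
    (343794094103980201431127238884095768615, 222, 526, 990),
    (189086317673284644579356800529390726410, 225, 228, 231),
    (505999724706802264196066183807813275334, 225, 236, 239),
    (189086317673284644579356800529390726410, 226, 228, 231),
    (505999724706802264196066183807813275334, 226, 236, 239),
    (136200128198756219061269577076388029672, 227, 291, 1011),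
    (42697808121969006358097103454736142286, 227, 419, 995),
    (136200128198756219061269577076388029672, 227, 547, 1011),
    (42697808121969006358097103454736142286, 227, 675, 995),
    (395423633386439732883815920752225593348, 228, 420, 996),
    (395423633386439732883815920752225593348, 228, 676, 996),
    (65962510260028456007453791869152234699, 229, 421, 997),
    (65962510260028456007453791869152234699, 229, 677, 997),
    (65962510260028456007453791869152234699, 230, 422, 998),
    (65962510260028456007453791869152234699, 230, 678, 998),
    (270529169361237849575503492734781586608, 232, 424, 1000),
    (270529169361237849575503492734781586608, 232, 680, 1000),
    (301961001882823723792382485329682963328, 233, 425, 1001),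
    (301961001882823723792382485329682963328, 233, 681, 1001),
    (301961001882823723792382485329682963328, 234, 426, 1002),
    (301961001882823723792382485329682963328, 234, 682, 1002),
    (40502846478022927142987733447887976092, 235, 427, 1003),
    (40502846478022927142987733447887976092, 235, 683, 1003),
    (23872028182678597265908159680008151248, 239, 427, 1007),
    (23872028182678597265908159680008151248, 239, 683, 1007),
    (79869929577327855174789237150212913122, 240, 297, 1019),
    (79869929577327855174789237150212913122, 240, 298, 1019),
    (79869929577327855174789237150212913122, 240, 553, 1019),
    (79869929577327855174789237150212913122, 240, 554, 1019),
    (175579582934697725949557345004719645208, 243, 419, 1011),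
    (175579582934697725949557345004719645208, 243, 675, 1011),
    (67607253436813417820702230703120305115, 245, 257, 1013),
    (67607253436813417820702230703120305115, 245, 513, 1013),
    (67607253436813417820702230703120305115, 246, 258, 1014),
    (67607253436813417820702230703120305115, 246, 514, 1014),
    (21855497134735641941272392767486208942, 248, 424, 1016),
    (21855497134735641941272392767486208942, 248, 680, 1016),
    (485743888613660695802645899716058631060, 252, 884, 1023),
    (929010102122311083812849121517206473274, 256, 267, 267),
    (121360708121111941491121356098008772064, 257, 268, 271),
    (147442000997787409006133561921932068557, 257, 272, 471),
    (14609477388123786051152310807331163672, 257, 308, 311),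
    (312505210430417326347690051696835289499, 257, 316, 319),
    (121360708121111941491121356098008772064, 258, 268, 271),
    (147442000997787409006133561921932068557, 258, 272, 471),
    (14609477388123786051152310807331163672, 258, 308, 311),
    (312505210430417326347690051696835289499, 258, 316, 319),
    (638550147464751553714622302657775301532, 259, 288, 311),
    (406450991329093926082017113419221052784, 259, 467, 467),
    (12312351381169368740742649437272148770, 259, 496, 503),
    (653084098668841743791468785217800580406, 260, 272, 308),
    (27890851247201100573241859636532035743, 260, 289, 311),
    (27890851247201100573241859636532035743, 260, 290, 311),
    (288332850725044359326814591988051967492, 260, 384, 500),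
    (123852151053569952091476450661083667096, 260, 465, 471),
    (123852151053569952091476450661083667096, 260, 466, 471),
    (74817892561301607065936332356126991011, 261, 384, 471),
    (94994723926392307870455014256239452755, 261, 417, 501),
    (595775264980615387367154358645482051076, 261, 472, 479),
    (74817892561301607065936332356126991011, 262, 384, 471),
    (94994723926392307870455014256239452755, 262, 418, 502),
    (595775264980615387367154358645482051076, 262, 472, 479),
    (556161098428327693781959872766464923080, 263, 400, 471),
    (585661757056695999058601571115962373660, 263, 480, 503),
    (81202920244079975381602036801747452058, 264, 272, 319),
    (203125035091400085943228898642404913618, 264, 276, 479),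
    (300118136940729352879036433611753390732, 264, 293, 319),
    (300118136940729352879036433611753390732, 264, 294, 319),
    (1744031779811034468617716961817186300, 264, 336, 475),
    (982563179933843428226156772091604185364, 265, 317, 317),
    (161986712418590871199789891576162277107, 265, 464, 475),
    (191413362117778572989791147972046242625, 265, 500, 511),
    (982563179933843428226156772091604185364, 266, 318, 318),
    (161986712418590871199789891576162277107, 266, 464, 475),
    (191413362117778572989791147972046242625, 266, 500, 511),
    (276620453627196304537961746841475733130, 267, 336, 475),
    (626231752238989044739751513012610081786, 267, 368, 511),
    (357990728586163434546141936048713023672, 267, 432, 511),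
    (364246366335448281097785559570679228710, 267, 440, 511),
    (87790570326338019192241370495083293488, 267, 448, 475),
    (770171489192653912010386215329106669278, 268, 280, 316),
    (65719221951315678345782667984206844144, 268, 424, 508),
    (123198246698268914373553396670867486626, 269, 457, 509),
    (123198246698268914373553396670867486626, 270, 458, 510),
    (155009518529872330336459915279541433508, 271, 480, 511),
    (234512246254605784515629695228376495486, 272, 291, 311),
    (267934570419480010880639721323177428716, 272, 331, 475),
    (354749067775491571373314031730378536300, 273, 276, 279),
    (385778354059538086627203671144234391692, 273, 284, 287),
    (364977630152764862484656197821197336413, 273, 385, 465),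
    (354749067775491571373314031730378536300, 274, 276, 279),
    (385778354059538086627203671144234391692, 274, 284, 287),
    (364977630152764862484656197821197336413, 274, 386, 466),
    (203225495664546963041008556709610526392, 275, 323, 467),
    (174193281998183111178007334322523308336, 275, 384, 471),
    (5459859311122912407261122299337303168, 276, 281, 287),
    (5459859311122912407261122299337303168, 276, 282, 287),
    (261289922997274666767011001483784962504, 276, 388, 468),
    (494446306483162137604996741177327522352, 277, 325, 469),
    (494446306483162137604996741177327522352, 278, 326, 470),
    (501352191372343989754265939343216723076, 280, 392, 472),
    (360892265379102794652118076258669999215, 281, 297, 317),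
    (109387652896042357259409359522762300159, 281, 393, 473),
    (360892265379102794652118076258669999215, 282, 298, 318),
    (109387652896042357259409359522762300159, 282, 394, 474),
    (535610273328162121123721829134545807156, 284, 332, 476),
    (53820388244145340713852204825343084866, 287, 327, 479),
    (327851013881392395591093918825737374686, 288, 391, 503),
    (218453149078635115747985651640390315870, 288, 452, 500),
    (225175597938223318507879884045406430849, 289, 292, 295),
    (47778312309962773557721994342094106783, 289, 300, 303),
    (357553753428984465691713896587990490277, 289, 449, 501),
    (531922245396546268052492483258552876644, 289, 497, 497),
    (225175597938223318507879884045406430849, 290, 292, 295),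
    (47778312309962773557721994342094106783, 290, 300, 303),
    (357553753428984465691713896587990490277, 290, 450, 502),
    (531922245396546268052492483258552876644, 290, 498, 498),
    (622569827625813711116678084560880529202, 291, 304, 507),
    (254944432379216728144070615920961826348, 291, 432, 507),
    (456055435040987638281579236670468929498, 292, 296, 303),
    (604659003264221927324448546754613566636, 295, 448, 503),
    (166347624271739032657375428309755818707, 296, 305, 507),
    (166347624271739032657375428309755818707, 296, 306, 507),
    (45259130044585344388774446811912233862, 296, 391, 511),
    (343832251335996583782501985785508678502, 296, 392, 508),
    (71041277173291794914353659343781168465, 297, 461, 509),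
    (71041277173291794914353659343781168465, 298, 462, 510),
    (174025667470357584605946176035643644216, 299, 304, 507),
    (85486316181428916022038020152874575474, 299, 327, 511),
    (1777939345488166139026805295266742814, 299, 399, 511),
    (722704859700877960528763019326685981538, 300, 456, 508),
    (376421273377393487457331622067984983193, 301, 457, 509),
    (376421273377393487457331622067984983193, 302, 458, 510),
    (11640425900796918862769572081023859760, 304, 387, 503),
    (3258673971739273567186881840843270844, 304, 416, 496),
    (159760982428913948532537302272419531368, 305, 312, 315),
    (159760982428913948532537302272419531368, 306, 312, 315),
    (310174668542048424476643900643200745246, 307, 355, 499),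
    (827090639557141134730172720312748779454, 308, 384, 500),
    (231252674625416570803570128961163102041, 309, 385, 501),
    (231252674625416570803570128961163102041, 310, 386, 502),
    (277520316938332971862295598699814849544, 312, 360, 504),
    (19978536256933756689445454790658340130, 312, 496, 507),
    (25360048136636983616106228433846881439, 312, 497, 507),
    (25360048136636983616106228433846881439, 312, 498, 507),
    (493547632328185481671020780580482706952, 313, 361, 505),
    (280549880750661849760013693421624296506, 313, 425, 505),
    (493547632328185481671020780580482706952, 314, 362, 506),
    (280549880750661849760013693421624296506, 314, 426, 506),
    (930155314084267252650934340369929022678, 317, 329, 509),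
    (930155314084267252650934340369929022678, 318, 330, 510),
    (1712900606315467259917072120838145865304, 320, 372, 372),
    (247427148731192543992701290494421020992, 321, 324, 327),
    (406597705892861965627165786817861959856, 321, 328, 331),
    (26828889474404623237921241101907503401, 321, 348, 383),
    (589689923728540042317511683221512387795, 321, 372, 375),
    (247427148731192543992701290494421020992, 322, 324, 327),
    (406597705892861965627165786817861959856, 322, 328, 331),
    (26828889474404623237921241101907503401, 322, 348, 383),
    (589689923728540042317511683221512387795, 322, 372, 375),
    (334502227885870162098285776821687099680, 323, 352, 375),
    (13884336110496060257728891823359516992, 323, 368, 375),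
    (296837350330444912424862136954360121634, 324, 328, 335),
    (344046918853577643908115519996865763398, 324, 336, 372),
    (117810596180776867087769383491661544745, 325, 353, 373),
    (88935338586226015242440800825246617405, 325, 417, 501),
    (117810596180776867087769383491661544745, 326, 354, 374),
    (88935338586226015242440800825246617405, 326, 418, 502),
    (94257670039536164482501354526839419140, 327, 360, 383),
    (725805341659096296575030559677180451400, 328, 372, 383),
    (156419568331597988349081766587235728771, 329, 332, 335),
    (132443380317708890073502324865338639455, 329, 372, 383),
    (156419568331597988349081766587235728771, 330, 332, 335),
    (132443380317708890073502324865338639455, 330, 372, 383),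
    (300526183614317409223406693712540031102, 331, 352, 383),
    (447960153416473474191293715309616986286, 331, 376, 383),
    (243850920584397191110618342183657150387, 333, 361, 381),
    (243850920584397191110618342183657150387, 334, 362, 382),
    (341632307625715611659115384320830665213, 337, 340, 343),
    (35786470037014462559900506711303169515, 337, 353, 373),
    (341632307625715611659115384320830665213, 338, 340, 343),
    (35786470037014462559900506711303169515, 338, 354, 374),
    (359531577888639044193230076092185204089, 341, 344, 351),
    (359531577888639044193230076092185204089, 342, 344, 351),
    (162968923073736676667238334435149194690, 345, 348, 351),
    (162968923073736676667238334435149194690, 346, 348, 351),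
    (783869768991824000301033004451354887512, 352, 359, 359),
    (146772285430448297598571414504809894431, 353, 360, 363),
    (307253749536853503443976854898050260299, 353, 364, 367),
    (2053385808547758432807510523006710186, 353, 384, 503),
    (146772285430448297598571414504809894431, 354, 360, 363),
    (307253749536853503443976854898050260299, 354, 364, 367),
    (2053385808547758432807510523006710186, 354, 384, 503),
    (338004847693518135264554588620586988972, 356, 360, 367),
    (274716404145211633927536076464200421348, 363, 399, 511),
    (548458585908228435020784593101597723239, 385, 388, 391),
    (548458585908228435020784593101597723239, 386, 388, 391),
    (789107758571474751831926595178289592738, 387, 416, 439),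
    (355988774243078789005790608782887717501, 389, 392, 399),
    (478880816549089910327132968030886396933, 389, 401, 437),
    (209826447723731373405269049550062798131, 389, 481, 501),
    (355988774243078789005790608782887717501, 390, 392, 399),
    (478880816549089910327132968030886396933, 390, 402, 438),
    (209826447723731373405269049550062798131, 390, 482, 502),
    (544443203074606850561190306469569880176, 391, 411, 447),
    (24841736895748143542012600661673812537, 393, 404, 447),
    (311932571946297085844582081801569126531, 393, 436, 447),
    (24841736895748143542012600661673812537, 394, 404, 447),
    (311932571946297085844582081801569126531, 394, 436, 447),
    (377418777662730074219015891032133834728, 395, 400, 447),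
    (329704411435124054538033252768018749204, 396, 424, 444),
    (74066213665478767999303840994285772020, 396, 476, 476),
    (430623414202905939591298422213678056123, 397, 409, 445),
    (70526428371992108729498298504645751658, 397, 464, 479),
    (430623414202905939591298422213678056123, 398, 410, 446),
    (70526428371992108729498298504645751658, 398, 464, 479),
    (139866133049080279075176925417235366676, 400, 419, 439),
    (58810323848052175580894983880567379700, 400, 427, 447),
    (96752957039721643166784364762175048479, 401, 404, 407),
    (272221601537303425280595153234784940088, 401, 408, 411),
    (73736277817317519170329907459305388538, 401, 417, 437),
    (96752957039721643166784364762175048479, 402, 404, 407),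
    (272221601537303425280595153234784940088, 402, 408, 411),
    (73736277817317519170329907459305388538, 402, 418, 438),
    (145161068331819259315006111935436090280, 403, 416, 439),
    (337454885456337463842430516894046639088, 404, 408, 415),
    (314343850591536886726906331309276482908, 405, 465, 501),
    (314343850591536886726906331309276482908, 406, 466, 502),
    (221907648225789130858989972586638393860, 408, 424, 444),
    (90708111803717272396344073922158348732, 408, 469, 479),
    (90708111803717272396344073922158348732, 408, 470, 479),
    (154211335894986805989714647253479710516, 409, 412, 415),
    (154211335894986805989714647253479710516, 410, 412, 415),
    (281825473112248493531931751303094204490, 416, 423, 423),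
    (145161068331819259315006111935436090280, 416, 451, 503),
    (147027677638027795607377842944998988994, 417, 424, 427),
    (377418777662730074219015891032133834728, 417, 428, 431),
    (147027677638027795607377842944998988994, 418, 424, 427),
    (377418777662730074219015891032133834728, 418, 428, 431),
    (634189730130274703490103778011208964960, 419, 499, 499),
    (156188426274473452513207304602431549716, 420, 424, 431),
    (59475602443807758264107707249872063827, 433, 440, 443),
    (43292889039873612769223422596520542767, 433, 464, 503),
    (59475602443807758264107707249872063827, 434, 440, 443),
    (43292889039873612769223422596520542767, 434, 464, 503),
    (20671132864467237531107954413536961717, 441, 473, 509),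
    (20671132864467237531107954413536961717, 442, 474, 510),
    (637803776891816383710118939929223724226, 448, 455, 455),
    (14968568717276104569454587486891145531, 449, 452, 455),
    (383326235470480658485818598479221952679, 449, 460, 463),
    (14968568717276104569454587486891145531, 450, 452, 455),
    (383326235470480658485818598479221952679, 450, 460, 463),
    (249475007381773498233405586589608726602, 452, 456, 463),
    (353006187178347813760260914270544928724, 481, 488, 491),
    (353006187178347813760260914270544928724, 482, 488, 491),
    (337957459420247885952481493214835970785, 484, 489, 495),
    (337957459420247885952481493214835970785, 484, 490, 495),
    (172643041019073943154873564147276073405, 489, 492, 495),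
    (172643041019073943154873564147276073405, 490, 492, 495),
    (929010102122311083812849121517206473274, 512, 523, 523),
    (121360708121111941491121356098008772064, 513, 524, 527),
    (147442000997787409006133561921932068557, 513, 528, 727),
    (14609477388123786051152310807331163672, 513, 564, 567),
    (312505210430417326347690051696835289499, 513, 572, 575),
    (121360708121111941491121356098008772064, 514, 524, 527),
    (147442000997787409006133561921932068557, 514, 528, 727),
    (14609477388123786051152310807331163672, 514, 564, 567),
    (312505210430417326347690051696835289499, 514, 572, 575),
    (638550147464751553714622302657775301532, 515, 544, 567),
    (406450991329093926082017113419221052784, 515, 723, 723),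
    (12312351381169368740742649437272148770, 515, 752, 759),
    (653084098668841743791468785217800580406, 516, 528, 564),
    (27890851247201100573241859636532035743, 516, 545, 567),
    (27890851247201100573241859636532035743, 516, 546, 567),
    (288332850725044359326814591988051967492, 516, 640, 756),
    (123852151053569952091476450661083667096, 516, 721, 727),
    (123852151053569952091476450661083667096, 516, 722, 727),
    (74817892561301607065936332356126991011, 517, 640, 727),
    (94994723926392307870455014256239452755, 517, 673, 757),
    (595775264980615387367154358645482051076, 517, 728, 735),
    (74817892561301607065936332356126991011, 518, 640, 727),
    (94994723926392307870455014256239452755, 518, 674, 758),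
    (595775264980615387367154358645482051076, 518, 728, 735),
    (556161098428327693781959872766464923080, 519, 656, 727),
    (585661757056695999058601571115962373660, 519, 736, 759),
    (81202920244079975381602036801747452058, 520, 528, 575),
    (203125035091400085943228898642404913618, 520, 532, 735),
    (300118136940729352879036433611753390732, 520, 549, 575),
    (300118136940729352879036433611753390732, 520, 550, 575),
    (1744031779811034468617716961817186300, 520, 592, 731),
    (982563179933843428226156772091604185364, 521, 573, 573),
    (161986712418590871199789891576162277107, 521, 720, 731),
    (191413362117778572989791147972046242625, 521, 756, 767),
    (982563179933843428226156772091604185364, 522, 574, 574),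
    (161986712418590871199789891576162277107, 522, 720, 731),
    (191413362117778572989791147972046242625, 522, 756, 767),
    (276620453627196304537961746841475733130, 523, 592, 731),
    (626231752238989044739751513012610081786, 523, 624, 767),
    (357990728586163434546141936048713023672, 523, 688, 767),
    (364246366335448281097785559570679228710, 523, 696, 767),
    (87790570326338019192241370495083293488, 523, 704, 731),
    (770171489192653912010386215329106669278, 524, 536, 572),
    (65719221951315678345782667984206844144, 524, 680, 764),
    (123198246698268914373553396670867486626, 525, 713, 765),
    (123198246698268914373553396670867486626, 526, 714, 766),
    (155009518529872330336459915279541433508, 527, 736, 767),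
    (234512246254605784515629695228376495486, 528, 547, 567),
    (267934570419480010880639721323177428716, 528, 587, 731),
    (354749067775491571373314031730378536300, 529, 532, 535),
    (385778354059538086627203671144234391692, 529, 540, 543),
    (364977630152764862484656197821197336413, 529, 641, 721),
    (354749067775491571373314031730378536300, 530, 532, 535),
    (385778354059538086627203671144234391692, 530, 540, 543),
    (364977630152764862484656197821197336413, 530, 642, 722),
    (203225495664546963041008556709610526392, 531, 579, 723),
    (174193281998183111178007334322523308336, 531, 640, 727),
    (5459859311122912407261122299337303168, 532, 537, 543),
    (5459859311122912407261122299337303168, 532, 538, 543),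
    (261289922997274666767011001483784962504, 532, 644, 724),
    (494446306483162137604996741177327522352, 533, 581, 725),
    (494446306483162137604996741177327522352, 534, 582, 726),
    (501352191372343989754265939343216723076, 536, 648, 728),
    (360892265379102794652118076258669999215, 537, 553, 573),
    (109387652896042357259409359522762300159, 537, 649, 729),
    (360892265379102794652118076258669999215, 538, 554, 574),
    (109387652896042357259409359522762300159, 538, 650, 730),
    (535610273328162121123721829134545807156, 540, 588, 732),
    (53820388244145340713852204825343084866, 543, 583, 735),
    (327851013881392395591093918825737374686, 544, 647, 759),
    (218453149078635115747985651640390315870, 544, 708, 756),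
    (225175597938223318507879884045406430849, 545, 548, 551),
    (47778312309962773557721994342094106783, 545, 556, 559),
    (357553753428984465691713896587990490277, 545, 705, 757),
    (531922245396546268052492483258552876644, 545, 753, 753),
    (225175597938223318507879884045406430849, 546, 548, 551),
    (47778312309962773557721994342094106783, 546, 556, 559),
    (357553753428984465691713896587990490277, 546, 706, 758),
    (531922245396546268052492483258552876644, 546, 754, 754),
    (622569827625813711116678084560880529202, 547, 560, 763),
    (254944432379216728144070615920961826348, 547, 688, 763),
    (456055435040987638281579236670468929498, 548, 552, 559),
    (604659003264221927324448546754613566636, 551, 704, 759),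
    (166347624271739032657375428309755818707, 552, 561, 763),
    (166347624271739032657375428309755818707, 552, 562, 763),
    (45259130044585344388774446811912233862, 552, 647, 767),
    (343832251335996583782501985785508678502, 552, 648, 764),
    (71041277173291794914353659343781168465, 553, 717, 765),
    (71041277173291794914353659343781168465, 554, 718, 766),
    (174025667470357584605946176035643644216, 555, 560, 763),
    (85486316181428916022038020152874575474, 555, 583, 767),
    (1777939345488166139026805295266742814, 555, 655, 767),
    (722704859700877960528763019326685981538, 556, 712, 764),
    (376421273377393487457331622067984983193, 557, 713, 765),
    (376421273377393487457331622067984983193, 558, 714, 766),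
    (11640425900796918862769572081023859760, 560, 643, 759),
    (3258673971739273567186881840843270844, 560, 672, 752),
    (159760982428913948532537302272419531368, 561, 568, 571),
    (159760982428913948532537302272419531368, 562, 568, 571),
    (310174668542048424476643900643200745246, 563, 611, 755),
    (827090639557141134730172720312748779454, 564, 640, 756),
    (231252674625416570803570128961163102041, 565, 641, 757),
    (231252674625416570803570128961163102041, 566, 642, 758),
    (277520316938332971862295598699814849544, 568, 616, 760),
    (19978536256933756689445454790658340130, 568, 752, 763),
    (25360048136636983616106228433846881439, 568, 753, 763),
    (25360048136636983616106228433846881439, 568, 754, 763),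
    (493547632328185481671020780580482706952, 569, 617, 761),
    (280549880750661849760013693421624296506, 569, 681, 761),
    (493547632328185481671020780580482706952, 570, 618, 762),
    (280549880750661849760013693421624296506, 570, 682, 762),
    (930155314084267252650934340369929022678, 573, 585, 765),
    (930155314084267252650934340369929022678, 574, 586, 766),
    (1712900606315467259917072120838145865304, 576, 628, 628),
    (247427148731192543992701290494421020992, 577, 580, 583),
    (406597705892861965627165786817861959856, 577, 584, 587),
    (26828889474404623237921241101907503401, 577, 604, 639),
    (589689923728540042317511683221512387795, 577, 628, 631),
    (247427148731192543992701290494421020992, 578, 580, 583),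
    (406597705892861965627165786817861959856, 578, 584, 587),
    (26828889474404623237921241101907503401, 578, 604, 639),
    (589689923728540042317511683221512387795, 578, 628, 631),
    (334502227885870162098285776821687099680, 579, 608, 631),
    (13884336110496060257728891823359516992, 579, 624, 631),
    (296837350330444912424862136954360121634, 580, 584, 591),
    (344046918853577643908115519996865763398, 580, 592, 628),
    (117810596180776867087769383491661544745, 581, 609, 629),
    (88935338586226015242440800825246617405, 581, 673, 757),
    (117810596180776867087769383491661544745, 582, 610, 630),
    (88935338586226015242440800825246617405, 582, 674, 758),
    (94257670039536164482501354526839419140, 583, 616, 639),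
    (725805341659096296575030559677180451400, 584, 628, 639),
    (156419568331597988349081766587235728771, 585, 588, 591),
    (132443380317708890073502324865338639455, 585, 628, 639),
    (156419568331597988349081766587235728771, 586, 588, 591),
    (132443380317708890073502324865338639455, 586, 628, 639),
    (300526183614317409223406693712540031102, 587, 608, 639),
    (447960153416473474191293715309616986286, 587, 632, 639),
    (243850920584397191110618342183657150387, 589, 617, 637),
    (243850920584397191110618342183657150387, 590, 618, 638),
    (341632307625715611659115384320830665213, 593, 596, 599),
    (35786470037014462559900506711303169515, 593, 609, 629),
    (341632307625715611659115384320830665213, 594, 596, 599),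
    (35786470037014462559900506711303169515, 594, 610, 630),
    (359531577888639044193230076092185204089, 597, 600, 607),
    (359531577888639044193230076092185204089, 598, 600, 607),
    (162968923073736676667238334435149194690, 601, 604, 607),
    (162968923073736676667238334435149194690, 602, 604, 607),
    (783869768991824000301033004451354887512, 608, 615, 615),
    (146772285430448297598571414504809894431, 609, 616, 619),
    (307253749536853503443976854898050260299, 609, 620, 623),
    (2053385808547758432807510523006710186, 609, 640, 759),
    (146772285430448297598571414504809894431, 610, 616, 619),
    (307253749536853503443976854898050260299, 610, 620, 623),
    (2053385808547758432807510523006710186, 610, 640, 759),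
    (338004847693518135264554588620586988972, 612, 616, 623),
    (274716404145211633927536076464200421348, 619, 655, 767),
    (548458585908228435020784593101597723239, 641, 644, 647),
    (548458585908228435020784593101597723239, 642, 644, 647),
    (789107758571474751831926595178289592738, 643, 672, 695),
    (355988774243078789005790608782887717501, 645, 648, 655),
    (478880816549089910327132968030886396933, 645, 657, 693),
    (209826447723731373405269049550062798131, 645, 737, 757),
    (355988774243078789005790608782887717501, 646, 648, 655),
    (478880816549089910327132968030886396933, 646, 658, 694),
    (209826447723731373405269049550062798131, 646, 738, 758),
    (544443203074606850561190306469569880176, 647, 667, 703),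
    (24841736895748143542012600661673812537, 649, 660, 703),
    (311932571946297085844582081801569126531, 649, 692, 703),
    (24841736895748143542012600661673812537, 650, 660, 703),
    (311932571946297085844582081801569126531, 650, 692, 703),
    (377418777662730074219015891032133834728, 651, 656, 703),
    (329704411435124054538033252768018749204, 652, 680, 700),
    (74066213665478767999303840994285772020, 652, 732, 732),
    (430623414202905939591298422213678056123, 653, 665, 701),
    (70526428371992108729498298504645751658, 653, 720, 735),
    (430623414202905939591298422213678056123, 654, 666, 702),
    (70526428371992108729498298504645751658, 654, 720, 735),
    (139866133049080279075176925417235366676, 656, 675, 695),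
    (58810323848052175580894983880567379700, 656, 683, 703),
    (96752957039721643166784364762175048479, 657, 660, 663),
    (272221601537303425280595153234784940088, 657, 664, 667),
    (73736277817317519170329907459305388538, 657, 673, 693),
    (96752957039721643166784364762175048479, 658, 660, 663),
    (272221601537303425280595153234784940088, 658, 664, 667),
    (73736277817317519170329907459305388538, 658, 674, 694),
    (145161068331819259315006111935436090280, 659, 672, 695),
    (337454885456337463842430516894046639088, 660, 664, 671),
    (314343850591536886726906331309276482908, 661, 721, 757),
    (314343850591536886726906331309276482908, 662, 722, 758),
    (221907648225789130858989972586638393860, 664, 680, 700),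
    (90708111803717272396344073922158348732, 664, 725, 735),
    (90708111803717272396344073922158348732, 664, 726, 735),
    (154211335894986805989714647253479710516, 665, 668, 671),
    (154211335894986805989714647253479710516, 666, 668, 671),
    (281825473112248493531931751303094204490, 672, 679, 679),
    (145161068331819259315006111935436090280, 672, 707, 759),
    (147027677638027795607377842944998988994, 673, 680, 683),
    (377418777662730074219015891032133834728, 673, 684, 687),
    (147027677638027795607377842944998988994, 674, 680, 683),
    (377418777662730074219015891032133834728, 674, 684, 687),
    (634189730130274703490103778011208964960, 675, 755, 755),
    (156188426274473452513207304602431549716, 676, 680, 687),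
    (59475602443807758264107707249872063827, 689, 696, 699),
    (43292889039873612769223422596520542767, 689, 720, 759),
    (59475602443807758264107707249872063827, 690, 696, 699),
    (43292889039873612769223422596520542767, 690, 720, 759),
    (20671132864467237531107954413536961717, 697, 729, 765),
    (20671132864467237531107954413536961717, 698, 730, 766),
    (637803776891816383710118939929223724226, 704, 711, 711),
    (14968568717276104569454587486891145531, 705, 708, 711),
    (383326235470480658485818598479221952679, 705, 716, 719),
    (14968568717276104569454587486891145531, 706, 708, 711),
    (383326235470480658485818598479221952679, 706, 716, 719),
    (249475007381773498233405586589608726602, 708, 712, 719),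
    (353006187178347813760260914270544928724, 737, 744, 747),
    (353006187178347813760260914270544928724, 738, 744, 747),
    (337957459420247885952481493214835970785, 740, 745, 751),
    (337957459420247885952481493214835970785, 740, 746, 751),
    (172643041019073943154873564147276073405, 745, 748, 751),
    (172643041019073943154873564147276073405, 746, 748, 751),
    (1338908230385797329191876974163341099956, 768, 820, 820),
    (251285996737765766640685060861190373382, 769, 772, 775),
    (212928777468409195149201970542562712008, 769, 780, 783),
    (774781452385148133589497137982328911438, 769, 821, 821),
    (251285996737765766640685060861190373382, 770, 772, 775),
    (212928777468409195149201970542562712008, 770, 780, 783),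
    (774781452385148133589497137982328911438, 770, 822, 822),
    (832602681375163480038585544504804544592, 771, 784, 823),
    (9331514949388223988449904720724779032, 771, 800, 823),
    (80264705542418093663417966321835192404, 772, 776, 783),
    (19322184415014342566132663197381459126, 772, 785, 823),
    (19322184415014342566132663197381459126, 772, 786, 823),
    (520987120139164678323572885810684629400, 775, 795, 831),
    (435483204995457777945018335806308270840, 776, 828, 828),
    (481394258254760078916312514393823922640, 777, 820, 831),
    (481394258254760078916312514393823922640, 778, 820, 831),
    (80617225499555113462875136010470307796, 779, 784, 831),
    (20922403204255731332510349974449545376, 779, 807, 831),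
    (11456486297516171513483830706544665228, 779, 808, 831),
    (474218700465683861916212972026347674512, 781, 793, 829),
    (474218700465683861916212972026347674512, 782, 794, 830),
    (125838883916804916748873448738054631154, 785, 788, 791),
    (350829908818442115813854375641999642054, 785, 792, 795),
    (125838883916804916748873448738054631154, 786, 788, 791),
    (350829908818442115813854375641999642054, 786, 792, 795),
    (663134016671511857784903313411111148172, 787, 800, 823),
    (183805437161847944447271438330199008532, 788, 792, 799),
    (135451039080469750018137552745730331350, 793, 796, 799),
    (60514519602290874372517297127881034808, 793, 809, 829),
    (135451039080469750018137552745730331350, 794, 796, 799),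
    (60514519602290874372517297127881034808, 794, 810, 830),
    (257235017766220606501765565277466126164, 801, 804, 807),
    (159677175165001185246506723128979699308, 801, 812, 815),
    (257235017766220606501765565277466126164, 802, 804, 807),
    (159677175165001185246506723128979699308, 802, 812, 815),
    (344331658765312162090769232438727780332, 805, 808, 815),
    (344331658765312162090769232438727780332, 806, 808, 815),
    (142785369521061811582133796091126457016, 817, 824, 827),
    (142785369521061811582133796091126457016, 818, 824, 827),
    (21533223055338559157329323777964933184, 839, 848, 887),
    (725681224562894621928220048842159844984, 839, 960, 983),
    (3224169087236680646674509172021273712, 840, 848, 987),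
    (376919205477838567469300893217021268608, 840, 885, 895),
    (376919205477838567469300893217021268608, 840, 886, 895),
    (174170103296462080957307341080121708420, 844, 848, 895),
    (260615365398154686642723918499352148754, 845, 857, 893),
    (260615365398154686642723918499352148754, 846, 858, 894),
    (181157749314617954500672464009856154000, 847, 855, 895),
    (161289259708619525569843977714990336164, 853, 856, 863),
    (161289259708619525569843977714990336164, 854, 856, 863),
    (449757253900779973042974692911435203788, 864, 976, 1012),
    (104377432171700192324387355440869376020, 865, 868, 871),
    (26244359520906682877680294556812234542, 865, 972, 1023),
    (49976512422072839309794223782704538542, 865, 984, 1023),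
    (104377432171700192324387355440869376020, 866, 868, 871),
    (26244359520906682877680294556812234542, 866, 972, 1023),
    (49976512422072839309794223782704538542, 866, 984, 1023),
    (28712211863108798523104802973188755500, 868, 968, 1023),
    (418299241974346455004404283703383553042, 869, 872, 879),
    (418299241974346455004404283703383553042, 870, 872, 879),
    (37799994127684600947132501210553482768, 872, 971, 1023),
    (117134427966408908926366349421892610222, 873, 1008, 1019),
    (117134427966408908926366349421892610222, 874, 1008, 1019),
    (49090998272617692933970784245172029144, 875, 960, 1023),
    (613165746517682682518390568606280066812, 876, 968, 1020),
    (331498125824956210812741922574698924350, 877, 969, 1021),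
    (331498125824956210812741922574698924350, 878, 970, 1022),
    (199459199831853072809073324917258821858, 885, 1020, 1023),
    (199459199831853072809073324917258821858, 886, 1020, 1023),
    (59828701570253340175664374690962525516, 896, 907, 907),
    (1536943050079758512289402856598834467564, 896, 948, 948),
    (670626487583623721546772938588203652580, 897, 900, 903),
    (4196574136768816102028977566657997886, 897, 948, 951),
    (670626487583623721546772938588203652580, 898, 900, 903),
    (4196574136768816102028977566657997886, 898, 948, 951),
    (62789044627259192650327548003004348028, 899, 912, 951),
    (223059465408196553563775194251685789192, 899, 928, 951),
    (149634694960002031730915593551618133620, 899, 944, 951),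
    (11456486297516171513483830706544665228, 900, 928, 948),
    (438194730974302280922491202689704601624, 901, 904, 911),
    (435657252273868403665290292608109577348, 901, 929, 949),
    (438194730974302280922491202689704601624, 902, 904, 911),
    (435657252273868403665290292608109577348, 902, 930, 950),
    (899998623657279407753037893999703759736, 903, 928, 951),
    (63835573847237961121492092144569710696, 903, 939, 959),
    (503780087088515394709394349253908843184, 904, 956, 956),
    (667740914326368592849028114903006015288, 905, 948, 959),
    (667740914326368592849028114903006015288, 906, 948, 959),
    (146925342569344895764668041852224179684, 907, 912, 959),
    (48664547879710734313688617917343895200, 908, 913, 959),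
    (48664547879710734313688617917343895200, 908, 914, 959),
    (338154109236036309317641099971620480440, 908, 920, 956),
    (153774884737832473769492850973906060186, 909, 921, 957),
    (139258777904650547837992239780362451158, 909, 937, 957),
    (153774884737832473769492850973906060186, 910, 922, 958),
    (139258777904650547837992239780362451158, 910, 938, 958),
    (1103224119321826370794046450709314286128, 912, 919, 919),
    (14516106833181925931500611193543609028, 913, 916, 919),
    (260407785878511848542180036525390917802, 913, 920, 923),
    (178251663029170502023069302327974086698, 913, 929, 949),
    (14516106833181925931500611193543609028, 914, 916, 919),
    (260407785878511848542180036525390917802, 914, 920, 923),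
    (178251663029170502023069302327974086698, 914, 930, 950),
    (323866530903675396298188116828908418522, 917, 920, 927),
    (323866530903675396298188116828908418522, 918, 920, 927),
    (257570552918092673108338564087950086918, 921, 924, 927),
    (86101356303703249741775011441941761628, 921, 937, 957),
    (257570552918092673108338564087950086918, 922, 924, 927),
    (86101356303703249741775011441941761628, 922, 938, 958),
    (249659389421347869533255213975438990768, 929, 936, 939),
    (249659389421347869533255213975438990768, 930, 936, 939),
    (426017288088718218125991816538403390692, 932, 936, 943),
    (116302901943866033172276846350150178732, 933, 936, 943),
    (116302901943866033172276846350150178732, 934, 936, 943),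
    (169460323544813331268494074688570868262, 937, 940, 943),
    (169460323544813331268494074688570868262, 938, 940, 943),
    (30027498361752157710229878106407110596, 945, 952, 955),
    (30027498361752157710229878106407110596, 946, 952, 955),
    (495569636910747642288931381560154545014, 961, 972, 975),
    (495569636910747642288931381560154545014, 962, 972, 975),
    (25862955945577111807532743323537192976, 968, 980, 991),
    (483396998962510178647284709567175595874, 981, 984, 991),
    (483396998962510178647284709567175595874, 982, 984, 991),
    (51659405216231100392147905316311595344, 993, 1008, 1019),
    (51659405216231100392147905316311595344, 994, 1008, 1019)]
    (by decide +kernel) (by decide) [a, b, c, d, e, f, g, h, i, j] rfl (by simp) hnd ?_ ?_ hS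
  · simp [decodeSet, h1, h2, h3, h4, h5]
  · simp [decodeSet]

theorem exists_eq_insert_pair {A : Finset ℕ} (hA : A.card = 3) {a : ℕ} (ha : a ∈ A) :
    ∃ b c, a ≠ b ∧ a ≠ c ∧ b ≠ c ∧ A = {a, b, c} := by
  obtain ⟨x, y, z, hxy, hxz, hyz, rfl⟩ := Finset.card_eq_three.mp hA
  simp only [Finset.mem_insert, Finset.mem_singleton] at ha
  rcases ha with rfl | rfl | rfl
  · exact ⟨y, z, hxy, hxz, hyz, rfl⟩
  · exact ⟨x, z, hxy.symm, hyz, hxz, by grind⟩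
  · exact ⟨x, y, hxz.symm, hyz.symm, hxy, by grind⟩

theorem exists_eq_insert_of_mem {A : Finset ℕ} (hA : A.card = 3) {a b : ℕ} (ha : a ∈ A)
    (hb : b ∈ A) (hab : a ≠ b) : ∃ c, a ≠ c ∧ b ≠ c ∧ A = {a, b, c} := by
  obtain ⟨x, y, hx, hy, hxy, rfl⟩ := exists_eq_insert_pair hA ha
  simp only [Finset.mem_insert, Finset.mem_singleton] at hb
  rcases hb with rfl | rfl | rfl
  · exact absurd rfl hab
  · exact ⟨y, hy, hxy, rfl⟩
  · exact ⟨x, hx, hxy.symm, by grind⟩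

theorem eq_of_mem_of_mem_of_common {S : Finset (Finset ℕ)} (h3 : ∀ A ∈ S, A.card = 3)
    (hS : NonFC (gen S)) {A B C : Finset ℕ} (hA : A ∈ S) (hB : B ∈ S) (hC : C ∈ S) {a b : ℕ}
    (hab : a ≠ b) (haA : a ∈ A) (hbA : b ∈ A) (haB : a ∈ B) (hbB : b ∈ B) (hAB : A ≠ B)
    (haC : a ∈ C) : C = A ∨ C = B := by
  by_contra! hne
  obtain ⟨hCA, hCB⟩ := hne
  obtain ⟨c, hac, hbc, rfl⟩ := exists_eq_insert_of_mem (h3 A hA) haA hbA hab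
  obtain ⟨d, had, hbd, rfl⟩ := exists_eq_insert_of_mem (h3 B hB) haB hbB hab
  have hcd : c ≠ d := by grind
  by_cases hbC : b ∈ C
  · obtain ⟨e, hae, hbe, rfl⟩ := exists_eq_insert_of_mem (h3 C hC) haC hbC hab
    exact not_bookThreePages hS (by simp; grind) hA hB hC
  by_cases hcC : c ∈ C
  · obtain ⟨e, hae, hce, rfl⟩ := exists_eq_insert_of_mem (h3 C hC) haC hcC hac
    by_cases hde : d = e
    · subst hde
      exact not_threeEdgesInFour hS (by simp; grind) hA hB hC
    · exact not_bookChain hS (by simp; grind) hA hB hC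
  by_cases hdC : d ∈ C
  · obtain ⟨e, hae, hde, rfl⟩ := exists_eq_insert_of_mem (h3 C hC) haC hdC had
    exact not_bookChain hS (by simp; grind) hB hA hC
  · obtain ⟨e, f, hae, haf, hef, rfl⟩ := exists_eq_insert_pair (h3 C hC) haC
    exact not_bookWithPendant hS (by simp; grind) hA hB hC

theorem eq_or_eq_of_mem {S : Finset (Finset ℕ)} (h3 : ∀ A ∈ S, A.card = 3)
    (hS : NonFC (gen S)) {A B C : Finset ℕ} (hA : A ∈ S) (hB : B ∈ S) (hC : C ∈ S) {a : ℕ}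
    (haA : a ∈ A) (haB : a ∈ B) (haC : a ∈ C) (hAB : A ≠ B) : C = A ∨ C = B := by
  by_contra! hne
  have disj : ∀ {A B C : Finset ℕ}, A ∈ S → B ∈ S → C ∈ S → a ∈ A → a ∈ B → a ∈ C → A ≠ B →
      C ≠ A → C ≠ B → ∀ x ∈ A, x ∈ B → x = a := by
    intro A B C hA hB hC haA haB haC hAB hCA hCB x hxA hxB
    by_contra hxa
    exact (eq_of_mem_of_mem_of_common h3 hS hA hB hC (Ne.symm hxa) haA hxA haB hxB hAB haC).elim
      hCA hCB
  have d1 := disj hA hB hC haA haB haC hAB hne.1 hne.2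
  have d2 := disj hA hC hB haA haC haB hne.1.symm hAB.symm hne.2.symm
  have d3 := disj hB hC hA haB haC haA hne.2.symm hAB hne.1.symm
  obtain ⟨b, c, hab, hac, hbc, rfl⟩ := exists_eq_insert_pair (h3 A hA) haA
  obtain ⟨d, e, had, hae, hde, rfl⟩ := exists_eq_insert_pair (h3 B hB) haB
  obtain ⟨f, g, haf, hag, hfg, rfl⟩ := exists_eq_insert_pair (h3 C hC) haC
  simp only [Finset.mem_insert, Finset.mem_singleton, forall_eq_or_imp, forall_eq] at d1 d2 d3
  exact not_sunflower hS (by simp; grind) hA hB hC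

theorem false_of_triangle {S : Finset (Finset ℕ)} (h3 : ∀ A ∈ S, A.card = 3)
    (hS : NonFC (gen S)) {A X Y : Finset ℕ} (hA : A ∈ S) (hX : X ∈ S) (hY : Y ∈ S) {a b x : ℕ}
    (haA : a ∈ A) (hbA : b ∈ A) (hab : a ≠ b) (haX : a ∈ X) (hbY : b ∈ Y)
    (hAX : ∀ v ∈ A, v ∈ X → v = a) (hAY : ∀ v ∈ A, v ∈ Y → v = b) (hxX : x ∈ X) (hxY : x ∈ Y) :
    False := by
  have hax : a ≠ x := by grind
  have hbx : b ≠ x := by grind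
  obtain ⟨c, hac, hbc, rfl⟩ := exists_eq_insert_of_mem (h3 A hA) haA hbA hab
  obtain ⟨e, hae, hxe, rfl⟩ := exists_eq_insert_of_mem (h3 X hX) haX hxX hax
  obtain ⟨f, hbf, hxf, rfl⟩ := exists_eq_insert_of_mem (h3 Y hY) hbY hxY hbx
  simp only [Finset.mem_insert, Finset.mem_singleton, forall_eq_or_imp, forall_eq] at hAX hAY
  by_cases hef : e = f
  · subst hef
    exact not_twoChords hS (by simp; grind) hA hX hY
  · exact not_triangle hS (by simp; grind) hA hX hY

theorem false_of_matchedStar {S : Finset (Finset ℕ)} (h3 : ∀ A ∈ S, A.card = 3)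
    (hS : NonFC (gen S)) {X Y Z : Finset ℕ} {a b c : ℕ} (hab : a ≠ b) (hac : a ≠ c) (hbc : b ≠ c)
    (hA : {a, b, c} ∈ S) (hX : X ∈ S) (hY : Y ∈ S) (hZ : Z ∈ S) (haX : a ∈ X) (hbY : b ∈ Y)
    (hcZ : c ∈ Z) (hXA : X ≠ {a, b, c}) (hYA : Y ≠ {a, b, c}) (hZA : Z ≠ {a, b, c})
    (hXY : X ≠ Y) (hXZ : X ≠ Z) (hYZ : Y ≠ Z) : False := by
  have key : ∀ {v : ℕ} {P Q : Finset ℕ}, v ∈ ({a, b, c} : Finset ℕ) → P ∈ S → Q ∈ S → v ∈ P →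
      P ≠ {a, b, c} → Q ≠ {a, b, c} → P ≠ Q → v ∉ Q := by
    intro v P Q hv hP hQ hvP hPA hQA hPQ hvQ
    exact (eq_or_eq_of_mem h3 hS hA hP hQ hv hvP hvQ hPA.symm).elim hQA hPQ.symm
  have haA : a ∈ ({a, b, c} : Finset ℕ) := by simp
  have hbA : b ∈ ({a, b, c} : Finset ℕ) := by simp
  have hcA : c ∈ ({a, b, c} : Finset ℕ) := by simp
  have haY := key haA hX hY haX hXA hYA hXY
  have haZ := key haA hX hZ haX hXA hZA hXZ
  have hbX := key hbA hY hX hbY hYA hXA hXY.symm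
  have hbZ := key hbA hY hZ hbY hYA hZA hYZ
  have hcX := key hcA hZ hX hcZ hZA hXA hXZ.symm
  have hcY := key hcA hZ hY hcZ hZA hYA hYZ.symm
  have mX : ∀ v ∈ ({a, b, c} : Finset ℕ), v ∈ X → v = a := by
    intro v hv; simp only [Finset.mem_insert, Finset.mem_singleton] at hv; grind
  have mY : ∀ v ∈ ({a, b, c} : Finset ℕ), v ∈ Y → v = b := by
    intro v hv; simp only [Finset.mem_insert, Finset.mem_singleton] at hv; grind
  have mZ : ∀ v ∈ ({a, b, c} : Finset ℕ), v ∈ Z → v = c := by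
    intro v hv; simp only [Finset.mem_insert, Finset.mem_singleton] at hv; grind
  have dXY : ∀ x ∈ X, x ∉ Y := fun x h h' =>
    false_of_triangle h3 hS hA hX hY haA hbA hab haX hbY mX mY h h'
  have dXZ : ∀ x ∈ X, x ∉ Z := fun x h h' =>
    false_of_triangle h3 hS hA hX hZ haA hcA hac haX hcZ mX mZ h h'
  have dYZ : ∀ x ∈ Y, x ∉ Z := fun x h h' =>
    false_of_triangle h3 hS hA hY hZ hbA hcA hbc hbY hcZ mY mZ h h'
  obtain ⟨d, e, had, hae, hde, rfl⟩ := exists_eq_insert_pair (h3 X hX) haX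
  obtain ⟨f, g, hbf, hbg, hfg, rfl⟩ := exists_eq_insert_pair (h3 Y hY) hbY
  obtain ⟨h, i, hch, hci, hhi, rfl⟩ := exists_eq_insert_pair (h3 Z hZ) hcZ
  simp only [Finset.mem_insert, Finset.mem_singleton, forall_eq_or_imp, forall_eq, not_or] at *
  exact not_matchedStar hS (by simp; grind) hA hX hY hZ

/-- The vertices of `A` that lie in no other member of `S`. -/
def privateVertices (S : Finset (Finset ℕ)) (A : Finset ℕ) : Finset ℕ :=
  A.filter fun v => ∀ B ∈ S, v ∈ B → B = A

theorem mem_privateVertices {S : Finset (Finset ℕ)} {A : Finset ℕ} {v : ℕ} :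
    v ∈ privateVertices S A ↔ v ∈ A ∧ ∀ B ∈ S, v ∈ B → B = A :=
  Finset.mem_filter

/-- An edge `A` is linked to another edge `K` if they meet, or if they are joined through an
intermediate edge that has a private vertex. -/
def Linked (S : Finset (Finset ℕ)) (A K : Finset ℕ) : Prop :=
  A ≠ K ∧ ((∃ c, c ∈ A ∧ c ∈ K) ∨ ∃ C ∈ S, A ≠ C ∧ C ≠ K ∧ (privateVertices S C).Nonempty ∧
    ∃ c e, c ≠ e ∧ c ∈ A ∧ c ∈ C ∧ e ∈ C ∧ e ∈ K)

theorem false_of_long_book_path {S : Finset (Finset ℕ)} (h3 : ∀ A ∈ S, A.card = 3)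
    (hS : NonFC (gen S)) {a b c d e f g h : ℕ} (hnd : [a, b, c, d, e, f, g, h].Nodup)
    (hA : {a, b, c} ∈ S) (hB : {a, b, d} ∈ S) (hC : {c, e, f} ∈ S) (hG : {e, g, h} ∈ S)
    (hd : ∀ D ∈ S, d ∈ D → D = {a, b, d}) (hf : ∀ D ∈ S, f ∈ D → D = {c, e, f})
    {H : Finset ℕ} (hH : H ∈ S) (hgH : g ∈ H) (hGH : H ≠ {e, g, h}) : False := by
  simp only [List.nodup_cons, List.mem_cons, List.not_mem_nil, or_false, not_or, List.nodup_nil,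
    not_false_eq_true, and_true] at hnd
  have hHA : H ≠ {a, b, c} := by rintro rfl; simp at hgH; grind
  have hHB : H ≠ {a, b, d} := by rintro rfl; simp at hgH; grind
  have hHC : H ≠ {c, e, f} := by rintro rfl; simp at hgH; grind
  have hAB : ({a, b, c} : Finset ℕ) ≠ {a, b, d} := by
    intro heq; have : c ∈ ({a, b, d} : Finset ℕ) := heq ▸ by simp
    simp at this; grind
  have hAC : ({a, b, c} : Finset ℕ) ≠ {c, e, f} := by
    intro heq; have : a ∈ ({c, e, f} : Finset ℕ) := heq ▸ by simp
    simp at this; grind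
  have hCG : ({c, e, f} : Finset ℕ) ≠ {e, g, h} := by
    intro heq; have : c ∈ ({e, g, h} : Finset ℕ) := heq ▸ by simp
    simp at this; grind
  have haH : a ∉ H := fun h =>
    (eq_or_eq_of_mem h3 hS hA hB hH (by simp) (by simp) h hAB).elim hHA hHB
  have hbH : b ∉ H := fun h =>
    (eq_or_eq_of_mem h3 hS hA hB hH (by simp) (by simp) h hAB).elim hHA hHB
  have hcH : c ∉ H := fun h =>
    (eq_or_eq_of_mem h3 hS hA hC hH (by simp) (by simp) h hAC).elim hHA hHC
  have heH : e ∉ H := fun h =>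
    (eq_or_eq_of_mem h3 hS hC hG hH (by simp) (by simp) h hCG).elim hHC hGH
  have hdH : d ∉ H := fun h => hHB (hd H hH h)
  have hfH : f ∉ H := fun h => hHC (hf H hH h)
  by_cases hhH : h ∈ H
  · obtain ⟨i, hgi, hhi, rfl⟩ := exists_eq_insert_of_mem (h3 H hH) hgH hhH (by grind)
    simp only [Finset.mem_insert, Finset.mem_singleton, not_or] at *
    exact not_bookPathOverlap hS (by simp; grind) hA hB hC hG hH
  · obtain ⟨i, j, hgi, hgj, hij, rfl⟩ := exists_eq_insert_pair (h3 H hH) hgH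
    simp only [Finset.mem_insert, Finset.mem_singleton, not_or] at *
    exact not_bookPath hS (by simp; grind) hA hB hC hG hH

theorem exists_linked_of_shared_tail {S : Finset (Finset ℕ)} (h3 : ∀ A ∈ S, A.card = 3)
    (hS : NonFC (gen S)) {a b c d e f : ℕ} (hnd : [a, b, c, d, e, f].Nodup)
    (hA : {a, b, c} ∈ S) (hB : {a, b, d} ∈ S) (hC : {c, e, f} ∈ S)
    (hd : ∀ D ∈ S, d ∈ D → D = {a, b, d}) {G : Finset ℕ} (hG : G ∈ S) (heG : e ∈ G)
    (hGC : G ≠ {c, e, f}) :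
    ∃ K ∈ S, 2 ≤ (privateVertices S K).card ∧ Linked S {a, b, c} K := by
  have hnd' := hnd
  simp only [List.nodup_cons, List.mem_cons, List.not_mem_nil, or_false, not_or, List.nodup_nil,
    not_false_eq_true, and_true] at hnd'
  have hGA : G ≠ {a, b, c} := by rintro rfl; simp at heG; grind
  have hGB : G ≠ {a, b, d} := by rintro rfl; simp at heG; grind
  have hAB : ({a, b, c} : Finset ℕ) ≠ {a, b, d} := by
    intro heq; have : c ∈ ({a, b, d} : Finset ℕ) := heq ▸ by simp
    simp at this; grind
  have hAC : ({a, b, c} : Finset ℕ) ≠ {c, e, f} := by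
    intro heq; have : a ∈ ({c, e, f} : Finset ℕ) := heq ▸ by simp
    simp at this; grind
  have haG : a ∉ G := fun h =>
    (eq_or_eq_of_mem h3 hS hA hB hG (by simp) (by simp) h hAB).elim hGA hGB
  have hbG : b ∉ G := fun h =>
    (eq_or_eq_of_mem h3 hS hA hB hG (by simp) (by simp) h hAB).elim hGA hGB
  have hcG : c ∉ G := fun h =>
    (eq_or_eq_of_mem h3 hS hA hC hG (by simp) (by simp) h hAC).elim hGA hGC
  have hdG : d ∉ G := fun h => hGB (hd G hG h)
  by_cases hfG : f ∈ G
  · obtain ⟨g, heg, hfg, rfl⟩ := exists_eq_insert_of_mem (h3 G hG) heG hfG (by grind)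
    simp only [Finset.mem_insert, Finset.mem_singleton, not_or] at haG hbG hcG hdG
    exact (not_bookTailOverlap hS (by simp; grind) hA hB hC hG).elim
  have hf : ∀ D ∈ S, f ∈ D → D = {c, e, f} := by
    intro D hD hfD
    by_contra hDC
    refine false_of_matchedStar h3 hS (by grind) (by grind) (by grind) hC hA hG hD (by simp) heG
      hfD hAC hGC hDC hGA.symm ?_ ?_
    · rintro rfl; simp at hfD; grind
    · rintro rfl; exact hfG hfD
  obtain ⟨g, h, heg, heh, hgh, rfl⟩ := exists_eq_insert_pair (h3 G hG) heG
  simp only [Finset.mem_insert, Finset.mem_singleton, not_or] at haG hbG hcG hdG hfG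
  refine ⟨_, hG, ?_, hGA.symm, Or.inr ⟨_, hC, hAC, hGC.symm,
    ⟨f, mem_privateVertices.mpr ⟨by simp, hf⟩⟩, c, e, by grind, by simp, by simp, by simp, by simp⟩⟩
  have hgp : g ∈ privateVertices S {e, g, h} := by
    refine mem_privateVertices.mpr ⟨by simp, fun H hH hgH => ?_⟩
    by_contra hne
    exact false_of_long_book_path h3 hS (by simp; grind) hA hB hC hG hd hf hH hgH hne
  have hhp : h ∈ privateVertices S {e, g, h} := by
    refine mem_privateVertices.mpr ⟨by simp, fun H hH hhH => ?_⟩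
    by_contra hne
    rw [Finset.pair_comm] at hG hne
    exact false_of_long_book_path h3 hS (by simp; grind) hA hB hC hG hd hf hH hhH hne
  exact Finset.one_lt_card.mpr ⟨g, hgp, h, hhp, hgh⟩

theorem exists_linked {S : Finset (Finset ℕ)} (h3 : ∀ A ∈ S, A.card = 3) (hS : NonFC (gen S))
    {A : Finset ℕ} (hA : A ∈ S) (hp : privateVertices S A = ∅) :
    ∃ K ∈ S, 2 ≤ (privateVertices S K).card ∧ Linked S A K := by
  have shared : ∀ v ∈ A, ∃ X ∈ S, v ∈ X ∧ X ≠ A := by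
    intro v hv
    by_contra! hno
    have : v ∈ privateVertices S A := mem_privateVertices.mpr ⟨hv, hno⟩
    simp [hp] at this
  obtain ⟨a, b, B, hab, haA, hbA, hB, haB, hbB, hBA⟩ : ∃ a b B, a ≠ b ∧ a ∈ A ∧ b ∈ A ∧ B ∈ S ∧
      a ∈ B ∧ b ∈ B ∧ B ≠ A := by
    obtain ⟨a, b, c, hab, hac, hbc, rfl⟩ := Finset.card_eq_three.mp (h3 A hA)
    obtain ⟨X, hX, haX, hXA⟩ := shared a (by simp)
    obtain ⟨Y, hY, hbY, hYA⟩ := shared b (by simp)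
    obtain ⟨Z, hZ, hcZ, hZA⟩ := shared c (by simp)
    by_cases hXY : X = Y
    · exact ⟨a, b, X, hab, by simp, by simp, hX, haX, hXY ▸ hbY, hXA⟩
    by_cases hXZ : X = Z
    · exact ⟨a, c, X, hac, by simp, by simp, hX, haX, hXZ ▸ hcZ, hXA⟩
    by_cases hYZ : Y = Z
    · exact ⟨b, c, Y, hbc, by simp, by simp, hY, hbY, hYZ ▸ hcZ, hYA⟩
    exact (false_of_matchedStar h3 hS hab hac hbc hA hX hY hZ haX hbY hcZ hXA hYA hZA hXY hXZ
      hYZ).elim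
  obtain ⟨c, hac, hbc, rfl⟩ := exists_eq_insert_of_mem (h3 A hA) haA hbA hab
  obtain ⟨d, had, hbd, rfl⟩ := exists_eq_insert_of_mem (h3 B hB) haB hbB hab
  have hcd : c ≠ d := by rintro rfl; exact hBA rfl
  obtain ⟨C, hC, hcC, hCA⟩ := shared c (by simp)
  have hCB : C ≠ {a, b, d} := by rintro rfl; simp at hcC; grind
  have haC : a ∉ C := fun h =>
    (eq_or_eq_of_mem h3 hS hA hB hC (by simp) (by simp) h hBA.symm).elim hCA hCB
  have hbC : b ∉ C := fun h =>
    (eq_or_eq_of_mem h3 hS hA hB hC (by simp) (by simp) h hBA.symm).elim hCA hCB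
  by_cases hdC : d ∈ C
  · obtain ⟨e, hce, hde, rfl⟩ := exists_eq_insert_of_mem (h3 C hC) hcC hdC hcd
    simp only [Finset.mem_insert, Finset.mem_singleton, not_or] at haC hbC
    exact (not_bookCapped hS (by simp; grind) hA hB hC).elim
  obtain ⟨e, f, hce, hcf, hef, rfl⟩ := exists_eq_insert_pair (h3 C hC) hcC
  simp only [Finset.mem_insert, Finset.mem_singleton, not_or] at haC hbC hdC
  have hC' : {c, f, e} ∈ S := Finset.pair_comm e f ▸ hC
  have hd : ∀ D ∈ S, d ∈ D → D = {a, b, d} := by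
    intro D hD hdD
    by_contra hDB
    have hDA : D ≠ {a, b, c} := by rintro rfl; simp at hdD; grind
    have hDC : D ≠ {c, e, f} := by rintro rfl; simp at hdD; grind
    have haD : a ∉ D := fun h =>
      (eq_or_eq_of_mem h3 hS hA hB hD (by simp) (by simp) h hBA.symm).elim hDA hDB
    have hbD : b ∉ D := fun h =>
      (eq_or_eq_of_mem h3 hS hA hB hD (by simp) (by simp) h hBA.symm).elim hDA hDB
    have hcD : c ∉ D := fun h =>
      (eq_or_eq_of_mem h3 hS hA hC hD (by simp) (by simp) h hCA.symm).elim hDA hDC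
    by_cases heD : e ∈ D
    · obtain ⟨g, hdg, heg, rfl⟩ := exists_eq_insert_of_mem (h3 D hD) hdD heD (by grind)
      simp only [Finset.mem_insert, Finset.mem_singleton, not_or] at haD hbD hcD
      by_cases hfg : f = g
      · subst hfg
        exact not_bookPair hS (by simp; grind) hA hB hC hD
      · exact not_bookTriangle hS (by simp; grind) hA hB hC hD
    by_cases hfD : f ∈ D
    · obtain ⟨g, hdg, hfg, rfl⟩ := exists_eq_insert_of_mem (h3 D hD) hdD hfD (by grind)
      simp only [Finset.mem_insert, Finset.mem_singleton, not_or] at haD hbD hcD heD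
      exact not_bookTriangle hS (by simp; grind) hA hB hC' hD
    · obtain ⟨g, h, hdg, hdh, hgh, rfl⟩ := exists_eq_insert_pair (h3 D hD) hdD
      simp only [Finset.mem_insert, Finset.mem_singleton, not_or] at haD hbD hcD heD hfD
      exact not_bookTwoTails hS (by simp; grind) hA hB hC hD
  by_cases he : ∀ G ∈ S, e ∈ G → G = {c, e, f}
  · by_cases hf : ∀ G ∈ S, f ∈ G → G = {c, e, f}
    · exact ⟨_, hC, Finset.one_lt_card.mpr ⟨e, mem_privateVertices.mpr ⟨by simp, he⟩,
        f, mem_privateVertices.mpr ⟨by simp, hf⟩, hef⟩, hCA.symm, Or.inl ⟨c, by simp, by simp⟩⟩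
    · push Not at hf
      obtain ⟨G, hG, hfG, hGC⟩ := hf
      rw [Finset.pair_comm] at hGC
      exact exists_linked_of_shared_tail h3 hS (by simp; grind) hA hB hC' hd hG hfG hGC
  · push Not at he
    obtain ⟨G, hG, heG, hGC⟩ := he
    exact exists_linked_of_shared_tail h3 hS (by simp; grind) hA hB hC hd hG heG hGC

theorem linked_subsingleton {S : Finset (Finset ℕ)} (h3 : ∀ A ∈ S, A.card = 3)
    (hS : NonFC (gen S)) {A A' K : Finset ℕ} (hA : A ∈ S) (hA' : A' ∈ S) (hK : K ∈ S)
    (hpA : privateVertices S A = ∅) (hpA' : privateVertices S A' = ∅)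
    (hpK : 2 ≤ (privateVertices S K).card) (h : Linked S A K) (h' : Linked S A' K) : A = A' := by
  have unique : ∀ {u v : ℕ} {X Y : Finset ℕ}, u ∈ K → v ∈ K → X ∈ S → Y ∈ S → X ≠ K → Y ≠ K →
      u ∈ X → v ∈ Y → u = v := by
    intro u v X Y hu hv hX hY hXK hYK huX hvY
    by_contra huv
    have hsub : privateVertices S K ⊆ K \ {u, v} := by
      intro w hw
      obtain ⟨hwK, hw⟩ := mem_privateVertices.mp hw
      simp only [Finset.mem_sdiff, Finset.mem_insert, Finset.mem_singleton, not_or]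
      refine ⟨hwK, ?_, ?_⟩
      · rintro rfl; exact hXK (hw X hX huX)
      · rintro rfl; exact hYK (hw Y hY hvY)
    have h1 := Finset.card_le_card hsub
    rw [Finset.card_sdiff_of_subset (by grind), Finset.card_pair huv, h3 K hK] at h1
    omega
  have other : ∀ {u : ℕ} {X Y Z : Finset ℕ}, X ∈ S → Y ∈ S → Z ∈ S → u ∈ X → u ∈ Y → u ∈ Z →
      X ≠ Z → Y ≠ Z → X = Y := by
    intro u X Y Z hX hY hZ huX huY huZ hXZ hYZ
    by_contra hXY
    exact (eq_or_eq_of_mem h3 hS hX hY hZ huX huY huZ hXY).elim hXZ.symm hYZ.symm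
  obtain ⟨hAK, ⟨u, huA, huK⟩ | ⟨C, hC, hAC, hCK, ⟨p, hp⟩, c, e, hce, hcA, hcC, heC, heK⟩⟩ := h <;>
  obtain ⟨hAK', ⟨u', huA', huK'⟩ |
    ⟨C', hC', hAC', hCK', ⟨p', hp'⟩, c', e', hce', hcA', hcC', heC', heK'⟩⟩ := h'
  · obtain rfl := unique huK huK' hA hA' hAK hAK' huA huA'
    exact other hA hA' hK huA huA' huK hAK hAK'
  · obtain rfl := unique huK heK' hA hC' hAK hCK' huA heC'
    obtain rfl := other hA hC' hK huA heC' huK hAK hCK'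
    simp [hpA] at hp'
  · obtain rfl := unique heK huK' hC hA' hCK hAK' heC huA'
    obtain rfl := other hC hA' hK heC huA' huK' hCK hAK'
    simp [hpA'] at hp
  · obtain rfl := unique heK heK' hC hC' hCK hCK' heC heC'
    obtain rfl := other hC hC' hK heC heC' heK hCK hCK'
    obtain ⟨hpC, hp⟩ := mem_privateVertices.mp hp
    have hcc : c = c' := by
      by_contra hcc
      have hsub : ({c, c', e, p} : Finset ℕ) ⊆ C := by
        intro x hx
        simp only [Finset.mem_insert, Finset.mem_singleton] at hx
        rcases hx with rfl | rfl | rfl | rfl <;> assumption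
      have h1 : p ≠ c := by rintro rfl; exact hAC (hp A hA hcA)
      have h2 : p ≠ c' := by rintro rfl; exact hAC' (hp A' hA' hcA')
      have h4 : p ≠ e := by rintro rfl; exact hCK (hp K hK heK).symm
      have := Finset.card_le_card hsub
      simp [h3 C hC, hcc, hce, hce', h1.symm, h2.symm, h4.symm] at this
    subst hcc
    exact other hA hA' hC hcA hcA' hcC hAC hAC'

theorem card_filter_mem_le_two {S : Finset (Finset ℕ)} (h3 : ∀ A ∈ S, A.card = 3)
    (hS : NonFC (gen S)) (v : ℕ) : (S.filter (v ∈ ·)).card ≤ 2 := by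
  by_contra! h
  obtain ⟨A, hA, B, hB, C, hC, hAB, hAC, hBC⟩ := Finset.two_lt_card.mp h
  simp only [Finset.mem_filter] at hA hB hC
  exact (eq_or_eq_of_mem h3 hS hA.1 hB.1 hC.1 hA.2 hB.2 hC.2 hAB).elim hAC.symm hBC.symm

theorem sum_card_add_card_privateVertices_le {S : Finset (Finset ℕ)} (h3 : ∀ A ∈ S, A.card = 3)
    (hS : NonFC (gen S)) :
    ∑ A ∈ S, (A.card + (privateVertices S A).card) ≤ 2 * (famU S).card := by
  have hsum : ∀ A ∈ S, A.card + (privateVertices S A).card = ∑ v ∈ famU S,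
      ((if v ∈ A then 1 else 0) + if v ∈ privateVertices S A then 1 else 0) := by
    intro A hA
    have hAU := subset_famU hA
    have hpU : privateVertices S A ⊆ famU S := (Finset.filter_subset _ _).trans hAU
    rw [Finset.sum_add_distrib, Finset.sum_ite_mem, Finset.sum_ite_mem,
      Finset.inter_eq_right.mpr hAU, Finset.inter_eq_right.mpr hpU]
    simp
  rw [Finset.sum_congr rfl hsum, Finset.sum_comm, mul_comm, ← smul_eq_mul]
  refine Finset.sum_le_card_nsmul _ _ _ fun v _ => ?_
  by_cases hv : ∃ A ∈ S, v ∈ privateVertices S A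
  · obtain ⟨A, hA, hvA⟩ := hv
    have hvA' := (mem_privateVertices.mp hvA).2
    rw [Finset.sum_eq_single_of_mem A hA]
    · split_ifs <;> simp
    · intro B hB hBA
      have hvB : v ∉ B := fun h => hBA (hvA' B hB h)
      simp [hvB, mem_privateVertices]
  · push Not at hv
    rw [Finset.sum_congr rfl fun A hA => by rw [if_neg (hv A hA), add_zero], Finset.sum_boole]
    exact card_filter_mem_le_two h3 hS v

theorem card_filter_privateVertices_eq_empty_le {S : Finset (Finset ℕ)}
    (h3 : ∀ A ∈ S, A.card = 3) (hS : NonFC (gen S)) :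
    (S.filter fun A => privateVertices S A = ∅).card ≤
      (S.filter fun A => 2 ≤ (privateVertices S A).card).card := by
  refine Finset.card_le_card_of_forall_subsingleton (Linked S) ?_ ?_
  · intro A hA
    simp only [Finset.mem_filter] at hA
    obtain ⟨K, hK, hpK, hAK⟩ := exists_linked h3 hS hA.1 hA.2
    exact ⟨K, Finset.mem_filter.mpr ⟨hK, hpK⟩, hAK⟩
  · rintro K hK A ⟨hA, hAK⟩ A' ⟨hA', hAK'⟩
    simp only [Finset.mem_filter] at hK hA hA'
    exact linked_subsingleton h3 hS hA.1 hA'.1 hK.1 hA.2 hA'.2 hK.2 hAK hAK'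

theorem card_le_sum_card_privateVertices {S : Finset (Finset ℕ)} (h3 : ∀ A ∈ S, A.card = 3)
    (hS : NonFC (gen S)) : S.card ≤ ∑ A ∈ S, (privateVertices S A).card := by
  have hle : ∑ A ∈ S, (1 + if 2 ≤ (privateVertices S A).card then 1 else 0) ≤
      ∑ A ∈ S, ((privateVertices S A).card + if privateVertices S A = ∅ then 1 else 0) := by
    refine Finset.sum_le_sum fun A _ => ?_
    have := Finset.card_eq_zero (s := privateVertices S A)
    split_ifs <;> grind
  have := card_filter_privateVertices_eq_empty_le h3 hS
  rw [Finset.sum_add_distrib, Finset.sum_add_distrib, Finset.sum_boole, Finset.sum_boole,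
    Finset.sum_const, smul_eq_mul, mul_one] at hle
  simp only [Nat.cast_id] at hle
  omega

/-- NFC(3,n) ≤ n/2 for all n ≥ 4. -/
theorem nfc_upper_bound (n : ℕ) (hn : 4 ≤ n) (S : Finset (Finset ℕ))
    (h3 : ∀ A ∈ S, A.card = 3) (hU : famU S = Finset.Icc 1 n)
    (hnfc : NonFC (gen S)) :
    2 * S.card ≤ n := by
  have h1 := sum_card_add_card_privateVertices_le h3 hnfc
  have h2 := card_le_sum_card_privateVertices h3 hnfc
  rw [Finset.sum_add_distrib, Finset.sum_congr rfl h3, Finset.sum_const, smul_eq_mul, hU,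
    Nat.card_Icc] at h1
  omega
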